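/- Let λ: ℝ → (0,∞) satisfy the admissibility condition. There exist constants C > 0 and M ≥ 0 such that ‖Op_ħ(a)‖_{L²(dq)→L²(dq)} ≤ C (‖a‖_{L^∞(ℝ^{3n})} + ħ^{1/2} |a|_{λ:M,0,0,t}) for all t ∈ [0,1], all a ∈ BS^0_0(λ;t) and all ħ ∈ (0,1] (semiclassical L² bound). -/

import Mathlib

open MeasureTheory Real
open scoped BigOperators Classical

noncomputable section

/-- Points of `ℝⁿ`. The coordinate `q 0` plays the role of the radial variable `r`,
the remaining coordinates are the angular variables `θ`. -/
abbrev Vec (n : ℕ) := Fin n → ℝ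

/-- Complex-valued partial derivative in the coordinate direction `i`. -/
def pdC {n : ℕ} (i : Fin n) (f : Vec n → ℂ) : Vec n → ℂ :=
  fun x => fderiv ℝ f x (Pi.single i 1)

/-- Iterated (multiindex) partial derivative `∂^A f`. -/
def mpd {n : ℕ} (A : Fin n → ℕ) (f : Vec n → ℂ) : Vec n → ℂ :=
  (List.finRange n).foldr (fun i g => (pdC i)^[A i] g) f

/-- Real-valued partial derivative in the coordinate direction `i`. -/
def pdR {n : ℕ} (i : Fin n) (f : Vec n → ℝ) : Vec n → ℝ :=
  fun x => fderiv ℝ f x (Pi.single i 1)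

/-- Iterated (multiindex) partial derivative, real valued. -/
def mpdR {n : ℕ} (A : Fin n → ℕ) (f : Vec n → ℝ) : Vec n → ℝ :=
  (List.finRange n).foldr (fun i g => (pdR i)^[A i] g) f

/-- Total length `|A| = α₀ + |α|` of a multiindex. -/
def fullLen {n : ℕ} (A : Fin n → ℕ) : ℕ := ∑ i, A i

/-- Angular length `|α|` of a multiindex `A = (α₀, α)`. -/
def angLen {n : ℕ} [NeZero n] (A : Fin n → ℕ) : ℕ := ∑ i, if i = 0 then 0 else A i

/-- The weighted Japanese bracket `⟨ρ ⊕ μ⁻¹ η⟩ = (1 + ρ² + μ⁻²|η|²)^(1/2)`,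
where `ρ = p 0` and `η` are the remaining coordinates of `p`. -/
def jbr {n : ℕ} [NeZero n] (μ : ℝ) (p : Vec n) : ℝ :=
  Real.sqrt (1 + ∑ i, (if i = 0 then p i else μ⁻¹ * p i) ^ 2)

/-- Derivative `∂_q^A` of a function `a(q, p)` in the first slot. -/
def dqS {n : ℕ} (A : Fin n → ℕ) (a : Vec n → Vec n → ℂ) : Vec n → Vec n → ℂ :=
  fun q p => mpd A (fun x => a x p) q

/-- Derivative `∂_p^B` of a function `a(q, p)` in the second slot. -/
def dpS {n : ℕ} (B : Fin n → ℕ) (a : Vec n → Vec n → ℂ) : Vec n → Vec n → ℂ :=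
  fun q p => mpd B (fun x => a q x) p

/-- Derivative `∂_q^A` of a function `a(q, p, q')` in the first slot. -/
def d1B {n : ℕ} (A : Fin n → ℕ) (a : Vec n → Vec n → Vec n → ℂ) :
    Vec n → Vec n → Vec n → ℂ :=
  fun q p q' => mpd A (fun x => a x p q') q

/-- Derivative `∂_p^B` of a function `a(q, p, q')` in the second slot. -/
def d2B {n : ℕ} (B : Fin n → ℕ) (a : Vec n → Vec n → Vec n → ℂ) :
    Vec n → Vec n → Vec n → ℂ :=
  fun q p q' => mpd B (fun x => a q x q') p

/-- Derivative `∂_{q'}^{A'}` of a function `a(q, p, q')` in the third slot. -/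
def d3B {n : ℕ} (A' : Fin n → ℕ) (a : Vec n → Vec n → Vec n → ℂ) :
    Vec n → Vec n → Vec n → ℂ :=
  fun q p q' => mpd A' (fun x => a q p x) q'

/-- The admissibility condition for the weight `λ : ℝ → (0,∞)`:
`λ` is positive and `C₀⁻¹ ≤ λ(r)/λ(r') ≤ C₀` whenever `|r - r'| ≤ 1`. -/
def Admissible (lam : ℝ → ℝ) : Prop :=
  (∀ r, 0 < lam r) ∧
  ∃ C > 0, ∀ r r' : ℝ, |r - r'| ≤ 1 → C⁻¹ ≤ lam r / lam r' ∧ lam r / lam r' ≤ C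

/-- The symbol class `S^m_σ(λ)`:  `a` is smooth on `ℝ^{2n}` and for all multiindices
`A = (α₀, α)`, `B = (β₀, β)`,
`|(λ(r)⁻¹∂_θ)^α (λ(r)∂_η)^β ∂_r^{α₀} ∂_ρ^{β₀} a(q,p)| ≤ C ⟨ρ ⊕ λ(r)⁻¹η⟩^{m - σ|B|}`.
(The weights `λ(r)^{±1}` commute with the `θ`- and `η`-derivatives, so the weighted
derivative equals `λ(r)^{|β| - |α|}` times the plain mixed partial derivative.) -/
def IsSymbol {n : ℕ} [NeZero n] (lam : ℝ → ℝ) (m σ : ℝ) (a : Vec n → Vec n → ℂ) : Prop :=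
  ContDiff ℝ (⊤ : ℕ∞) (fun x : Vec n × Vec n => a x.1 x.2) ∧
  ∀ A B : Fin n → ℕ, ∃ C > 0, ∀ q p : Vec n,
    lam (q 0) ^ ((angLen B : ℤ) - (angLen A : ℤ)) * ‖dqS A (dpS B a) q p‖
      ≤ C * jbr (lam (q 0)) p ^ (m - σ * (fullLen B : ℝ))

/-- The seminorm `|a|_{λ : M, m, σ}` on the symbol class `S^m_σ(λ)`. -/
def symSeminorm {n : ℕ} [NeZero n] (lam : ℝ → ℝ) (M : ℕ) (m σ : ℝ)
    (a : Vec n → Vec n → ℂ) : ℝ :=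
  ∑ A : Fin n → Fin (M + 1), ∑ B : Fin n → Fin (M + 1),
    if fullLen (fun i => (A i : ℕ)) + fullLen (fun i => (B i : ℕ)) ≤ M then
      ⨆ q : Vec n, ⨆ p : Vec n,
        jbr (lam (q 0)) p ^ (-m + σ * (fullLen (fun i => (B i : ℕ)) : ℝ)) *
          (lam (q 0) ^ ((angLen (fun i => (B i : ℕ)) : ℤ) - (angLen (fun i => (A i : ℕ)) : ℤ)) *
            ‖dqS (fun i => (A i : ℕ)) (dpS (fun i => (B i : ℕ)) a) q p‖)
    else 0

/-- `λ^t_{jk} := λ(tj + (1-t)k)`. -/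
def lamT (lam : ℝ → ℝ) (t : ℝ) (j k : ℤ) : ℝ := lam (t * j + (1 - t) * k)

/-- The bisymbol class `BS^m_σ(λ; t)`. -/
def IsBisymbol {n : ℕ} [NeZero n] (lam : ℝ → ℝ) (m σ t : ℝ)
    (a : Vec n → Vec n → Vec n → ℂ) : Prop :=
  ContDiff ℝ (⊤ : ℕ∞) (fun x : Vec n × Vec n × Vec n => a x.1 x.2.1 x.2.2) ∧
  ∀ A B A' : Fin n → ℕ, ∃ C > 0, ∀ (j k : ℤ) (q p q' : Vec n),
    |q 0 - (j : ℝ)| ≤ 1 → |q' 0 - (k : ℝ)| ≤ 1 →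
    lamT lam t j k ^ ((angLen B : ℤ) - (angLen A : ℤ) - (angLen A' : ℤ)) *
        ‖d1B A (d2B B (d3B A' a)) q p q'‖
      ≤ C * jbr (lamT lam t j k) p ^ (m - σ * (fullLen B : ℝ))

/-- The seminorm `|a|_{λ : M, m, σ, t}` on `BS^m_σ(λ; t)`. -/
def bisymSeminorm {n : ℕ} [NeZero n] (lam : ℝ → ℝ) (M : ℕ) (m σ t : ℝ)
    (a : Vec n → Vec n → Vec n → ℂ) : ℝ :=
  ∑ A : Fin n → Fin (M + 1), ∑ B : Fin n → Fin (M + 1), ∑ A' : Fin n → Fin (M + 1),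
    if fullLen (fun i => (A i : ℕ)) + fullLen (fun i => (B i : ℕ))
        + fullLen (fun i => (A' i : ℕ)) ≤ M then
      ⨆ j : ℤ, ⨆ k : ℤ, ⨆ q : Vec n, ⨆ p : Vec n, ⨆ q' : Vec n,
        if |q 0 - (j : ℝ)| ≤ 1 ∧ |q' 0 - (k : ℝ)| ≤ 1 then
          jbr (lamT lam t j k) p ^ (-m + σ * (fullLen (fun i => (B i : ℕ)) : ℝ)) *
            (lamT lam t j k ^ ((angLen (fun i => (B i : ℕ)) : ℤ)
                - (angLen (fun i => (A i : ℕ)) : ℤ) - (angLen (fun i => (A' i : ℕ)) : ℤ)) *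
              ‖d1B (fun i => (A i : ℕ)) (d2B (fun i => (B i : ℕ))
                  (d3B (fun i => (A' i : ℕ)) a)) q p q'‖)
        else 0
    else 0

/-- The plain bisymbol class `BS^m_σ(1)` (the case `λ ≡ 1`). -/
def IsBisymbolOne {n : ℕ} [NeZero n] (m σ : ℝ) (a : Vec n → Vec n → Vec n → ℂ) : Prop :=
  ContDiff ℝ (⊤ : ℕ∞) (fun x : Vec n × Vec n × Vec n => a x.1 x.2.1 x.2.2) ∧
  ∀ A B A' : Fin n → ℕ, ∃ C > 0, ∀ q p q' : Vec n,
    ‖d1B A (d2B B (d3B A' a)) q p q'‖ ≤ C * jbr 1 p ^ (m - σ * (fullLen B : ℝ))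

/-- The seminorm `|a|_{M, m, σ}` on `BS^m_σ(1)`. -/
def bisymSeminormOne {n : ℕ} [NeZero n] (M : ℕ) (m σ : ℝ)
    (a : Vec n → Vec n → Vec n → ℂ) : ℝ :=
  ∑ A : Fin n → Fin (M + 1), ∑ B : Fin n → Fin (M + 1), ∑ A' : Fin n → Fin (M + 1),
    if fullLen (fun i => (A i : ℕ)) + fullLen (fun i => (B i : ℕ))
        + fullLen (fun i => (A' i : ℕ)) ≤ M then
      ⨆ q : Vec n, ⨆ p : Vec n, ⨆ q' : Vec n,
        jbr 1 p ^ (-m + σ * (fullLen (fun i => (B i : ℕ)) : ℝ)) *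
          ‖d1B (fun i => (A i : ℕ)) (d2B (fun i => (B i : ℕ))
              (d3B (fun i => (A' i : ℕ)) a)) q p q'‖
    else 0

/-- The oscillatory phase `e^{i p · (q - q')}`. -/
def phase {n : ℕ} (p q q' : Vec n) : ℂ :=
  Complex.exp (Complex.I * ((∑ i, p i * (q i - q' i) : ℝ) : ℂ))

/-- The pseudodifferential operator `Op^g(a)` with bisymbol `a`, as an iterated integral:
`Op^g(a)u(q) = (2π)^{-n} g(q)^{-1/4} ∫ dp ∫ dq' a(q,p,q') e^{ip⋅(q-q')} u(q') g(q')^{1/4}`. -/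
def OpG {n : ℕ} (g : Vec n → ℝ) (a : Vec n → Vec n → Vec n → ℂ) (u : Vec n → ℂ) :
    Vec n → ℂ :=
  fun q => (((2 * Real.pi) ^ (-(n : ℤ)) : ℝ) : ℂ) * ((g q ^ (-(1 : ℝ) / 4) : ℝ) : ℂ) *
    ∫ p : Vec n, ∫ q' : Vec n,
      a q p q' * phase p q q' * u q' * ((g q' ^ ((1 : ℝ) / 4) : ℝ) : ℂ)

/-- The pseudodifferential operator `Op(a) = Op^1(a)` with bisymbol `a`. -/
def Op {n : ℕ} (a : Vec n → Vec n → Vec n → ℂ) (u : Vec n → ℂ) : Vec n → ℂ :=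
  fun q => (((2 * Real.pi) ^ (-(n : ℤ)) : ℝ) : ℂ) *
    ∫ p : Vec n, ∫ q' : Vec n, a q p q' * phase p q q' * u q'

/-- The `t`-quantization `Op^{g,t}(a)` of a symbol `a`. -/
def OpSt {n : ℕ} (g : Vec n → ℝ) (t : ℝ) (a : Vec n → Vec n → ℂ) (u : Vec n → ℂ) :
    Vec n → ℂ :=
  OpG g (fun q p q' => a (t • q + (1 - t) • q') p) u

/-- The quantization `Op(b)` of a symbol `b` (the case `t = 1`, `g ≡ 1`). -/
def OpSym {n : ℕ} (b : Vec n → Vec n → ℂ) (u : Vec n → ℂ) : Vec n → ℂ :=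
  Op (fun q p _ => b q p) u

/-- The `L²(g^{1/2}dq)` norm. -/
def L2g {n : ℕ} (g : Vec n → ℝ) (f : Vec n → ℂ) : ℝ :=
  Real.sqrt (∫ q : Vec n, ‖f q‖ ^ 2 * Real.sqrt (g q))

/-- The `L²(dq)` norm. -/
def L2 {n : ℕ} (f : Vec n → ℂ) : ℝ :=
  Real.sqrt (∫ q : Vec n, ‖f q‖ ^ 2)

end

noncomputable section

/-- The semiclassical quantization `Op_ħ(a) := Op(a(q, ħp, q'))`. -/
def Oph {n : ℕ} (h : ℝ) (a : Vec n → Vec n → Vec n → ℂ) (u : Vec n → ℂ) : Vec n → ℂ :=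
  Op (fun q p q' => a q (h • p) q') u

/-- The supremum norm `‖a‖_{L^∞(ℝ^{3n})}` of a bisymbol. -/
def biSup {n : ℕ} (a : Vec n → Vec n → Vec n → ℂ) : ℝ :=
  ⨆ q : Vec n, ⨆ p : Vec n, ⨆ q' : Vec n, ‖a q p q'‖

end

section DirectionalDerivatives

variable {E ι : Type*} [NormedAddCommGroup E] [NormedSpace ℝ E]

/-- The directional derivative of `f` along the constant vector field `v`. -/
noncomputable def dirD (v : E) (f : E → ℂ) : E → ℂ := fun X => fderiv ℝ f X v

/-- Iterated directional derivatives along the vectors `e i`, `i` running through a list. -/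
noncomputable def itD (e : ι → E) (l : List ι) (f : E → ℂ) : E → ℂ :=
  l.foldr (fun i g => dirD (e i) g) f

/-- The operator `1 + ∂_v`. -/
noncomputable def addD (v : E) (f : E → ℂ) : E → ℂ := fun X => f X + dirD v f X

/-- The composition of the operators `1 + ∂_{e i}`, `i` running through a list. -/
noncomputable def itAddD (e : ι → E) (l : List ι) (f : E → ℂ) : E → ℂ :=
  l.foldr (fun i g => addD (e i) g) f

/-- All iterated derivatives of `f` of order at most `N` are bounded by `A` at the point `X`. -/
def BdAt (e : ι → E) (N : ℕ) (f : E → ℂ) (X : E) (A : ℝ) : Prop :=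
  ∀ l : List ι, l.length ≤ N → ‖itD e l f X‖ ≤ A

@[simp] lemma itD_nil (e : ι → E) (f : E → ℂ) : itD e [] f = f := rfl

@[simp] lemma itD_cons (e : ι → E) (i : ι) (l : List ι) (f : E → ℂ) :
    itD e (i :: l) f = dirD (e i) (itD e l f) := rfl

lemma itD_append (e : ι → E) (l l' : List ι) (f : E → ℂ) :
    itD e (l ++ l') f = itD e l (itD e l' f) := by
  simp [itD, List.foldr_append]

@[simp] lemma itAddD_nil (e : ι → E) (f : E → ℂ) : itAddD e [] f = f := rfl

@[simp] lemma itAddD_cons (e : ι → E) (i : ι) (l : List ι) (f : E → ℂ) :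
    itAddD e (i :: l) f = addD (e i) (itAddD e l f) := rfl

lemma itAddD_append (e : ι → E) (l l' : List ι) (f : E → ℂ) :
    itAddD e (l ++ l') f = itAddD e l (itAddD e l' f) := by
  simp [itAddD, List.foldr_append]

lemma contDiff_dirD {f : E → ℂ} (hf : ContDiff ℝ (⊤ : ℕ∞) f) (v : E) :
    ContDiff ℝ (⊤ : ℕ∞) (dirD v f) :=
  (hf.fderiv_right (m := (⊤ : ℕ∞)) (by simp)).clm_apply contDiff_const

lemma contDiff_addD {f : E → ℂ} (hf : ContDiff ℝ (⊤ : ℕ∞) f) (v : E) :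
    ContDiff ℝ (⊤ : ℕ∞) (addD v f) :=
  hf.add (contDiff_dirD hf v)

lemma contDiff_itD {f : E → ℂ} (hf : ContDiff ℝ (⊤ : ℕ∞) f) (e : ι → E) (l : List ι) :
    ContDiff ℝ (⊤ : ℕ∞) (itD e l f) := by
  induction l with
  | nil => exact hf
  | cons i l ih => exact contDiff_dirD ih _

lemma contDiff_itAddD {f : E → ℂ} (hf : ContDiff ℝ (⊤ : ℕ∞) f) (e : ι → E) (l : List ι) :
    ContDiff ℝ (⊤ : ℕ∞) (itAddD e l f) := by
  induction l with
  | nil => exact hf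
  | cons i l ih => exact contDiff_addD ih _

lemma smooth_differentiable {F : Type*} [NormedAddCommGroup F] [NormedSpace ℝ F] {f : E → F}
    (hf : ContDiff ℝ (⊤ : ℕ∞) f) : Differentiable ℝ f :=
  hf.differentiable (by simp)

lemma dirD_add {f g : E → ℂ} (hf : ContDiff ℝ (⊤ : ℕ∞) f) (hg : ContDiff ℝ (⊤ : ℕ∞) g) (v : E) :
    dirD v (fun X => f X + g X) = fun X => dirD v f X + dirD v g X := by
  funext X
  simp [dirD, fderiv_fun_add (smooth_differentiable hf X) (smooth_differentiable hg X)]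

lemma dirD_mul {f g : E → ℂ} (hf : ContDiff ℝ (⊤ : ℕ∞) f) (hg : ContDiff ℝ (⊤ : ℕ∞) g) (v : E) :
    dirD v (fun X => f X * g X) = fun X => f X * dirD v g X + dirD v f X * g X := by
  funext X
  simp [dirD, fderiv_fun_mul (smooth_differentiable hf X) (smooth_differentiable hg X), mul_comm]

lemma itD_add {f g : E → ℂ} (hf : ContDiff ℝ (⊤ : ℕ∞) f) (hg : ContDiff ℝ (⊤ : ℕ∞) g)
    (e : ι → E) (l : List ι) :
    itD e l (fun X => f X + g X) = fun X => itD e l f X + itD e l g X := by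
  induction l with
  | nil => rfl
  | cons i l ih => simp only [itD_cons, ih, dirD_add (contDiff_itD hf e l) (contDiff_itD hg e l)]

lemma BdAt.nonneg {e : ι → E} {N : ℕ} {f : E → ℂ} {X : E} {A : ℝ} (h : BdAt e N f X A) : 0 ≤ A :=
  (norm_nonneg _).trans (h [] (by simp))

lemma BdAt.norm_le {e : ι → E} {N : ℕ} {f : E → ℂ} {X : E} {A : ℝ} (h : BdAt e N f X A) :
    ‖f X‖ ≤ A := h [] (by simp)

lemma BdAt.mono {e : ι → E} {N N' : ℕ} {f : E → ℂ} {X : E} {A A' : ℝ} (h : BdAt e N f X A)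
    (hN : N' ≤ N) (hA : A ≤ A') : BdAt e N' f X A' :=
  fun l hl => (h l (hl.trans hN)).trans hA

lemma BdAt.dirD {e : ι → E} {N : ℕ} {f : E → ℂ} {X : E} {A : ℝ} (h : BdAt e (N + 1) f X A)
    (i : ι) : BdAt e N (dirD (e i) f) X A := by
  intro l hl
  have := h (l ++ [i]) (by simpa using hl)
  rwa [itD_append] at this

lemma BdAt.add {e : ι → E} {N : ℕ} {f g : E → ℂ} {X : E} {A B : ℝ}
    (hf : ContDiff ℝ (⊤ : ℕ∞) f) (hg : ContDiff ℝ (⊤ : ℕ∞) g)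
    (h : BdAt e N f X A) (h' : BdAt e N g X B) : BdAt e N (fun X => f X + g X) X (A + B) := by
  intro l hl
  rw [itD_add hf hg]
  exact (norm_add_le _ _).trans (add_le_add (h l hl) (h' l hl))

lemma BdAt.mul {e : ι → E} {N : ℕ} {f g : E → ℂ} {X : E} {A B : ℝ}
    (hf : ContDiff ℝ (⊤ : ℕ∞) f) (hg : ContDiff ℝ (⊤ : ℕ∞) g)
    (h : BdAt e N f X A) (h' : BdAt e N g X B) :
    BdAt e N (fun X => f X * g X) X (2 ^ N * (A * B)) := by
  induction N generalizing f g with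
  | zero =>
    intro l hl
    have : l = [] := by simpa using hl
    subst this
    simpa using mul_le_mul h.norm_le h'.norm_le (norm_nonneg _) h.nonneg
  | succ N ih =>
    intro l hl
    have hAB : 0 ≤ A * B := mul_nonneg h.nonneg h'.nonneg
    rcases List.eq_nil_or_concat l with rfl | ⟨l', i, rfl⟩
    · have h1 := mul_le_mul h.norm_le h'.norm_le (norm_nonneg _) h.nonneg
      have h2 : (1 : ℝ) ≤ 2 ^ (N + 1) := one_le_pow₀ (by norm_num)
      simp only [itD_nil, norm_mul]
      nlinarith
    · rw [List.concat_eq_append] at hl ⊢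
      rw [itD_append, itD_cons, itD_nil, dirD_mul hf hg]
      have h1 := ih hf (contDiff_dirD hg (e i)) (h.mono (Nat.le_succ N) le_rfl) (h'.dirD i)
      have h2 := ih (contDiff_dirD hf (e i)) hg (h.dirD i) (h'.mono (Nat.le_succ N) le_rfl)
      have h3 := BdAt.add (hf.mul (contDiff_dirD hg (e i))) ((contDiff_dirD hf (e i)).mul hg) h1 h2
      refine (h3 l' (by simpa using hl)).trans (le_of_eq ?_)
      ring

lemma BdAt.addD {e : ι → E} {N : ℕ} {f : E → ℂ} {X : E} {A : ℝ} (hf : ContDiff ℝ (⊤ : ℕ∞) f)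
    (h : BdAt e (N + 1) f X A) (i : ι) : BdAt e N (addD (e i) f) X (2 * A) := by
  have := BdAt.add hf (contDiff_dirD hf (e i)) (h.mono (Nat.le_succ N) le_rfl) (h.dirD i)
  rwa [← two_mul] at this

lemma BdAt.itAddD {e : ι → E} {N : ℕ} {f : E → ℂ} {X : E} {A : ℝ} (hf : ContDiff ℝ (⊤ : ℕ∞) f)
    (l : List ι) (h : BdAt e (N + l.length) f X A) :
    BdAt e N (itAddD e l f) X (2 ^ l.length * A) := by
  induction l generalizing N with
  | nil => simpa using h
  | cons i l ih =>
    have h1 := ih (N := N + 1) (h.mono (by simp; omega) le_rfl)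
    have := BdAt.addD (contDiff_itAddD hf e l) h1 i
    refine this.mono le_rfl (le_of_eq ?_)
    simp only [List.length_cons]; ring

lemma itD_const (e : ι → E) (c : ℂ) (l : List ι) (hl : l ≠ []) :
    itD e l (fun _ => c) = fun _ => 0 := by
  induction l with
  | nil => exact absurd rfl hl
  | cons i l ih =>
    by_cases h : l = []
    · subst h; funext X; simp [dirD]
    · rw [itD_cons, ih h]; funext X; simp [dirD]

lemma BdAt.one (e : ι → E) (N : ℕ) (X : E) : BdAt e N (fun _ => 1) X 1 := by
  intro l _
  by_cases h : l = []
  · subst h; simp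
  · rw [itD_const e 1 l h]; simp

lemma BdAt.prod {κ : Type*} {e : ι → E} {N : ℕ} (s : Finset κ) {f : κ → E → ℂ} {X : E} {A : κ → ℝ}
    (hf : ∀ j, ContDiff ℝ (⊤ : ℕ∞) (f j)) (h : ∀ j, BdAt e N (f j) X (A j)) :
    BdAt e N (fun X => ∏ j ∈ s, f j X) X ((2 ^ N) ^ s.card * ∏ j ∈ s, A j) := by
  induction s using Finset.induction_on with
  | empty => simpa using BdAt.one e N X
  | insert a s ha ih =>
    simp only [Finset.prod_insert ha, Finset.card_insert_of_notMem ha]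
    refine (BdAt.mul (hf a) (contDiff_prod fun j _ => hf j) (h a) ih).mono le_rfl (le_of_eq ?_)
    ring

lemma itD_comp_linear {φ : ℝ → ℂ} (hφ : ContDiff ℝ (⊤ : ℕ∞) φ) (L : E →L[ℝ] ℝ) (b : ℝ)
    (e : ι → E) (l : List ι) :
    itD e l (fun X => φ (L X + b)) =
      fun X => ((l.map fun i => L (e i)).prod : ℝ) * iteratedDeriv l.length φ (L X + b) := by
  induction l with
  | nil => simp
  | cons i l ih =>
    rw [itD_cons, ih]
    funext X
    have hd : Differentiable ℝ (iteratedDeriv l.length φ) :=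
      hφ.differentiable_iteratedDeriv _ (by exact_mod_cast WithTop.coe_lt_top _)
    have h1 : HasFDerivAt (fun X => L X + b) L X := L.hasFDerivAt.add_const b
    have h2 := (hd (L X + b)).hasFDerivAt.comp X h1
    have h3 := h2.const_mul (((l.map fun i => L (e i)).prod : ℝ) : ℂ)
    rw [dirD]
    erw [h3.fderiv]
    simp only [smul_apply, ContinuousLinearMap.comp_apply, smul_eq_mul,
      fderiv_eq_smul_deriv, List.map_cons, List.prod_cons, List.length_cons, iteratedDeriv_succ,
      Complex.real_smul, Complex.ofReal_mul]
    ring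

lemma BdAt.comp_linear {φ : ℝ → ℂ} (hφ : ContDiff ℝ (⊤ : ℕ∞) φ) (L : E →L[ℝ] ℝ) (b : ℝ)
    {e : ι → E} (hL : ∀ i, |L (e i)| ≤ 1) {N : ℕ} {X : E} {A : ℝ}
    (hA : ∀ m ≤ N, ‖iteratedDeriv m φ (L X + b)‖ ≤ A) :
    BdAt e N (fun X => φ (L X + b)) X A := by
  intro l hl
  rw [itD_comp_linear hφ]
  have h1 : ∀ l : List ι, |(l.map fun i => L (e i)).prod| ≤ 1 := by
    intro l
    induction l with
    | nil => simp
    | cons i l ih =>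
      simp only [List.map_cons, List.prod_cons, abs_mul]
      exact mul_le_one₀ (hL i) (abs_nonneg _) ih
  simp only [norm_mul, Complex.norm_real, Real.norm_eq_abs]
  calc _ ≤ 1 * ‖iteratedDeriv l.length φ (L X + b)‖ :=
        mul_le_mul_of_nonneg_right (h1 l) (norm_nonneg _)
    _ ≤ A := by rw [one_mul]; exact hA _ hl

lemma itD_comp_scaling {f : E → ℂ} (hf : ContDiff ℝ (⊤ : ℕ∞) f) (S : E →L[ℝ] E) (e : ι → E)
    (s : ι → ℝ) (hS : ∀ i, S (e i) = s i • e i) (l : List ι) :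
    itD e l (fun X => f (S X)) = fun X => ((l.map s).prod : ℝ) * itD e l f (S X) := by
  induction l with
  | nil => simp
  | cons i l ih =>
    rw [itD_cons, ih]
    funext X
    have hd := (smooth_differentiable (contDiff_itD hf e l) (S X)).hasFDerivAt
    have h3 := (hd.comp X S.hasFDerivAt).const_mul (((l.map s).prod : ℝ) : ℂ)
    rw [dirD]
    erw [h3.fderiv]
    simp [hS, dirD]
    ring

lemma itD_eq_zero_of_eventuallyEq (e : ι → E) {f : E → ℂ} {X : E}
    (h : f =ᶠ[nhds X] fun _ => 0) (l : List ι) : itD e l f X = 0 := by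
  have : itD e l f =ᶠ[nhds X] fun _ => 0 := by
    induction l with
    | nil => exact h
    | cons i l ih =>
      filter_upwards [ih.eventuallyEq_nhds] with Y hY
      rw [itD_cons, dirD, hY.fderiv_eq]; simp
  exact this.eq_of_nhds

lemma dirD_comm {f : E → ℂ} (hf : ContDiff ℝ (⊤ : ℕ∞) f) (v w : E) :
    dirD v (dirD w f) = dirD w (dirD v f) := by
  funext X
  have hd : Differentiable ℝ (fderiv ℝ f) :=
    smooth_differentiable (hf.fderiv_right (m := (⊤ : ℕ∞)) (by simp))
  have h : ∀ v w, dirD v (dirD w f) X = fderiv ℝ (fderiv ℝ f) X v w := by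
    intro v w
    have := (hd X).hasFDerivAt.clm_apply (hasFDerivAt_const w X)
    rw [dirD]
    erw [this.fderiv]
    simp
  rw [h, h]
  exact (hf.contDiffAt.isSymmSndFDerivAt (by
    rw [minSmoothness_of_isRCLikeNormedField]; exact WithTop.coe_le_coe.2 (le_top : (2 : ℕ∞) ≤ ⊤))) v w

lemma itD_perm {f : E → ℂ} (hf : ContDiff ℝ (⊤ : ℕ∞) f) (e : ι → E) {l l' : List ι}
    (h : l.Perm l') : itD e l f = itD e l' f := by
  induction h with
  | nil => rfl
  | cons i _ ih => rw [itD_cons, itD_cons, ih]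
  | swap i j l => simp only [itD_cons]; exact dirD_comm (contDiff_itD hf e l) _ _
  | trans _ _ h1 h2 => exact h1.trans h2

end DirectionalDerivatives

section SchurAndPlancherel

open scoped ENNReal

lemma two_mul_le_weighted_sq (s : ℝ≥0∞) (hs : s ≠ 0) (hs' : s ≠ ⊤) (a b : ℝ≥0∞) :
    2 * (a * b) ≤ s * a ^ 2 + s⁻¹ * b ^ 2 := by
  have hsi : s⁻¹ ≠ 0 := ENNReal.inv_ne_zero.2 hs'
  by_cases ha : a = ⊤
  · subst ha; simp [ENNReal.mul_top hs]
  by_cases hb : b = ⊤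
  · subst hb; simp [ENNReal.mul_top hsi]
  lift s to NNReal using hs'
  lift a to NNReal using ha
  lift b to NNReal using hb
  have hs0 : s ≠ 0 := by simpa using hs
  rw [← ENNReal.coe_inv hs0]
  norm_cast
  have hsp : (0 : ℝ) < s := by positivity
  have h : (0 : ℝ) ≤ (s : ℝ)⁻¹ * ((s : ℝ) * a - b) ^ 2 := by positivity
  have h2 : (s : ℝ)⁻¹ * ((s : ℝ) * a - b) ^ 2 = s * a ^ 2 + (s : ℝ)⁻¹ * b ^ 2 - 2 * (a * b) := by
    field_simp; ring
  rw [← NNReal.coe_le_coe]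
  push_cast
  linarith

/-- Schur's test for a convolution kernel, in additive form. -/
lemma schur_convolution {n : ℕ} {K a b : Vec n → ℝ≥0∞} (hK : Measurable K) (ha : Measurable a)
    (hb : Measurable b) (s : ℝ≥0∞) (hs : s ≠ 0) (hs' : s ≠ ⊤) :
    2 * ∫⁻ x, ∫⁻ y, K (x - y) * (a x * b y)
      ≤ (∫⁻ z, K z) * (s * (∫⁻ x, a x ^ 2) + s⁻¹ * ∫⁻ y, b y ^ 2) := by
  have hm : Measurable fun p : Vec n × Vec n => K (p.1 - p.2) :=
    hK.comp (measurable_fst.sub measurable_snd)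
  calc 2 * ∫⁻ x, ∫⁻ y, K (x - y) * (a x * b y)
      = ∫⁻ x, ∫⁻ y, K (x - y) * (2 * (a x * b y)) := by
        rw [← lintegral_const_mul' _ _ (by simp)]
        refine lintegral_congr fun x => ?_
        rw [← lintegral_const_mul' _ _ (by simp)]
        exact lintegral_congr fun y => by ring
    _ ≤ ∫⁻ x, ∫⁻ y, (K (x - y) * (s * a x ^ 2) + K (x - y) * (s⁻¹ * b y ^ 2)) := by
        refine lintegral_mono fun x => lintegral_mono fun y => ?_
        rw [← mul_add]
        exact mul_le_mul_right (two_mul_le_weighted_sq s hs hs' _ _) _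
    _ = (∫⁻ x, ∫⁻ y, K (x - y) * (s * a x ^ 2)) + ∫⁻ x, ∫⁻ y, K (x - y) * (s⁻¹ * b y ^ 2) := by
        rw [← lintegral_add_left]
        · refine lintegral_congr fun x => ?_
          rw [lintegral_add_left]
          exact (hK.comp (measurable_const.sub measurable_id)).mul_const _
        · exact Measurable.lintegral_prod_right'
            (f := fun p : Vec n × Vec n => K (p.1 - p.2) * (s * a p.1 ^ 2))
            (hm.mul (((ha.comp measurable_fst).pow_const 2).const_mul s))
    _ = (∫⁻ z, K z) * (s * (∫⁻ x, a x ^ 2) + s⁻¹ * ∫⁻ y, b y ^ 2) := by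
        rw [lintegral_lintegral_swap (f := fun x y => K (x - y) * (s⁻¹ * b y ^ 2))]
        · have h1 : ∀ x, ∫⁻ y, K (x - y) * (s * a x ^ 2) = (∫⁻ z, K z) * (s * a x ^ 2) := by
            intro x
            rw [lintegral_mul_const, lintegral_sub_left_eq_self K x]
            exact hK.comp (measurable_const.sub measurable_id)
          have h2 : ∀ y, ∫⁻ x, K (x - y) * (s⁻¹ * b y ^ 2) = (∫⁻ z, K z) * (s⁻¹ * b y ^ 2) := by
            intro y
            rw [lintegral_mul_const, lintegral_sub_right_eq_self K y]
            exact hK.comp (measurable_id.sub measurable_const)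
          simp_rw [h1, h2]
          rw [lintegral_const_mul _ ((ha.pow_const 2).const_mul s),
            lintegral_const_mul _ ((hb.pow_const 2).const_mul s⁻¹),
            lintegral_const_mul _ (ha.pow_const 2), lintegral_const_mul _ (hb.pow_const 2), mul_add]
        · exact (hm.mul (((hb.comp measurable_snd).pow_const 2).const_mul s⁻¹)).aemeasurable

/-- The Gaussian `exp(-δ|ξ|²)` on `ℝⁿ`. -/
noncomputable def gaussW {n : ℕ} (δ : ℝ) (ξ : Vec n) : ℝ := ∏ i, rexp (-δ * ξ i ^ 2)

/-- The Fourier transform of `gaussW δ`. -/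
noncomputable def gaussHat {n : ℕ} (δ : ℝ) (z : Vec n) : ℝ :=
  ∏ i, (√(π / δ) * rexp (-(1 / (4 * δ)) * z i ^ 2))

/-- The character `e^{i x·ξ}`. -/
noncomputable def chr {n : ℕ} (x ξ : Vec n) : ℂ :=
  Complex.exp (Complex.I * ((∑ i, ξ i * x i : ℝ) : ℂ))

lemma norm_chr {n : ℕ} (x ξ : Vec n) : ‖chr x ξ‖ = 1 := by
  rw [chr, mul_comm, Complex.norm_exp_ofReal_mul_I]

lemma chr_add {n : ℕ} (x y ξ : Vec n) : chr (x + y) ξ = chr x ξ * chr y ξ := by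
  rw [chr, chr, chr, ← Complex.exp_add, ← mul_add, ← Complex.ofReal_add, ← Finset.sum_add_distrib]
  simp [mul_add]

lemma chr_neg {n : ℕ} (x ξ : Vec n) : chr (-x) ξ = starRingEnd ℂ (chr x ξ) := by
  rw [chr, chr, ← Complex.exp_conj]
  simp

lemma continuous_chr {n : ℕ} : Continuous fun p : Vec n × Vec n => chr p.1 p.2 := by
  unfold chr; fun_prop

lemma integrable_gaussW {n : ℕ} {δ : ℝ} (hδ : 0 < δ) : Integrable (gaussW (n := n) δ) :=
  Integrable.fintype_prod (f := fun _ (x : ℝ) => rexp (-δ * x ^ 2))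
    fun _ => integrable_exp_neg_mul_sq hδ

lemma integrable_gaussHat {n : ℕ} {δ : ℝ} (hδ : 0 < δ) : Integrable (gaussHat (n := n) δ) :=
  Integrable.fintype_prod (f := fun _ (x : ℝ) => √(π / δ) * rexp (-(1 / (4 * δ)) * x ^ 2))
    fun _ => (integrable_exp_neg_mul_sq (by positivity)).const_mul _

lemma integral_gaussHat {n : ℕ} {δ : ℝ} (hδ : 0 < δ) : ∫ z, gaussHat (n := n) δ z = (2 * π) ^ n := by
  unfold gaussHat
  rw [integral_fintype_prod_volume_eq_pow
    (fun (x : ℝ) => √(π / δ) * rexp (-(1 / (4 * δ)) * x ^ 2))]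
  rw [integral_const_mul, integral_gaussian]
  have : √(π / δ) * √(π / (1 / (4 * δ))) = 2 * π := by
    rw [← Real.sqrt_mul (by positivity)]
    rw [show π / δ * (π / (1 / (4 * δ))) = (2 * π) ^ 2 by field_simp; ring]
    exact Real.sqrt_sq (by positivity)
  rw [this, Fintype.card_fin]

lemma integral_gaussW_mul_chr {n : ℕ} {δ : ℝ} (hδ : 0 < δ) (z : Vec n) :
    ∫ ξ, (gaussW δ ξ : ℂ) * chr z ξ = (gaussHat δ z : ℂ) := by
  have h1 : ∀ ξ : Vec n, (gaussW δ ξ : ℂ) * chr z ξ =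
      ∏ i, (Complex.exp (Complex.I * (z i : ℂ) * (ξ i : ℂ)) * Complex.exp (-(δ : ℂ) * (ξ i : ℂ) ^ 2)) := by
    intro ξ
    rw [Finset.prod_mul_distrib, mul_comm, gaussW, chr, ← Complex.exp_sum]
    push_cast
    congr 1
    rw [Finset.mul_sum]
    exact congrArg _ (Finset.sum_congr rfl fun i _ => by ring)
  simp_rw [h1]
  rw [integral_fintype_prod_volume_eq_prod (f := fun i (x : ℝ) =>
    (Complex.exp (Complex.I * (z i : ℂ) * (x : ℂ)) * Complex.exp (-(δ : ℂ) * (x : ℂ) ^ 2)))]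
  rw [gaussHat, Complex.ofReal_prod]
  refine Finset.prod_congr rfl fun i _ => ?_
  rw [fourierIntegral_gaussian (by simpa using hδ)]
  push_cast
  congr 1
  · rw [Real.sqrt_eq_rpow, Complex.ofReal_cpow (by positivity)]; push_cast; rfl
  · congr 1; field_simp

lemma gaussW_nonneg {n : ℕ} (δ : ℝ) (ξ : Vec n) : 0 ≤ gaussW δ ξ :=
  Finset.prod_nonneg fun _ _ => (Real.exp_pos _).le

lemma gaussHat_nonneg {n : ℕ} (δ : ℝ) (ξ : Vec n) : 0 ≤ gaussHat δ ξ :=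
  Finset.prod_nonneg fun _ _ => by positivity

lemma continuous_gaussW {n : ℕ} (δ : ℝ) : Continuous (gaussW (n := n) δ) := by
  unfold gaussW; fun_prop

lemma continuous_gaussHat {n : ℕ} (δ : ℝ) : Continuous (gaussHat (n := n) δ) := by
  unfold gaussHat; fun_prop

lemma ofReal_norm_eq {a : ℝ} (ha : 0 ≤ a) : ENNReal.ofReal a = ‖(a : ℂ)‖ₑ := by
  rw [← ofReal_norm, Complex.norm_real, Real.norm_of_nonneg ha]

lemma lintegral_gaussW_mul_fourier_sq_le {n : ℕ} {g : Vec n → ℂ} (hgm : Measurable g)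
    (hg : Integrable g) {δ : ℝ} (hδ : 0 < δ) :
    ∫⁻ ξ, ENNReal.ofReal (gaussW δ ξ) * ‖∫ w, g w * chr w ξ‖ₑ ^ 2
      ≤ ENNReal.ofReal ((2 * π) ^ n) * ∫⁻ w, ‖g w‖ₑ ^ 2 := by
  set G : Vec n → ℂ := fun ξ => ∫ w, g w * chr w ξ with hG
  have hGm : Measurable G := by
    have : StronglyMeasurable fun p : Vec n × Vec n => g p.2 * chr p.2 p.1 :=
      ((hgm.comp measurable_snd).mul
        (continuous_chr.comp continuous_swap).measurable).stronglyMeasurable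
    exact this.integral_prod_right'.measurable
  have hsq : ∀ ξ, ((gaussW δ ξ * ‖G ξ‖ ^ 2 : ℝ) : ℂ) =
      ∫ p : Vec n × Vec n, (gaussW δ ξ : ℂ) * ((g p.1 * chr p.1 ξ) *
        starRingEnd ℂ (g p.2 * chr p.2 ξ)) := by
    intro ξ
    rw [integral_const_mul, Measure.volume_eq_prod,
      integral_prod_mul (fun w => g w * chr w ξ) (fun w => starRingEnd ℂ (g w * chr w ξ))]
    rw [integral_conj]
    push_cast
    rw [Complex.mul_conj, Complex.normSq_eq_norm_sq]
    push_cast; rfl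
  have hInt : Integrable (fun q : Vec n × (Vec n × Vec n) => (gaussW δ q.1 : ℂ) *
      ((g q.2.1 * chr q.2.1 q.1) * starRingEnd ℂ (g q.2.2 * chr q.2.2 q.1))) := by
    have h0 : Integrable (fun q : Vec n × (Vec n × Vec n) => gaussW δ q.1 *
        (‖g q.2.1‖ * ‖g q.2.2‖)) :=
      (integrable_gaussW hδ).mul_prod (hg.norm.mul_prod hg.norm)
    refine h0.mono' ?_ (Filter.Eventually.of_forall fun q => ?_)
    · have hc : ∀ i : Vec n × (Vec n × Vec n) → Vec n, Measurable i →
          Measurable fun q : Vec n × (Vec n × Vec n) => g (i q) * chr (i q) q.1 := fun i hi =>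
        (hgm.comp hi).mul (continuous_chr.measurable.comp (hi.prodMk measurable_fst))
      refine Measurable.aestronglyMeasurable ?_
      refine (Complex.measurable_ofReal.comp
        ((continuous_gaussW δ).measurable.comp measurable_fst)).mul ?_
      exact (hc _ (measurable_fst.comp measurable_snd)).mul
        (Complex.continuous_conj.measurable.comp (hc _ (measurable_snd.comp measurable_snd)))
    · simp [norm_chr, abs_of_nonneg (gaussW_nonneg δ q.1)]
  have hJint : Integrable (fun ξ => gaussW δ ξ * ‖G ξ‖ ^ 2) := by
    have := hInt.integral_prod_left
    simp_rw [← hsq] at this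
    exact (this.re).congr (Filter.Eventually.of_forall fun ξ => Complex.ofReal_re _)
  have hJ : ((∫ ξ, gaussW δ ξ * ‖G ξ‖ ^ 2 : ℝ) : ℂ) =
      ∫ x, ∫ y, (gaussHat δ (x - y) : ℂ) * (g x * starRingEnd ℂ (g y)) := by
    rw [← integral_complex_ofReal]
    simp_rw [hsq]
    rw [integral_integral_swap hInt]
    have hp : ∀ p : Vec n × Vec n, ∫ ξ, (gaussW δ ξ : ℂ) * ((g p.1 * chr p.1 ξ) *
        starRingEnd ℂ (g p.2 * chr p.2 ξ)) =
        (gaussHat δ (p.1 - p.2) : ℂ) * (g p.1 * starRingEnd ℂ (g p.2)) := by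
      intro p
      rw [← integral_gaussW_mul_chr hδ, ← integral_mul_const]
      refine integral_congr_ae (Filter.Eventually.of_forall fun ξ => ?_)
      simp only [sub_eq_add_neg, chr_add, chr_neg, map_mul]
      ring
    simp_rw [hp]
    have hint2 : Integrable (fun p : Vec n × Vec n =>
        (gaussHat δ (p.1 - p.2) : ℂ) * (g p.1 * starRingEnd ℂ (g p.2))) := by
      have := hInt.integral_prod_right
      refine this.congr (Filter.Eventually.of_forall fun p => ?_)
      exact hp p
    exact integral_prod _ hint2
  have hmain : ENNReal.ofReal (∫ ξ, gaussW δ ξ * ‖G ξ‖ ^ 2) ≤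
      ∫⁻ x, ∫⁻ y, ENNReal.ofReal (gaussHat δ (x - y)) * (‖g x‖ₑ * ‖g y‖ₑ) := by
    rw [ofReal_norm_eq (integral_nonneg fun ξ => mul_nonneg (gaussW_nonneg δ ξ) (sq_nonneg _)), hJ]
    refine (enorm_integral_le_lintegral_enorm _).trans (lintegral_mono fun x => ?_)
    refine (enorm_integral_le_lintegral_enorm _).trans (lintegral_mono fun y => ?_)
    simp only [enorm_mul, ← ofReal_norm_eq (gaussHat_nonneg δ (x - y))]
    rw [RCLike.enorm_conj]
  have hschur := schur_convolution (K := fun z => ENNReal.ofReal (gaussHat δ z))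
    (continuous_gaussHat δ).measurable.ennreal_ofReal hgm.enorm hgm.enorm 1 one_ne_zero
    ENNReal.one_ne_top
  rw [← ofReal_integral_eq_lintegral_ofReal (integrable_gaussHat hδ)
    (Filter.Eventually.of_forall (gaussHat_nonneg δ)), integral_gaussHat hδ] at hschur
  have hL : ∫⁻ ξ, ENNReal.ofReal (gaussW δ ξ) * ‖G ξ‖ₑ ^ 2 =
      ENNReal.ofReal (∫ ξ, gaussW δ ξ * ‖G ξ‖ ^ 2) := by
    rw [ofReal_integral_eq_lintegral_ofReal hJint (Filter.Eventually.of_forall fun ξ =>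
      mul_nonneg (gaussW_nonneg δ ξ) (sq_nonneg _))]
    refine lintegral_congr fun ξ => ?_
    rw [ENNReal.ofReal_mul (gaussW_nonneg δ ξ), ENNReal.ofReal_pow (norm_nonneg _),
      ofReal_norm]
  rw [hL]
  refine hmain.trans ?_
  have h2 : 2 * ∫⁻ x, ∫⁻ y, ENNReal.ofReal (gaussHat δ (x - y)) * (‖g x‖ₑ * ‖g y‖ₑ) ≤
      2 * (ENNReal.ofReal ((2 * π) ^ n) * ∫⁻ w, ‖g w‖ₑ ^ 2) := by
    refine hschur.trans (le_of_eq ?_)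
    simp only [inv_one, one_mul]
    ring
  exact (ENNReal.mul_le_mul_iff_right (by simp) (by simp)).1 h2

/-- The Plancherel inequality for integrable functions. -/
lemma lintegral_fourier_sq_le {n : ℕ} {g : Vec n → ℂ} (hgm : Measurable g)
    (hg : Integrable g) :
    ∫⁻ ξ, ‖∫ w, g w * chr w ξ‖ₑ ^ 2 ≤ ENNReal.ofReal ((2 * π) ^ n) * ∫⁻ w, ‖g w‖ₑ ^ 2 := by
  set G : Vec n → ℂ := fun ξ => ∫ w, g w * chr w ξ with hG
  have hGm : Measurable G := by
    have : StronglyMeasurable fun p : Vec n × Vec n => g p.2 * chr p.2 p.1 :=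
      ((hgm.comp measurable_snd).mul
        (continuous_chr.comp continuous_swap).measurable).stronglyMeasurable
    exact this.integral_prod_right'.measurable
  have hlim : ∀ ξ, Filter.Tendsto (fun m : ℕ =>
      ENNReal.ofReal (gaussW (1 / ((m : ℝ) + 1)) ξ) * ‖G ξ‖ₑ ^ 2) Filter.atTop
        (nhds (‖G ξ‖ₑ ^ 2)) := by
    intro ξ
    have h1 : Filter.Tendsto (fun m : ℕ => gaussW (1 / ((m : ℝ) + 1)) ξ) Filter.atTop (nhds 1) := by
      have hc : Continuous fun δ : ℝ => gaussW δ ξ := by unfold gaussW; fun_prop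
      have := (hc.tendsto 0).comp tendsto_one_div_add_atTop_nhds_zero_nat
      simpa only [gaussW, Function.comp_def, neg_zero, zero_mul, Real.exp_zero,
        Finset.prod_const_one] using this
    have h2 := ENNReal.Tendsto.mul_const (b := ‖G ξ‖ₑ ^ 2) (ENNReal.tendsto_ofReal h1)
      (Or.inl (by simp))
    simpa using h2
  calc ∫⁻ ξ, ‖G ξ‖ₑ ^ 2
      = ∫⁻ ξ, Filter.liminf (fun m : ℕ =>
          ENNReal.ofReal (gaussW (1 / ((m : ℝ) + 1)) ξ) * ‖G ξ‖ₑ ^ 2) Filter.atTop :=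
        lintegral_congr fun ξ => (hlim ξ).liminf_eq.symm
    _ ≤ Filter.liminf (fun m : ℕ => ∫⁻ ξ,
          ENNReal.ofReal (gaussW (1 / ((m : ℝ) + 1)) ξ) * ‖G ξ‖ₑ ^ 2) Filter.atTop :=
        lintegral_liminf_le fun m =>
          (continuous_gaussW _).measurable.ennreal_ofReal.mul (hGm.enorm.pow_const 2)
    _ ≤ _ := by
        refine Filter.liminf_le_of_le (by isBoundedDefault) fun b hb => ?_
        obtain ⟨m, hm⟩ := hb.exists
        exact hm.trans (lintegral_gaussW_mul_fourier_sq_le hgm hg (by positivity))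

end SchurAndPlancherel

section ExponentialSmoothing

open scoped ENNReal

/-- The density of the standard exponential distribution. -/
noncomputable def expD (τ : ℝ) : ℝ := (Set.Ioi (0 : ℝ)).indicator (fun τ => rexp (-τ)) τ

/-- The standard exponential distribution. -/
noncomputable def expM : Measure ℝ := volume.withDensity fun τ => ENNReal.ofReal (expD τ)

/-- The product of `n` standard exponential distributions. -/
noncomputable def expPi (n : ℕ) : Measure (Vec n) := Measure.pi fun _ => expM

/-- The density of `expPi n`. -/
noncomputable def expDPi {n : ℕ} (z : Vec n) : ℝ := ∏ i, expD (z i)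

lemma expD_nonneg (τ : ℝ) : 0 ≤ expD τ :=
  Set.indicator_nonneg (fun _ _ => (Real.exp_pos _).le) τ

lemma expD_le_one (τ : ℝ) : expD τ ≤ 1 := by
  unfold expD
  by_cases h : τ ∈ Set.Ioi (0 : ℝ)
  · rw [Set.indicator_of_mem h]
    have : (0 : ℝ) < τ := h
    exact Real.exp_le_one_iff.2 (by linarith)
  · rw [Set.indicator_of_notMem h]; norm_num

lemma measurable_expD : Measurable expD :=
  (by fun_prop : Measurable fun τ : ℝ => rexp (-τ)).indicator measurableSet_Ioi

lemma integrable_expD : Integrable expD := by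
  unfold expD
  exact (integrable_indicator_iff measurableSet_Ioi).2 (by
    simpa using (exp_neg_integrableOn_Ioi 0 one_pos))

lemma integral_expD : ∫ τ, expD τ = 1 := by
  unfold expD
  rw [integral_indicator measurableSet_Ioi, integral_exp_neg_Ioi_zero]

lemma expDPi_nonneg {n : ℕ} (z : Vec n) : 0 ≤ expDPi z :=
  Finset.prod_nonneg fun _ _ => expD_nonneg _

lemma expDPi_le_one {n : ℕ} (z : Vec n) : expDPi z ≤ 1 :=
  Finset.prod_le_one (fun _ _ => expD_nonneg _) fun _ _ => expD_le_one _

lemma measurable_expDPi {n : ℕ} : Measurable (expDPi (n := n)) :=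
  Finset.measurable_prod _ fun i _ => measurable_expD.comp (measurable_pi_apply i)

instance : IsProbabilityMeasure expM := by
  constructor
  rw [expM, withDensity_apply _ MeasurableSet.univ, setLIntegral_univ,
    ← ofReal_integral_eq_lintegral_ofReal integrable_expD
      (Filter.Eventually.of_forall expD_nonneg), integral_expD]
  simp

instance (n : ℕ) : IsProbabilityMeasure (expPi n) := by unfold expPi; infer_instance

lemma expPi_eq_withDensity (n : ℕ) :
    expPi n = volume.withDensity fun z => ENNReal.ofReal (expDPi z) := by
  unfold expPi
  refine Measure.pi_eq (μ := fun _ : Fin n => expM) fun s hs => ?_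
  have hind : ∀ i, Integrable ((s i).indicator expD) := fun i =>
    integrable_expD.indicator (hs i)
  have hind0 : ∀ i τ, 0 ≤ (s i).indicator expD τ := fun i τ =>
    Set.indicator_nonneg (fun _ _ => expD_nonneg _) τ
  have hInt : Integrable fun z : Vec n => ∏ i, (s i).indicator expD (z i) :=
    Integrable.fintype_prod hind
  have h1 : ∀ i, expM (s i) = ENNReal.ofReal (∫ τ, (s i).indicator expD τ) := by
    intro i
    rw [expM, withDensity_apply _ (hs i), integral_indicator (hs i),
      ofReal_integral_eq_lintegral_ofReal integrable_expD.integrableOn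
        (Filter.Eventually.of_forall expD_nonneg)]
  simp only [h1]
  rw [← ENNReal.ofReal_prod_of_nonneg fun i _ => integral_nonneg (hind0 i),
    ← integral_fintype_prod_volume_eq_prod (fun i => (s i).indicator expD),
    withDensity_apply _ (MeasurableSet.univ_pi hs), ← lintegral_indicator (MeasurableSet.univ_pi hs),
    ofReal_integral_eq_lintegral_ofReal hInt
      (Filter.Eventually.of_forall fun z => Finset.prod_nonneg fun i _ => hind0 i _)]
  refine lintegral_congr fun z => ?_
  by_cases hz : z ∈ Set.univ.pi s
  · rw [Set.indicator_of_mem hz]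
    congr 1
    exact Finset.prod_congr rfl fun i _ =>
      (Set.indicator_of_mem (hz i (Set.mem_univ i)) expD).symm
  · rw [Set.indicator_of_notMem hz]
    obtain ⟨i, hi⟩ : ∃ i, z i ∉ s i := by simpa [Set.mem_pi] using hz
    rw [Finset.prod_eq_zero (Finset.mem_univ i) (Set.indicator_of_notMem hi expD),
      ENNReal.ofReal_zero]

lemma integral_expM (f : ℝ → ℂ) : ∫ τ, f τ ∂expM = ∫ τ in Set.Ioi 0, rexp (-τ) • f τ := by
  rw [expM, integral_withDensity_eq_integral_toReal_smul measurable_expD.ennreal_ofReal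
    (Filter.Eventually.of_forall fun _ => ENNReal.ofReal_lt_top), ← integral_indicator measurableSet_Ioi]
  refine integral_congr_ae (Filter.Eventually.of_forall fun τ => ?_)
  simp only [ENNReal.toReal_ofReal (expD_nonneg τ)]
  unfold expD
  by_cases h : τ ∈ Set.Ioi (0 : ℝ)
  · simp only [Set.indicator_of_mem h]
  · simp only [Set.indicator_of_notMem h, zero_smul]

lemma integral_expPi {n : ℕ} (f : Vec n → ℂ) :
    ∫ z, f z ∂expPi n = ∫ z, (expDPi z : ℂ) * f z := by
  rw [expPi_eq_withDensity, integral_withDensity_eq_integral_toReal_smul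
    measurable_expDPi.ennreal_ofReal (Filter.Eventually.of_forall fun _ => ENNReal.ofReal_lt_top)]
  refine integral_congr_ae (Filter.Eventually.of_forall fun z => ?_)
  simp only [ENNReal.toReal_ofReal (expDPi_nonneg z), Complex.real_smul]

lemma lintegral_expDPi_sq_le (n : ℕ) :
    ∫⁻ z : Vec n, ENNReal.ofReal (expDPi z) ^ 2 ≤ 1 := by
  have h1 : ∫⁻ z : Vec n, ENNReal.ofReal (expDPi z) = 1 := by
    have := measure_univ (μ := expPi n)
    rwa [expPi_eq_withDensity, withDensity_apply _ MeasurableSet.univ, setLIntegral_univ] at this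
  rw [← h1]
  refine lintegral_mono fun z => ?_
  rw [pow_two]
  exact mul_le_of_le_one_left' (ENNReal.ofReal_le_one.2 (expDPi_le_one z))

lemma measurePreserving_update_expPi {n : ℕ} (i : Fin n) :
    MeasurePreserving (fun p : Vec n × ℝ => Function.update p.1 i p.2)
      ((expPi n).prod expM) (expPi n) := by
  have hm : Measurable fun p : Vec n × ℝ => Function.update p.1 i p.2 := by
    refine measurable_pi_iff.2 fun j => ?_
    by_cases h : j = i
    · subst h; simpa using measurable_snd
    · simp only [Function.update_of_ne h]
      exact (measurable_pi_apply j).comp measurable_fst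
  refine ⟨hm, (Measure.pi_eq fun s hs => ?_).symm⟩
  rw [Measure.map_apply hm (MeasurableSet.univ_pi hs)]
  have : (fun p : Vec n × ℝ => Function.update p.1 i p.2) ⁻¹' Set.univ.pi s =
      (Set.univ.pi (Function.update s i Set.univ)) ×ˢ s i := by
    ext p
    simp only [Set.mem_preimage, Set.mem_pi, Set.mem_univ, true_imp_iff, Set.mem_prod]
    constructor
    · intro h
      refine ⟨fun j => ?_, by simpa using h i⟩
      by_cases hj : j = i
      · subst hj; simp
      · simpa [Function.update_of_ne hj] using h j
    · rintro ⟨h, h'⟩ j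
      by_cases hj : j = i
      · subst hj; simpa using h'
      · simpa [Function.update_of_ne hj] using h j
  rw [this, Measure.prod_prod, expPi, Measure.pi_pi, mul_comm,
    ← Finset.mul_prod_erase _ _ (Finset.mem_univ i), ← Finset.mul_prod_erase _ (fun j => expM (s j)) (Finset.mem_univ i)]
  simp only [Function.update_self, measure_univ, one_mul]
  congr 1
  refine Finset.prod_congr rfl fun j hj => ?_
  rw [Function.update_of_ne (Finset.ne_of_mem_erase hj)]

variable {E : Type*} [NormedAddCommGroup E] [NormedSpace ℝ E]

lemma eq_integral_addD {g : E → ℂ} (hg : ContDiff ℝ (⊤ : ℕ∞) g) (v : E) {S : ℝ}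
    (h0 : ∀ X, ‖g X‖ ≤ S) (h1 : ∀ X, ‖dirD v g X‖ ≤ S) (X : E) :
    g X = ∫ τ, addD v g (X - τ • v) ∂expM := by
  rw [integral_expM]
  have hline : ∀ τ : ℝ, HasDerivAt (fun τ : ℝ => X - τ • v) (-v) τ := by
    intro τ
    simpa using ((hasDerivAt_id τ).smul_const v).const_sub X
  have hder : ∀ τ ∈ Set.Ici (0 : ℝ), HasDerivAt (fun τ : ℝ => -(rexp (-τ) • g (X - τ • v)))
      (rexp (-τ) • addD v g (X - τ • v)) τ := by
    intro τ _
    have ha := (smooth_differentiable hg (X - τ • v)).hasFDerivAt.comp_hasDerivAt τ (hline τ)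
    have hb : HasDerivAt (fun τ : ℝ => rexp (-τ)) (-rexp (-τ)) τ := by
      simpa using (hasDerivAt_neg τ).exp
    have := (hb.smul ha).neg
    refine this.congr_deriv ?_
    change -(rexp (-τ) • fderiv ℝ g (X - τ • v) (-v) + -rexp (-τ) • g (X - τ • v)) =
      rexp (-τ) • (g (X - τ • v) + fderiv ℝ g (X - τ • v) v)
    rw [map_neg, smul_add, smul_neg, neg_smul]
    abel
  have hInt : IntegrableOn (fun τ : ℝ => rexp (-τ) • addD v g (X - τ • v)) (Set.Ioi 0) := by
    have hE : IntegrableOn (fun τ : ℝ => rexp (-τ) * (2 * S)) (Set.Ioi 0) :=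
      Integrable.mul_const (by simpa [IntegrableOn] using exp_neg_integrableOn_Ioi 0 one_pos) _
    refine Integrable.mono' hE ?_ (Filter.Eventually.of_forall fun τ => ?_)
    · have := (contDiff_addD hg v).continuous
      exact (by fun_prop : Continuous fun τ : ℝ =>
        rexp (-τ) • addD v g (X - τ • v)).aestronglyMeasurable
    · rw [norm_smul, Real.norm_of_nonneg (Real.exp_pos _).le]
      refine mul_le_mul_of_nonneg_left ?_ (Real.exp_pos _).le
      rw [two_mul]
      exact (norm_add_le _ _).trans (add_le_add (h0 _) (h1 _))
  have hlim : Filter.Tendsto (fun τ : ℝ => -(rexp (-τ) • g (X - τ • v))) Filter.atTop (nhds 0) := by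
    rw [tendsto_zero_iff_norm_tendsto_zero]
    have hexp : Filter.Tendsto (fun τ : ℝ => rexp (-τ) * S) Filter.atTop (nhds 0) := by
      simpa using Real.tendsto_exp_neg_atTop_nhds_zero.mul_const S
    refine squeeze_zero (fun _ => norm_nonneg _) (fun τ => ?_) hexp
    rw [norm_neg, norm_smul, Real.norm_of_nonneg (Real.exp_pos _).le]
    exact mul_le_mul_of_nonneg_left (h0 _) (Real.exp_pos _).le
  have := integral_Ioi_of_hasDerivAt_of_tendsto' hder hInt hlim
  rw [this]
  simp

/-- A smooth function with bounded derivatives is an average of its image under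
`∏ (1 + ∂_{e i})`. -/
lemma eq_integral_itAddD {n : ℕ} {c : E → ℂ} (hc : ContDiff ℝ (⊤ : ℕ∞) c) (e : Fin n → E)
    (l : List (Fin n)) (hl : l.Nodup) {S : ℝ} (hS : ∀ X, BdAt e l.length c X S) (X : E) :
    c X = ∫ z, itAddD e l c (X - (l.map fun i => z i • e i).sum) ∂expPi n := by
  induction l with
  | nil => simp
  | cons i l ih =>
    have hnd := List.nodup_cons.1 hl
    have hcl := contDiff_itAddD hc e l
    rw [ih hnd.2 fun X => (hS X).mono (by simp) le_rfl]
    have hb : ∀ X, BdAt e 1 (itAddD e l c) X (2 ^ l.length * S) := fun X =>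
      BdAt.itAddD hc l ((hS X).mono (by simp [add_comm]) le_rfl)
    have h1 := eq_integral_addD hcl (e i) (fun X => (hb X).norm_le)
      (fun X => hb X [i] (by simp))
    have hcont : Continuous (addD (e i) (itAddD e l c)) := (contDiff_addD hcl (e i)).continuous
    set H : Vec n → ℂ := fun z =>
      addD (e i) (itAddD e l c) (X - ((i :: l).map fun i => z i • e i).sum) with hH
    have hsum : Continuous fun z : Vec n => ((i :: l).map fun i => z i • e i).sum :=
      continuous_list_sum _ fun j _ => by fun_prop
    have hHc : Continuous H := hcont.comp (continuous_const.sub hsum)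
    have hupd : ∀ (z : Vec n) (τ : ℝ), addD (e i) (itAddD e l c)
        (X - (l.map fun i => z i • e i).sum - τ • e i) = H (Function.update z i τ) := by
      intro z τ
      have : (l.map fun j => Function.update z i τ j • e j) = l.map fun j => z j • e j := by
        refine List.map_congr_left fun j hj => ?_
        rw [Function.update_of_ne]
        rintro rfl
        exact hnd.1 hj
      simp only [hH, List.map_cons, List.sum_cons, Function.update_self, this]
      congr 1; abel
    have hmp := measurePreserving_update_expPi (n := n) i
    have hHint : Integrable H (expPi n) := by
      refine Integrable.of_bound hHc.aestronglyMeasurable (2 * (2 ^ l.length * S))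
        (Filter.Eventually.of_forall fun z => ?_)
      rw [hH, two_mul]
      exact (norm_add_le _ _).trans (add_le_add (hb _).norm_le (hb _ [i] (by simp)))
    calc ∫ z, itAddD e l c (X - (l.map fun i => z i • e i).sum) ∂expPi n
        = ∫ z, ∫ τ, H (Function.update z i τ) ∂expM ∂expPi n := by
          refine integral_congr_ae (Filter.Eventually.of_forall fun z => ?_)
          simp only [h1 (X - (l.map fun i => z i • e i).sum), hupd]
      _ = ∫ p : Vec n × ℝ, H (Function.update p.1 i p.2) ∂((expPi n).prod expM) := by
          rw [integral_prod]
          exact hmp.integrable_comp_of_integrable hHint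
      _ = ∫ z, H z ∂expPi n := by
          rw [← hmp.map_eq, integral_map hmp.measurable.aemeasurable, hmp.map_eq]
          exact hHc.aestronglyMeasurable

end ExponentialSmoothing

section Cutoffs

/-- The function `(1 - i w)^{-p}`. -/
noncomputable def resK (p : ℕ) (w : ℝ) : ℂ := ((1 - Complex.I * (w : ℂ))⁻¹) ^ p

lemma one_sub_I_mul_ne_zero (w : ℝ) : 1 - Complex.I * (w : ℂ) ≠ 0 := by
  intro h
  have := congrArg Complex.re h
  simp at this

lemma norm_resK (p : ℕ) (w : ℝ) : ‖resK p w‖ = (√(1 + w ^ 2))⁻¹ ^ p := by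
  rw [resK, norm_pow, norm_inv]
  congr 2
  rw [Complex.norm_def, Complex.normSq_apply]
  congr 1
  simp
  ring

lemma norm_resK_four_add_le (m : ℕ) (w : ℝ) : ‖resK (4 + m) w‖ ≤ ((1 + w ^ 2)⁻¹) ^ 2 := by
  have h0 : (0 : ℝ) ≤ 1 + w ^ 2 := by positivity
  have h1 : (1 : ℝ) ≤ √(1 + w ^ 2) := Real.one_le_sqrt.2 (by nlinarith [sq_nonneg w])
  have h2 : (√(1 + w ^ 2))⁻¹ ≤ 1 := inv_le_one_of_one_le₀ h1
  rw [norm_resK, pow_add]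
  refine (mul_le_of_le_one_right (by positivity) (pow_le_one₀ (by positivity) h2)).trans_eq ?_
  rw [show 4 = 2 * 2 from rfl, pow_mul, inv_pow, Real.sq_sqrt h0]

lemma hasDerivAt_resK (p : ℕ) (w : ℝ) :
    HasDerivAt (resK p) ((p * Complex.I) * resK (p + 1) w) w := by
  have h1 : HasDerivAt (fun w : ℝ => 1 - Complex.I * (w : ℂ)) (-Complex.I) w := by
    simpa using ((Complex.ofRealCLM.hasDerivAt (x := w)).const_mul Complex.I).const_sub 1
  have h2 := (h1.fun_inv (one_sub_I_mul_ne_zero w)).fun_pow p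
  refine h2.congr_deriv ?_
  have := one_sub_I_mul_ne_zero w
  rcases p with _ | p
  · simp
  · simp only [resK, Nat.add_sub_cancel]
    rw [pow_succ _ (p + 1), pow_succ _ p]
    generalize (1 - Complex.I * (w : ℂ))⁻¹ ^ p = z
    field_simp

lemma contDiff_resK (p : ℕ) : ContDiff ℝ (⊤ : ℕ∞) (resK p) := by
  have : ContDiff ℝ (⊤ : ℕ∞) fun w : ℝ => 1 - Complex.I * (w : ℂ) :=
    contDiff_const.sub (contDiff_const.mul Complex.ofRealCLM.contDiff)
  exact (this.inv one_sub_I_mul_ne_zero).pow p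

lemma iteratedDeriv_resK (p m : ℕ) :
    ∃ c : ℂ, iteratedDeriv m (resK p) = fun w => c * resK (p + m) w := by
  induction m with
  | zero => exact ⟨1, by simp⟩
  | succ m ih =>
    obtain ⟨c, hc⟩ := ih
    refine ⟨c * ((p + m : ℕ) * Complex.I), ?_⟩
    rw [iteratedDeriv_succ, hc]
    funext w
    rw [((hasDerivAt_resK (p + m) w).const_mul c).deriv, ← add_assoc]
    ring

lemma exists_iteratedDeriv_resK_bound (N : ℕ) : ∃ C : ℝ, 1 ≤ C ∧ ∀ m ≤ N, ∀ w,
    ‖iteratedDeriv m (resK 4) w‖ ≤ C * ((1 + w ^ 2)⁻¹) ^ 2 := by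
  choose c hc using iteratedDeriv_resK 4
  refine ⟨1 + ∑ m ∈ Finset.range (N + 1), ‖c m‖, ?_, fun m hm w => ?_⟩
  · exact le_add_of_nonneg_right (Finset.sum_nonneg fun _ _ => norm_nonneg _)
  · rw [hc, norm_mul]
    refine mul_le_mul ?_ (norm_resK_four_add_le m w) (norm_nonneg _) (by positivity)
    have := Finset.single_le_sum (f := fun m => ‖c m‖) (fun _ _ => norm_nonneg _)
      (Finset.mem_range.2 (Nat.lt_succ_of_le hm))
    linarith

lemma resK_zero_right (p : ℕ) : resK p 0 = 1 := by simp [resK]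

lemma norm_resK_le_one (p : ℕ) (w : ℝ) : ‖resK p w‖ ≤ 1 := by
  have h1 : (1 : ℝ) ≤ √(1 + w ^ 2) := Real.one_le_sqrt.2 (by nlinarith [sq_nonneg w])
  rw [norm_resK]
  exact pow_le_one₀ (by positivity) (inv_le_one_of_one_le₀ h1)

lemma one_sub_I_mul_pow_mul_resK (p : ℕ) (w : ℝ) :
    (1 - Complex.I * (w : ℂ)) ^ p * resK p w = 1 := by
  rw [resK, ← mul_pow, mul_inv_cancel₀ (one_sub_I_mul_ne_zero w), one_pow]

/-- A smooth bump supported in `[-1, 1]` whose integer translates sum up to one. -/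
noncomputable def bump (r : ℝ) : ℂ :=
  ((Real.smoothTransition (r + 1) - Real.smoothTransition r : ℝ) : ℂ)

lemma contDiff_bump : ContDiff ℝ (⊤ : ℕ∞) bump := by
  have h : ContDiff ℝ (⊤ : ℕ∞) fun r : ℝ =>
      Real.smoothTransition (r + 1) - Real.smoothTransition r :=
    (Real.smoothTransition.contDiff.comp (contDiff_id.add contDiff_const)).sub
      Real.smoothTransition.contDiff
  exact Complex.ofRealCLM.contDiff.comp h

lemma bump_eq_zero {r : ℝ} (hr : 1 ≤ |r|) : bump r = 0 := by
  rcases le_abs.1 hr with h | h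
  · simp [bump, Real.smoothTransition.one_of_one_le h,
      Real.smoothTransition.one_of_one_le (show 1 ≤ r + 1 by linarith)]
  · simp [bump, Real.smoothTransition.zero_of_nonpos (show r ≤ 0 by linarith),
      Real.smoothTransition.zero_of_nonpos (show r + 1 ≤ 0 by linarith)]

lemma hasCompactSupport_bump : HasCompactSupport bump := by
  refine HasCompactSupport.intro (isCompact_Icc (a := (-1 : ℝ)) (b := 1)) fun r hr => ?_
  refine bump_eq_zero ?_
  by_contra h
  exact hr (abs_le.1 (not_le.1 h).le)

lemma exists_iteratedDeriv_bump_bound (N : ℕ) : ∃ C : ℝ, 1 ≤ C ∧ ∀ m ≤ N, ∀ r,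
    ‖iteratedDeriv m bump r‖ ≤ C := by
  have h : ∀ m, ∃ C : ℝ, ∀ r, ‖iteratedDeriv m bump r‖ ≤ C := by
    intro m
    have hs : HasCompactSupport (iteratedDeriv m bump) := by
      induction m with
      | zero => simpa using hasCompactSupport_bump
      | succ m ih => rw [iteratedDeriv_succ]; exact ih.deriv
    obtain ⟨C, hC⟩ := hs.exists_bound_of_continuous
      (contDiff_bump.continuous_iteratedDeriv m (by exact_mod_cast le_top))
    exact ⟨C, hC⟩
  choose c hc using h
  refine ⟨1 + ∑ m ∈ Finset.range (N + 1), |c m|, ?_, fun m hm r => ?_⟩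
  · exact le_add_of_nonneg_right (Finset.sum_nonneg fun _ _ => abs_nonneg _)
  · have := Finset.single_le_sum (f := fun m => |c m|) (fun _ _ => abs_nonneg _)
      (Finset.mem_range.2 (Nat.lt_succ_of_le hm))
    linarith [hc m r, le_abs_self (c m)]

lemma sum_bump_eq_one (J : ℕ) {r : ℝ} (hr : |r| ≤ J) :
    ∑ j ∈ Finset.Icc (-(J : ℤ)) J, bump (r - j) = 1 := by
  have key : ∀ m : ℕ, ∑ j ∈ Finset.Ico (-(J : ℤ)) (-(J : ℤ) + m), bump (r - j) =
      ((Real.smoothTransition (r + J + 1) - Real.smoothTransition (r + J + 1 - m) : ℝ) : ℂ) := by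
    intro m
    induction m with
    | zero => simp
    | succ m ih =>
      have : Finset.Ico (-(J : ℤ)) (-(J : ℤ) + (m + 1 : ℕ)) =
          insert (-(J : ℤ) + m) (Finset.Ico (-(J : ℤ)) (-(J : ℤ) + m)) := by
        ext x; simp only [Finset.mem_Ico, Finset.mem_insert]; omega
      rw [this, Finset.sum_insert (by simp), ih, bump]
      push_cast
      rw [show r - (-(J : ℝ) + m) + 1 = r + J + 1 - m by ring,
        show r - (-(J : ℝ) + m) = r + J + 1 - (m + 1) by ring]
      ring
  have h2 : Finset.Icc (-(J : ℤ)) J = Finset.Ico (-(J : ℤ)) (-(J : ℤ) + (2 * J + 1 : ℕ)) := by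
    ext x; simp only [Finset.mem_Icc, Finset.mem_Ico]; omega
  rw [h2, key]
  have := abs_le.1 hr
  rw [Real.smoothTransition.one_of_one_le (by linarith),
    Real.smoothTransition.zero_of_nonpos (by push_cast; linarith)]
  simp

end Cutoffs

section IntegrationByParts

variable {E F ι κ : Type*} [NormedAddCommGroup E] [NormedSpace ℝ E]
  [NormedAddCommGroup F] [NormedSpace ℝ F]

lemma itD_index (e : ι → E) (g : κ → ι) (l : List κ) (f : E → ℂ) :
    itD (fun k => e (g k)) l f = itD e (l.map g) f := by
  induction l with
  | nil => rfl
  | cons k l ih => rw [itD_cons, ih, List.map_cons, itD_cons]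

lemma itAddD_index (e : ι → E) (g : κ → ι) (l : List κ) (f : E → ℂ) :
    itAddD (fun k => e (g k)) l f = itAddD e (l.map g) f := by
  induction l with
  | nil => rfl
  | cons k l ih => rw [itAddD_cons, ih, List.map_cons, itAddD_cons]

lemma BdAt.index {e : ι → E} {N : ℕ} {f : E → ℂ} {X : E} {A : ℝ} (h : BdAt e N f X A)
    (g : κ → ι) : BdAt (fun k => e (g k)) N f X A := by
  intro l hl
  rw [itD_index]
  exact h _ (by simpa using hl)

lemma dirD_comp_affine {f : E → ℂ} (hf : ContDiff ℝ (⊤ : ℕ∞) f) (T : F →L[ℝ] E) (b : E) (v : F) :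
    dirD v (fun Y => f (T Y + b)) = fun Y => dirD (T v) f (T Y + b) := by
  funext Y
  have h1 : HasFDerivAt (fun Y => T Y + b) T Y := T.hasFDerivAt.add_const b
  have h2 := (smooth_differentiable hf (T Y + b)).hasFDerivAt.comp Y h1
  rw [dirD]
  erw [h2.fderiv]
  rfl

lemma itD_comp_affine {f : E → ℂ} (hf : ContDiff ℝ (⊤ : ℕ∞) f) (T : F →L[ℝ] E) (b : E)
    (e : ι → F) (l : List ι) :
    itD e l (fun Y => f (T Y + b)) = fun Y => itD (fun i => T (e i)) l f (T Y + b) := by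
  induction l with
  | nil => rfl
  | cons i l ih => rw [itD_cons, ih, itD_cons, dirD_comp_affine (contDiff_itD hf _ l)]

lemma itAddD_comp_affine {f : E → ℂ} (hf : ContDiff ℝ (⊤ : ℕ∞) f) (T : F →L[ℝ] E) (b : E)
    (e : ι → F) (l : List ι) :
    itAddD e l (fun Y => f (T Y + b)) = fun Y => itAddD (fun i => T (e i)) l f (T Y + b) := by
  induction l with
  | nil => rfl
  | cons i l ih =>
    rw [itAddD_cons, ih, itAddD_cons]
    funext Y
    simp only [addD, dirD_comp_affine (contDiff_itAddD hf _ l)]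

lemma contDiff_chr {n : ℕ} (w : Vec n) : ContDiff ℝ (⊤ : ℕ∞) (chr w) := by
  unfold chr
  have : ContDiff ℝ (⊤ : ℕ∞) fun ξ : Vec n => ∑ i, ξ i * w i :=
    ContDiff.sum fun i _ => (contDiff_apply ℝ ℝ i).mul contDiff_const
  exact (contDiff_const.mul (Complex.ofRealCLM.contDiff.comp this)).cexp

lemma dirD_chr {n : ℕ} (w : Vec n) (i : Fin n) (ξ : Vec n) :
    dirD (Pi.single i (1 : ℝ)) (chr w) ξ = Complex.I * (w i : ℂ) * chr w ξ := by
  have h0 : HasFDerivAt (fun ξ : Vec n => ∑ j, ξ j * w j)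
      (∑ j, (w j) • ContinuousLinearMap.proj (R := ℝ) (φ := fun _ : Fin n => ℝ) j) ξ := by
    refine HasFDerivAt.fun_sum fun j _ => ?_
    exact (hasFDerivAt_apply j ξ).mul_const (w j)
  have h1 := ((Complex.ofRealCLM.hasFDerivAt.comp ξ h0).const_mul Complex.I).cexp
  have h2 : fderiv ℝ (chr w) ξ = _ := h1.fderiv
  rw [dirD, h2]
  simp [chr, Pi.single_apply]
  ring

lemma integral_addD_mul_chr {n : ℕ} {g : Vec n → ℂ} (hg : ContDiff ℝ (⊤ : ℕ∞) g) (i : Fin n)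
    (h0 : Integrable g) (h1 : Integrable (dirD (Pi.single i (1 : ℝ)) g)) (w : Vec n) :
    ∫ ξ, addD (Pi.single i (1 : ℝ)) g ξ * chr w ξ =
      (1 - Complex.I * (w i : ℂ)) * ∫ ξ, g ξ * chr w ξ := by
  have hb : ∀ {f : Vec n → ℂ}, Integrable f → Integrable fun ξ => f ξ * chr w ξ := by
    intro f hf
    exact hf.mul_bdd (c := 1) (contDiff_chr w).continuous.aestronglyMeasurable
      (Filter.Eventually.of_forall fun ξ => (norm_chr w ξ).le)
  have h2 : ∀ ξ, g ξ * fderiv ℝ (chr w) ξ (Pi.single i (1 : ℝ)) =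
      (Complex.I * (w i : ℂ)) * (g ξ * chr w ξ) := by
    intro ξ
    have := dirD_chr w i ξ
    rw [dirD] at this
    rw [this]; ring
  have key := integral_mul_fderiv_eq_neg_fderiv_mul_of_integrable (μ := volume)
    (f := g) (g := chr w) (v := Pi.single i (1 : ℝ)) (hb h1)
    (by simp only [h2]; exact (hb h0).const_mul _) (hb h0)
    (fun x _ => smooth_differentiable hg x) fun x _ => smooth_differentiable (contDiff_chr w) x
  simp only [h2] at key
  rw [integral_const_mul] at key
  have h3 : ∀ ξ, addD (Pi.single i (1 : ℝ)) g ξ * chr w ξ =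
      g ξ * chr w ξ + dirD (Pi.single i (1 : ℝ)) g ξ * chr w ξ := by
    intro ξ; rw [addD]; ring
  simp only [h3]
  rw [integral_add (hb h0) (hb h1), sub_mul, key, one_mul, sub_neg_eq_add]
  rfl

lemma integral_itAddD_mul_chr {n : ℕ} {g : Vec n → ℂ} (hg : ContDiff ℝ (⊤ : ℕ∞) g)
    (l : List (Fin n)) {W : Vec n → ℝ} (hW : Integrable W)
    (hgW : ∀ ξ, BdAt (fun i => Pi.single i (1 : ℝ)) l.length g ξ (W ξ)) (w : Vec n) :
    ∫ ξ, itAddD (fun i => Pi.single i (1 : ℝ)) l g ξ * chr w ξ =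
      (l.map fun i => 1 - Complex.I * (w i : ℂ)).prod * ∫ ξ, g ξ * chr w ξ := by
  induction l with
  | nil => simp
  | cons i l ih =>
    have hs := contDiff_itAddD hg (fun i : Fin n => Pi.single i (1 : ℝ)) l
    have hb : ∀ ξ, BdAt (fun i => Pi.single i (1 : ℝ)) 1
        (itAddD (fun i => Pi.single i (1 : ℝ)) l g) ξ (2 ^ l.length * W ξ) := fun ξ =>
      BdAt.itAddD hg l ((hgW ξ).mono (by simp [add_comm]) le_rfl)
    rw [itAddD_cons, integral_addD_mul_chr hs i, ih fun ξ => (hgW ξ).mono (by simp) le_rfl]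
    · simp [mul_assoc]
    · exact (hW.const_mul _).mono' hs.continuous.aestronglyMeasurable
        (Filter.Eventually.of_forall fun ξ => (hb ξ).norm_le)
    · exact (hW.const_mul _).mono' (contDiff_dirD hs _).continuous.aestronglyMeasurable
        (Filter.Eventually.of_forall fun ξ => hb ξ [i] (by simp))

/-- The space of triples `(x, ξ, y)`. -/
abbrev Tri (n : ℕ) := Vec n × Vec n × Vec n

/-- The standard basis of the space of triples. -/
def triE {n : ℕ} : Fin n ⊕ Fin n ⊕ Fin n → Tri n :=
  Sum.elim (fun i => (Pi.single i 1, 0, 0))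
    (Sum.elim (fun i => (0, Pi.single i 1, 0)) fun i => (0, 0, Pi.single i 1))

/-- The list of all indices, each of them occurring four times. -/
def fourL (n : ℕ) : List (Fin n) := (List.finRange n).flatMap fun i => List.replicate 4 i

lemma length_fourL (n : ℕ) : (fourL n).length = 4 * n := by
  simp [fourL, List.length_flatMap, mul_comm]

lemma prod_map_fourL {n : ℕ} (f : Fin n → ℂ) : ((fourL n).map f).prod = ∏ i, f i ^ 4 := by
  have h : ∀ l : List (Fin n), ((l.flatMap fun i => List.replicate 4 i).map f).prod =
      (l.map fun i => f i ^ 4).prod := by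
    intro l
    induction l with
    | nil => rfl
    | cons i l ih =>
      rw [List.flatMap_cons, List.map_append, List.prod_append, ih, List.map_replicate,
        List.prod_replicate, List.map_cons, List.prod_cons]
  rw [fourL, h, ← List.ofFn_eq_map, List.prod_ofFn]

/-- The kernel `∏ (1 - i w_j)^{-4}`. -/
noncomputable def prodK {n : ℕ} (w : Vec n) : ℂ := ∏ i, resK 4 (w i)

/-- The amplitude obtained from `c` by integrating by parts four times in every frequency. -/
noncomputable def ibpAmp {n : ℕ} (c : Tri n → ℂ) (X : Tri n) : ℂ :=
  prodK (X.1 - X.2.2) * itAddD triE ((fourL n).map fun i => Sum.inr (Sum.inl i)) c X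

lemma integral_mul_chr_eq_ibpAmp {n : ℕ} {c : Tri n → ℂ} (hc : ContDiff ℝ (⊤ : ℕ∞) c)
    {W : Vec n → ℝ} (hW : Integrable W) (hcW : ∀ X, BdAt triE (4 * n) c X (W X.2.1))
    (x y : Vec n) :
    ∫ ξ, c (x, ξ, y) * chr (x - y) ξ = ∫ ξ, ibpAmp c (x, ξ, y) * chr (x - y) ξ := by
  set T : Vec n →L[ℝ] Tri n :=
    (ContinuousLinearMap.inr ℝ (Vec n) (Vec n × Vec n)).comp
      (ContinuousLinearMap.inl ℝ (Vec n) (Vec n)) with hT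
  have hTX : ∀ ξ : Vec n, T ξ + (x, 0, y) = (x, ξ, y) := by intro ξ; simp [hT]
  have hTe : ∀ i : Fin n, T (Pi.single i (1 : ℝ)) = triE (Sum.inr (Sum.inl i)) := by
    intro i; simp [hT, triE]
  have hgs : ContDiff ℝ (⊤ : ℕ∞) fun ξ => c (T ξ + (x, 0, y)) :=
    hc.comp (T.contDiff.add contDiff_const)
  have h1 := integral_itAddD_mul_chr hgs (fourL n) hW (fun ξ => by
    intro l hl
    rw [itD_comp_affine hc]
    simp only [hTe]
    have := ((hcW (T ξ + (x, 0, y))).index fun i => Sum.inr (Sum.inl i)) l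
      (by rw [length_fourL] at hl; exact hl)
    simpa [hTX] using this) (x - y)
  rw [itAddD_comp_affine hc] at h1
  simp only [hTX, hTe] at h1
  rw [itAddD_index, prod_map_fourL] at h1
  have h2 : ∀ ξ, ibpAmp c (x, ξ, y) * chr (x - y) ξ = prodK (x - y) *
      (itAddD triE ((fourL n).map fun i => Sum.inr (Sum.inl i)) c (x, ξ, y) * chr (x - y) ξ) := by
    intro ξ; rw [ibpAmp]; ring
  simp only [h2]
  rw [integral_const_mul, h1, ← mul_assoc, prodK, ← Finset.prod_mul_distrib]
  simp only [mul_comm (resK 4 _), one_sub_I_mul_pow_mul_resK, Finset.prod_const_one, one_mul]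

end IntegrationByParts

section AmplitudeBounds

/-- The linear functional `(x, ξ, y) ↦ x_i - y_i`. -/
noncomputable def diffL {n : ℕ} (i : Fin n) : Tri n →L[ℝ] ℝ :=
  (ContinuousLinearMap.proj (R := ℝ) (φ := fun _ : Fin n => ℝ) i).comp
    (ContinuousLinearMap.fst ℝ (Vec n) (Vec n × Vec n) -
      (ContinuousLinearMap.snd ℝ (Vec n) (Vec n)).comp
        (ContinuousLinearMap.snd ℝ (Vec n) (Vec n × Vec n)))

lemma diffL_apply {n : ℕ} (i : Fin n) (X : Tri n) : diffL i X = X.1 i - X.2.2 i := by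
  simp [diffL]

lemma abs_diffL_triE_le {n : ℕ} (i : Fin n) (j : Fin n ⊕ Fin n ⊕ Fin n) :
    |diffL i (triE j)| ≤ 1 := by
  rw [diffL_apply]
  rcases j with j | j | j
  · by_cases h : i = j <;> simp [triE, h]
  · simp [triE]
  · by_cases h : i = j <;> simp [triE, h]

lemma contDiff_prodK_diff {n : ℕ} : ContDiff ℝ (⊤ : ℕ∞) fun X : Tri n => prodK (X.1 - X.2.2) := by
  have : (fun X : Tri n => prodK (X.1 - X.2.2)) = fun X => ∏ i, resK 4 (diffL i X) := by
    funext X; simp [prodK, diffL_apply]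
  rw [this]
  exact contDiff_prod fun i _ => (contDiff_resK 4).comp (diffL i).contDiff

lemma contDiff_ibpAmp {n : ℕ} {c : Tri n → ℂ} (hc : ContDiff ℝ (⊤ : ℕ∞) c) :
    ContDiff ℝ (⊤ : ℕ∞) (ibpAmp c) :=
  contDiff_prodK_diff.mul (contDiff_itAddD hc _ _)

lemma exists_bdAt_prodK (n N : ℕ) : ∃ C : ℝ, 1 ≤ C ∧ ∀ X : Tri n,
    BdAt triE N (fun X : Tri n => prodK (X.1 - X.2.2)) X
      (C * ∏ i, ((1 + (X.1 i - X.2.2 i) ^ 2)⁻¹) ^ 2) := by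
  obtain ⟨C, hC1, hC⟩ := exists_iteratedDeriv_resK_bound N
  refine ⟨(2 ^ N) ^ n * C ^ n, ?_, fun X => ?_⟩
  · exact one_le_mul_of_one_le_of_one_le (one_le_pow₀ (one_le_pow₀ (by norm_num)))
      (one_le_pow₀ hC1)
  · have h1 : (fun X : Tri n => prodK (X.1 - X.2.2)) =
        fun X => ∏ i, resK 4 (diffL i X + 0) := by
      funext X; simp [prodK, diffL_apply]
    rw [h1]
    have h2 := BdAt.prod (e := triE) (N := N) (X := X) Finset.univ
      (f := fun (i : Fin n) (X : Tri n) => resK 4 (diffL i X + 0))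
      (A := fun i => C * ((1 + (X.1 i - X.2.2 i) ^ 2)⁻¹) ^ 2)
      (fun i => (contDiff_resK 4).comp ((diffL i).contDiff.add contDiff_const))
      (fun i => BdAt.comp_linear (contDiff_resK 4) (diffL i) 0 (abs_diffL_triE_le i)
        fun m hm => by
          have := hC m hm (diffL i X + 0)
          rwa [add_zero, diffL_apply] at *)
    refine h2.mono le_rfl (le_of_eq ?_)
    rw [Finset.prod_mul_distrib]
    simp [mul_assoc]

lemma exists_bdAt_ibpAmp (n : ℕ) : ∃ C : ℝ, 1 ≤ C ∧ ∀ c : Tri n → ℂ, ContDiff ℝ (⊤ : ℕ∞) c →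
    ∀ (X : Tri n) (A : ℝ), BdAt triE (6 * n) c X A →
      BdAt triE (2 * n) (ibpAmp c) X (C * A * ∏ i, ((1 + (X.1 i - X.2.2 i) ^ 2)⁻¹) ^ 2) := by
  obtain ⟨C, hC1, hC⟩ := exists_bdAt_prodK n (2 * n)
  refine ⟨2 ^ (2 * n) * (C * 2 ^ (4 * n)), ?_, fun c hc X A hA => ?_⟩
  · exact one_le_mul_of_one_le_of_one_le (one_le_pow₀ (by norm_num))
      (one_le_mul_of_one_le_of_one_le hC1 (one_le_pow₀ (by norm_num)))
  · have h1 := BdAt.itAddD (N := 2 * n) hc ((fourL n).map fun i => Sum.inr (Sum.inl i))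
      (hA.mono (by simp [length_fourL]; omega) le_rfl)
    have h2 := BdAt.mul contDiff_prodK_diff (contDiff_itAddD hc _ _) (hC X) h1
    refine h2.mono le_rfl (le_of_eq ?_)
    rw [List.length_map, length_fourL]
    ring

/-- The list of all `x`- and `y`-indices. -/
def outerL (n : ℕ) : List (Fin n ⊕ Fin n ⊕ Fin n) :=
  (List.finRange n).map Sum.inl ++ (List.finRange n).map fun i => Sum.inr (Sum.inr i)

/-- The amplitude obtained by integrating by parts in the frequencies and applying
`∏ (1 + ∂_{x_j}) (1 + ∂_{y_j})`. -/
noncomputable def smoothAmp {n : ℕ} (c : Tri n → ℂ) : Tri n → ℂ :=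
  itAddD triE (outerL n) (ibpAmp c)

lemma contDiff_smoothAmp {n : ℕ} {c : Tri n → ℂ} (hc : ContDiff ℝ (⊤ : ℕ∞) c) :
    ContDiff ℝ (⊤ : ℕ∞) (smoothAmp c) :=
  contDiff_itAddD (contDiff_ibpAmp hc) _ _

lemma exists_norm_smoothAmp_le (n : ℕ) : ∃ C : ℝ, 1 ≤ C ∧ ∀ c : Tri n → ℂ,
    ContDiff ℝ (⊤ : ℕ∞) c → ∀ (X : Tri n) (A : ℝ), BdAt triE (6 * n) c X A →
      ‖smoothAmp c X‖ ≤ C * A * ∏ i, ((1 + (X.1 i - X.2.2 i) ^ 2)⁻¹) ^ 2 := by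
  obtain ⟨C, hC1, hC⟩ := exists_bdAt_ibpAmp n
  refine ⟨2 ^ (2 * n) * C, one_le_mul_of_one_le_of_one_le (one_le_pow₀ (by norm_num)) hC1,
    fun c hc X A hA => ?_⟩
  have h : (outerL n).length = 2 * n := by simp [outerL]; omega
  have := BdAt.itAddD (N := 0) (contDiff_ibpAmp hc) (outerL n)
    ((hC c hc X A hA).mono (by omega) le_rfl)
  refine this.norm_le.trans (le_of_eq ?_)
  rw [h]; ring

lemma inv_one_add_sq_le_one (w : ℝ) : (1 + w ^ 2)⁻¹ ≤ 1 :=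
  inv_le_one_of_one_le₀ (by nlinarith [sq_nonneg w])

lemma inv_one_add_sq_nonneg (w : ℝ) : 0 ≤ (1 + w ^ 2)⁻¹ := by positivity

lemma prod_inv_sq_le_one {n : ℕ} (w : Fin n → ℝ) : ∏ i, ((1 + w i ^ 2)⁻¹) ^ 2 ≤ 1 :=
  Finset.prod_le_one (fun i _ => by positivity) fun i _ =>
    pow_le_one₀ (inv_one_add_sq_nonneg _) (inv_one_add_sq_le_one _)

lemma one_add_sq_mul_prod_le {n : ℕ} [NeZero n] (w : Fin n → ℝ) :
    (1 + w 0 ^ 2) * ∏ i, ((1 + w i ^ 2)⁻¹) ^ 2 ≤ ∏ i, (1 + w i ^ 2)⁻¹ := by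
  simp only [pow_two ((1 + w _ ^ 2)⁻¹), Finset.prod_mul_distrib]
  rw [← mul_assoc]
  refine mul_le_of_le_one_left (Finset.prod_nonneg fun i _ => inv_one_add_sq_nonneg _) ?_
  rw [← Finset.mul_prod_erase _ _ (Finset.mem_univ (0 : Fin n)), ← mul_assoc,
    mul_inv_cancel₀ (by positivity), one_mul]
  exact Finset.prod_le_one (fun i _ => inv_one_add_sq_nonneg _) fun i _ => inv_one_add_sq_le_one _

lemma ibpAmp_eq_integral {n : ℕ} {c : Tri n → ℂ} (hc : ContDiff ℝ (⊤ : ℕ∞) c) {S : ℝ}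
    (hS : ∀ X, BdAt triE (6 * n) c X S) (X : Tri n) :
    ibpAmp c X = ∫ z, ∫ z', smoothAmp c (X - (z', 0, z)) ∂expPi n ∂expPi n := by
  obtain ⟨C, hC1, hC⟩ := exists_bdAt_ibpAmp n
  set ly : List (Fin n ⊕ Fin n ⊕ Fin n) := (List.finRange n).map fun i => Sum.inr (Sum.inr i)
    with hly
  have hsum : ∀ (z : Vec n), ((List.finRange n).map fun i => z i • (Pi.single i (1 : ℝ) : Vec n)).sum
      = z := by
    intro z
    rw [← List.ofFn_eq_map, List.sum_ofFn]
    simp only [← Pi.single_smul, smul_eq_mul, mul_one]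
    exact Finset.univ_sum_single z
  have hS0 : 0 ≤ S := (hS X).nonneg
  have hb : ∀ X, BdAt triE (2 * n) (ibpAmp c) X (C * S) := fun X =>
    (hC c hc X S (hS X)).mono le_rfl (mul_le_of_le_one_right (by positivity) (prod_inv_sq_le_one _))
  have h1 := fun X => eq_integral_itAddD (contDiff_ibpAmp hc) (fun i : Fin n => triE (Sum.inr (Sum.inr i)))
    (List.finRange n) (List.nodup_finRange n) (S := C * S)
    (fun X => ((hb X).index _).mono (by simp; omega) le_rfl) X
  have hcy : ContDiff ℝ (⊤ : ℕ∞) (itAddD triE ly (ibpAmp c)) :=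
    contDiff_itAddD (contDiff_ibpAmp hc) _ _
  have hby : ∀ X, BdAt triE n (itAddD triE ly (ibpAmp c)) X (2 ^ ly.length * (C * S)) := fun X =>
    BdAt.itAddD (contDiff_ibpAmp hc) ly ((hb X).mono (by simp [hly]; omega) le_rfl)
  have h2 := fun X => eq_integral_itAddD hcy (fun i : Fin n => triE (Sum.inl i))
    (List.finRange n) (List.nodup_finRange n)
    (fun X => ((hby X).index _).mono (by simp) le_rfl) X
  have hsy : ∀ z : Vec n, ((List.finRange n).map fun i =>
      z i • (triE (Sum.inr (Sum.inr i)) : Tri n)).sum = (0, 0, z) := by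
    intro z
    have := congrArg (fun z => ((0, 0, z) : Tri n)) (hsum z)
    rw [← this]
    simp only [triE, Sum.elim_inr]
    generalize List.finRange n = l
    induction l with
    | nil => rfl
    | cons i l ih => simp only [List.map_cons, List.sum_cons, ih]; simp
  have hsx : ∀ z : Vec n, ((List.finRange n).map fun i =>
      z i • (triE (Sum.inl i) : Tri n)).sum = (z, 0, 0) := by
    intro z
    have := congrArg (fun z => ((z, 0, 0) : Tri n)) (hsum z)
    rw [← this]
    simp only [triE, Sum.elim_inl]
    generalize List.finRange n = l
    induction l with
    | nil => rfl
    | cons i l ih => simp only [List.map_cons, List.sum_cons, ih]; simp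
  rw [h1]
  refine integral_congr_ae (Filter.Eventually.of_forall fun z => ?_)
  simp only [hsy]
  rw [itAddD_index, h2]
  refine integral_congr_ae (Filter.Eventually.of_forall fun z' => ?_)
  simp only [hsx]
  rw [itAddD_index, ← itAddD_append, smoothAmp, outerL]
  congr 1
  ext i <;> simp

end AmplitudeBounds

section CoreEstimate

open scoped ENNReal

/-- The function `w * chr · ξ`, averaged over translations. -/
noncomputable def expAvg {n : ℕ} (w : Vec n → ℂ) (ξ x : Vec n) : ℂ :=
  ∫ z, w (x + z) * chr (x + z) ξ ∂expPi n

lemma measurable_expAvg {n : ℕ} {w : Vec n → ℂ} (hw : Measurable w) :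
    Measurable fun p : Vec n × Vec n => expAvg w p.1 p.2 := by
  have : StronglyMeasurable fun q : (Vec n × Vec n) × Vec n =>
      w (q.1.2 + q.2) * chr (q.1.2 + q.2) q.1.1 := by
    have h : Measurable fun q : (Vec n × Vec n) × Vec n => q.1.2 + q.2 := by fun_prop
    exact ((hw.comp h).mul (continuous_chr.measurable.comp
      (h.prodMk (by fun_prop : Measurable fun q : (Vec n × Vec n) × Vec n => q.1.1)))).stronglyMeasurable
  exact this.integral_prod_right'.measurable

lemma lintegral_expAvg_sq_le {n : ℕ} {w : Vec n → ℂ} (hw : Measurable w) (hi : Integrable w) :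
    ∫⁻ ξ, ∫⁻ x, ‖expAvg w ξ x‖ₑ ^ 2 ≤ ENNReal.ofReal ((2 * π) ^ n) * ∫⁻ x, ‖w x‖ₑ ^ 2 := by
  have hmeas : Measurable fun p : Vec n × Vec n => ‖expAvg w p.1 p.2‖ₑ ^ 2 :=
    (measurable_expAvg hw).enorm.pow_const 2
  rw [lintegral_lintegral_swap hmeas.aemeasurable]
  have h1 : ∀ x : Vec n, ∫⁻ ξ, ‖expAvg w ξ x‖ₑ ^ 2 ≤ ENNReal.ofReal ((2 * π) ^ n) *
      ∫⁻ z, ENNReal.ofReal (expDPi z) ^ 2 * ‖w (x + z)‖ₑ ^ 2 := by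
    intro x
    have hg : Measurable fun z : Vec n => (expDPi z : ℂ) * w (x + z) :=
      (Complex.measurable_ofReal.comp measurable_expDPi).mul (hw.comp (measurable_const_add x))
    have hgi : Integrable fun z : Vec n => (expDPi z : ℂ) * w (x + z) := by
      refine (hi.comp_add_left x).bdd_mul (c := 1)
        (Complex.measurable_ofReal.comp measurable_expDPi).aestronglyMeasurable
        (Filter.Eventually.of_forall fun z => ?_)
      rw [Complex.norm_real, Real.norm_of_nonneg (expDPi_nonneg z)]
      exact expDPi_le_one z
    have h2 : ∀ ξ, ‖expAvg w ξ x‖ₑ = ‖∫ z, (expDPi z : ℂ) * w (x + z) * chr z ξ‖ₑ := by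
      intro ξ
      have : expAvg w ξ x = chr x ξ * ∫ z, (expDPi z : ℂ) * w (x + z) * chr z ξ := by
        rw [expAvg, integral_expPi, ← integral_const_mul]
        refine integral_congr_ae (Filter.Eventually.of_forall fun z => ?_)
        simp only [chr_add]; ring
      rw [this, enorm_mul, ← ofReal_norm (chr x ξ), norm_chr, ENNReal.ofReal_one, one_mul]
    simp only [h2]
    refine (lintegral_fourier_sq_le hg hgi).trans_eq ?_
    congr 1
    refine lintegral_congr fun z => ?_
    rw [enorm_mul, mul_pow, ← ofReal_norm ((expDPi z : ℝ) : ℂ), Complex.norm_real,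
      Real.norm_of_nonneg (expDPi_nonneg z)]
  have hm2 : Measurable fun p : Vec n × Vec n =>
      ENNReal.ofReal (expDPi p.2) ^ 2 * ‖w (p.1 + p.2)‖ₑ ^ 2 :=
    ((measurable_expDPi.comp measurable_snd).ennreal_ofReal.pow_const 2).mul
      ((hw.comp (measurable_fst.add measurable_snd)).enorm.pow_const 2)
  refine (lintegral_mono h1).trans ?_
  rw [lintegral_const_mul' _ _ ENNReal.ofReal_ne_top]
  refine mul_le_mul_right ?_ _
  rw [lintegral_lintegral_swap hm2.aemeasurable]
  have h3 : ∀ z : Vec n, ∫⁻ x, ENNReal.ofReal (expDPi z) ^ 2 * ‖w (x + z)‖ₑ ^ 2 =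
      ENNReal.ofReal (expDPi z) ^ 2 * ∫⁻ x, ‖w x‖ₑ ^ 2 := by
    intro z
    rw [lintegral_const_mul' _ _ (ENNReal.pow_ne_top ENNReal.ofReal_ne_top),
      lintegral_add_right_eq_self (fun x => ‖w x‖ₑ ^ 2) z]
  simp only [h3]
  rw [lintegral_mul_const _ (measurable_expDPi.ennreal_ofReal.pow_const 2)]
  exact mul_le_of_le_one_left' (lintegral_expDPi_sq_le n)

lemma integral_tri_congr {n : ℕ} {f g : Tri n → ℂ} (hf : Integrable f) (hg : Integrable g)
    (h : ∀ x y, ∫ ξ, f (x, ξ, y) = ∫ ξ, g (x, ξ, y)) : ∫ X, f X = ∫ X, g X := by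
  rw [Measure.volume_eq_prod, integral_prod _ hf, integral_prod _ hg]
  refine integral_congr_ae ?_
  filter_upwards [Integrable.prod_right_ae hf, Integrable.prod_right_ae hg] with x hx hx'
  rw [Measure.volume_eq_prod] at hx hx' ⊢
  rw [integral_prod_symm _ hx, integral_prod_symm _ hx']
  simp only [h]

/-- The oscillating factor `e^{i (x - y) ξ} u(y) v(x)`. -/
noncomputable def oscF {n : ℕ} (u v : Vec n → ℂ) (X : Tri n) : ℂ :=
  chr (X.1 - X.2.2) X.2.1 * (u X.2.2 * v X.1)

lemma measurable_oscF {n : ℕ} {u v : Vec n → ℂ} (hu : Measurable u) (hv : Measurable v) :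
    Measurable (oscF u v) := by
  have h : Continuous fun X : Tri n => (X.1 - X.2.2, X.2.1) := by fun_prop
  exact ((continuous_chr.comp h).measurable).mul
    ((hu.comp (by fun_prop)).mul (hv.comp (by fun_prop)))

lemma norm_oscF {n : ℕ} (u v : Vec n → ℂ) (X : Tri n) :
    ‖oscF u v X‖ = ‖v X.1‖ * ‖u X.2.2‖ := by
  rw [oscF, norm_mul, norm_chr, one_mul, norm_mul, mul_comm]

lemma integrable_tri {n : ℕ} {W : Vec n → ℝ} {u v : Vec n → ℂ} (hW : Integrable W)
    (hu : Integrable u) (hv : Integrable v) :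
    Integrable fun X : Tri n => W X.2.1 * (‖v X.1‖ * ‖u X.2.2‖) := by
  have := hv.norm.mul_prod (hW.mul_prod hu.norm)
  refine this.congr (Filter.Eventually.of_forall fun X => ?_)
  simp only; ring

lemma integral_oscF_eq_ibpAmp {n : ℕ} {c : Tri n → ℂ} (hc : ContDiff ℝ (⊤ : ℕ∞) c)
    {W : Vec n → ℝ} (hW : Integrable W) (hcW : ∀ X, BdAt triE (6 * n) c X (W X.2.1))
    {u v : Vec n → ℂ} (hum : Measurable u) (hvm : Measurable v) (hu : Integrable u)
    (hv : Integrable v) :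
    ∫ X, c X * oscF u v X = ∫ X, ibpAmp c X * oscF u v X := by
  obtain ⟨C, hC1, hC⟩ := exists_bdAt_ibpAmp n
  have hm := measurable_oscF hum hvm
  refine integral_tri_congr ?_ ?_ fun x y => ?_
  · refine (integrable_tri hW hu hv).mono' (hc.continuous.measurable.mul hm).aestronglyMeasurable
      (Filter.Eventually.of_forall fun X => ?_)
    rw [norm_mul, norm_oscF]
    exact mul_le_mul_of_nonneg_right (hcW X).norm_le (by positivity)
  · refine ((integrable_tri hW hu hv).const_mul C).mono'
      ((contDiff_ibpAmp hc).continuous.measurable.mul hm).aestronglyMeasurable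
      (Filter.Eventually.of_forall fun X => ?_)
    rw [norm_mul, norm_oscF, ← mul_assoc C]
    refine mul_le_mul_of_nonneg_right ((hC c hc X _ (hcW X)).norm_le.trans ?_) (by positivity)
    exact mul_le_of_le_one_right (mul_nonneg (by linarith) (hcW X).nonneg) (prod_inv_sq_le_one _)
  · have h := integral_mul_chr_eq_ibpAmp hc hW (fun X => (hcW X).mono (by omega) le_rfl) x y
    simp only [oscF, ← mul_assoc]
    simp only [integral_mul_const, h]

lemma integral_oscF_eq_smoothAmp {n : ℕ} {c : Tri n → ℂ} (hc : ContDiff ℝ (⊤ : ℕ∞) c)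
    {W : Vec n → ℝ} (hW : Integrable W) (hcW : ∀ X, BdAt triE (6 * n) c X (W X.2.1))
    {S : ℝ} (hS : ∀ ξ, W ξ ≤ S)
    {u v : Vec n → ℂ} (hum : Measurable u) (hvm : Measurable v) (hu : Integrable u)
    (hv : Integrable v) :
    ∫ X, c X * oscF u v X = ∫ X : Tri n, smoothAmp c X *
      ((∫ z, u (X.2.2 + z) * chr (-(X.2.2 + z)) X.2.1 ∂expPi n) * expAvg v X.2.1 X.1) := by
  obtain ⟨C, hC1, hC⟩ := exists_norm_smoothAmp_le n
  have hm := measurable_oscF hum hvm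
  have hsc := (contDiff_smoothAmp hc).continuous
  rw [integral_oscF_eq_ibpAmp hc hW hcW hum hvm hu hv]
  set ν : Measure (Vec n × Vec n) := (expPi n).prod (expPi n) with hν
  have hsb : ∀ X, ‖smoothAmp c X‖ ≤ C * W X.2.1 := fun X =>
    (hC c hc X _ (hcW X)).trans
      (mul_le_of_le_one_right (mul_nonneg (by linarith) (hcW X).nonneg) (prod_inv_sq_le_one _))
  set T : Vec n × Vec n → Tri n := fun Z => (Z.2, 0, Z.1) with hT
  have hTc : Continuous T := by fun_prop
  have hib : ∀ X, ibpAmp c X = ∫ Z, smoothAmp c (X - T Z) ∂ν := by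
    intro X
    rw [ibpAmp_eq_integral hc (fun X => (hcW X).mono le_rfl (hS _)) X, hν, integral_prod]
    refine Integrable.of_bound (hsc.comp (continuous_const.sub hTc)).aestronglyMeasurable (C * S)
      (Filter.Eventually.of_forall fun Z => (hsb _).trans ?_)
    exact mul_le_mul_of_nonneg_left (hS _) (by linarith)
  set J' : (Vec n × Vec n) × Tri n → ℂ := fun p => smoothAmp c (p.2 - T p.1) * oscF u v p.2 with hJ'
  have hJ'm : Measurable J' :=
    (hsc.comp (continuous_snd.sub (hTc.comp continuous_fst))).measurable.mul
      (hm.comp measurable_snd)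
  have hJ'i : Integrable J' (ν.prod volume) := by
    refine (((integrable_tri hW hu hv).const_mul C).comp_snd ν).mono' hJ'm.aestronglyMeasurable
      (Filter.Eventually.of_forall fun p => ?_)
    rw [hJ', norm_mul, norm_oscF, ← mul_assoc C]
    refine mul_le_mul_of_nonneg_right ((hsb _).trans_eq ?_) (by positivity)
    simp [hT]
  have hΦ : MeasurePreserving (fun p : (Vec n × Vec n) × Tri n => (p.1, p.2 + T p.1))
      (ν.prod volume) (ν.prod volume) := by
    refine (MeasurePreserving.id ν).skew_product (g := fun Z X => X + T Z) ?_
      (Filter.Eventually.of_forall fun Z => ?_)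
    · exact (continuous_snd.add (hTc.comp continuous_fst)).measurable
    · exact
      ((measurePreserving_add_right (volume : Measure (Vec n)) Z.2).prod
        ((measurePreserving_add_right (volume : Measure (Vec n)) 0).prod
          (measurePreserving_add_right (volume : Measure (Vec n)) Z.1))).map_eq
  have e1 : ∫ X, ibpAmp c X * oscF u v X = ∫ p, J' p ∂(ν.prod volume) := by
    rw [integral_prod_symm _ hJ'i]
    refine integral_congr_ae (Filter.Eventually.of_forall fun X => ?_)
    simp only [hJ', hib, integral_mul_const]
  have e2 : ∫ p, J' p ∂(ν.prod volume) = ∫ p, J' (p.1, p.2 + T p.1) ∂(ν.prod volume) := by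
    conv_lhs => rw [← hΦ.map_eq]
    rw [integral_map hΦ.measurable.aemeasurable hJ'm.aestronglyMeasurable]
  have hJi : Integrable (fun p : (Vec n × Vec n) × Tri n => J' (p.1, p.2 + T p.1)) (ν.prod volume) :=
    hΦ.integrable_comp_of_integrable hJ'i
  rw [e1, e2, integral_prod_symm _ hJi]
  refine integral_congr_ae (Filter.Eventually.of_forall fun X => ?_)
  simp only [expAvg]
  rw [← integral_prod_mul, ← integral_const_mul]
  refine integral_congr_ae (Filter.Eventually.of_forall fun Z => ?_)
  simp only [hJ', add_sub_cancel_right, oscF, hT, Prod.fst_add, Prod.snd_add, add_zero]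
  rw [sub_eq_add_neg, chr_add]
  ring

end CoreEstimate

section CoreTheorem

open scoped ENNReal

lemma enorm_expAvg_conj {n : ℕ} (u : Vec n → ℂ) (ξ y : Vec n) :
    ‖∫ z, u (y + z) * chr (-(y + z)) ξ ∂expPi n‖ₑ =
      ‖expAvg (fun y => starRingEnd ℂ (u y)) ξ y‖ₑ := by
  have h : expAvg (fun y => starRingEnd ℂ (u y)) ξ y =
      starRingEnd ℂ (∫ z, u (y + z) * chr (-(y + z)) ξ ∂expPi n) := by
    rw [expAvg, ← integral_conj]
    refine integral_congr_ae (Filter.Eventually.of_forall fun z => ?_)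
    simp only [chr_neg, map_mul, Complex.conj_conj]
  rw [h, ← ofReal_norm, ← ofReal_norm, RCLike.norm_conj]

lemma lintegral_prod_inv_one_add_sq (n : ℕ) (A : ℝ) (hA : 0 ≤ A) :
    ∫⁻ w : Vec n, ENNReal.ofReal (A * ∏ i, (1 + w i ^ 2)⁻¹) = ENNReal.ofReal (A * π ^ n) := by
  have hi : Integrable fun w : Vec n => A * ∏ i, (1 + w i ^ 2)⁻¹ :=
    (Integrable.fintype_prod (f := fun _ (x : ℝ) => (1 + x ^ 2)⁻¹)
      fun _ => integrable_inv_one_add_sq).const_mul _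
  rw [← ofReal_integral_eq_lintegral_ofReal hi (Filter.Eventually.of_forall fun w =>
    mul_nonneg hA (Finset.prod_nonneg fun i _ => inv_one_add_sq_nonneg _)), integral_const_mul]
  congr 2
  have := integral_fintype_prod_volume_eq_prod (ι := Fin n) (fun _ (x : ℝ) => (1 + x ^ 2)⁻¹)
  rw [this]
  simp [integral_univ_inv_one_add_sq]

lemma lintegral_tri {n : ℕ} {G : Tri n → ℝ≥0∞} (hG : Measurable G) :
    ∫⁻ X, G X = ∫⁻ ξ, ∫⁻ x, ∫⁻ y, G (x, ξ, y) := by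
  rw [Measure.volume_eq_prod, lintegral_prod _ hG.aemeasurable]
  have h1 : ∀ x : Vec n, ∫⁻ q : Vec n × Vec n, G (x, q) = ∫⁻ ξ, ∫⁻ y, G (x, ξ, y) := by
    intro x
    rw [Measure.volume_eq_prod, lintegral_prod]
    exact (hG.comp measurable_prodMk_left).aemeasurable
  simp only [h1]
  refine lintegral_lintegral_swap (f := fun x ξ => ∫⁻ y, G (x, ξ, y)) ?_
  have h2 : Measurable fun p : (Vec n × Vec n) × Vec n => G (p.1.1, p.1.2, p.2) :=
    hG.comp (by fun_prop)
  exact h2.lintegral_prod_right'.aemeasurable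

/-- The bound for the oscillatory integral form with an amplitude all of whose derivatives of
order at most `6 n` are bounded by `B (1 + (x_0 - y_0)²)`. -/
theorem exists_enorm_integral_oscF_le (n : ℕ) [NeZero n] : ∃ C : ℝ, 0 < C ∧
    ∀ c : Tri n → ℂ, ContDiff ℝ (⊤ : ℕ∞) c → ∀ B : ℝ, 0 ≤ B →
    (∀ X : Tri n, BdAt triE (6 * n) c X (B * (1 + (X.1 0 - X.2.2 0) ^ 2))) →
    ∀ W : Vec n → ℝ, Integrable W → (∀ X, BdAt triE (6 * n) c X (W X.2.1)) →
    ∀ S : ℝ, (∀ ξ, W ξ ≤ S) →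
    ∀ u v : Vec n → ℂ, Measurable u → Measurable v → Integrable u → Integrable v →
    ∀ s : ℝ≥0∞, s ≠ 0 → s ≠ ⊤ →
      2 * ‖∫ X, c X * oscF u v X‖ₑ ≤ ENNReal.ofReal (C * B) *
        (s * (∫⁻ x, ‖v x‖ₑ ^ 2) + s⁻¹ * ∫⁻ y, ‖u y‖ₑ ^ 2) := by
  obtain ⟨C, hC1, hC⟩ := exists_norm_smoothAmp_le n
  have hC0 : 0 ≤ C := by linarith
  refine ⟨C * π ^ n * (2 * π) ^ n, by positivity, ?_⟩
  intro c hc B hB hcB W hW hcW S hS u v hum hvm hu hv s hs hs'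
  rw [integral_oscF_eq_smoothAmp hc hW hcW hS hum hvm hu hv]
  set u' : Vec n → ℂ := fun y => starRingEnd ℂ (u y) with hu'
  have hu'm : Measurable u' := Complex.continuous_conj.measurable.comp hum
  have hu'i : Integrable u' :=
    hu.mono hu'm.aestronglyMeasurable (Filter.Eventually.of_forall fun y => by simp [hu'])
  set K : Vec n → ℝ≥0∞ := fun w => ENNReal.ofReal (C * B * ∏ i, (1 + w i ^ 2)⁻¹) with hK
  have hKm : Measurable K := by
    refine Measurable.ennreal_ofReal (measurable_const.mul (Finset.measurable_prod _ fun i _ => ?_))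
    exact ((measurable_const.add ((measurable_pi_apply i).pow_const 2)).inv)
  have hbound : ∀ X : Tri n, ‖smoothAmp c X *
      ((∫ z, u (X.2.2 + z) * chr (-(X.2.2 + z)) X.2.1 ∂expPi n) * expAvg v X.2.1 X.1)‖ₑ ≤
      K (X.1 - X.2.2) * (‖expAvg v X.2.1 X.1‖ₑ * ‖expAvg u' X.2.1 X.2.2‖ₑ) := by
    intro X
    rw [enorm_mul, enorm_mul, enorm_expAvg_conj, mul_comm ‖expAvg _ _ _‖ₑ]
    refine mul_le_mul_left ?_ _
    rw [← ofReal_norm]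
    refine ENNReal.ofReal_le_ofReal ((hC c hc X _ (hcB X)).trans ?_)
    rw [← mul_assoc, mul_assoc (C * B)]
    exact mul_le_mul_of_nonneg_left (one_add_sq_mul_prod_le fun i => X.1 i - X.2.2 i)
      (mul_nonneg hC0 hB)
  have hm1 := (measurable_expAvg hvm).enorm
  have hm2 := (measurable_expAvg hu'm).enorm
  have hmeas : Measurable fun X : Tri n =>
      K (X.1 - X.2.2) * (‖expAvg v X.2.1 X.1‖ₑ * ‖expAvg u' X.2.1 X.2.2‖ₑ) :=
    (hKm.comp (by fun_prop : Measurable fun X : Tri n => X.1 - X.2.2)).mul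
      ((hm1.comp (by fun_prop : Measurable fun X : Tri n => (X.2.1, X.1))).mul
        (hm2.comp (by fun_prop : Measurable fun X : Tri n => (X.2.1, X.2.2))))
  have hKint : ∫⁻ w, K w = ENNReal.ofReal (C * B * π ^ n) :=
    lintegral_prod_inv_one_add_sq n _ (mul_nonneg hC0 hB)
  have hsw : ∫⁻ X : Tri n,
      K (X.1 - X.2.2) * (‖expAvg v X.2.1 X.1‖ₑ * ‖expAvg u' X.2.1 X.2.2‖ₑ) =
      ∫⁻ ξ, ∫⁻ x, ∫⁻ y, K (x - y) * (‖expAvg v ξ x‖ₑ * ‖expAvg u' ξ y‖ₑ) := lintegral_tri hmeas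
  calc 2 * ‖∫ X : Tri n, smoothAmp c X * ((∫ z, u (X.2.2 + z) * chr (-(X.2.2 + z)) X.2.1 ∂expPi n) *
          expAvg v X.2.1 X.1)‖ₑ
      ≤ 2 * ∫⁻ ξ, ∫⁻ x, ∫⁻ y, K (x - y) * (‖expAvg v ξ x‖ₑ * ‖expAvg u' ξ y‖ₑ) := by
        rw [← hsw]
        exact mul_le_mul_right ((enorm_integral_le_lintegral_enorm _).trans
          (lintegral_mono hbound)) _
    _ = ∫⁻ ξ, 2 * ∫⁻ x, ∫⁻ y, K (x - y) * (‖expAvg v ξ x‖ₑ * ‖expAvg u' ξ y‖ₑ) := by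
        rw [lintegral_const_mul' _ _ (by simp)]
    _ ≤ ∫⁻ ξ, ENNReal.ofReal (C * B * π ^ n) * (s * (∫⁻ x, ‖expAvg v ξ x‖ₑ ^ 2) +
          s⁻¹ * ∫⁻ y, ‖expAvg u' ξ y‖ₑ ^ 2) := by
        refine lintegral_mono fun ξ => ?_
        rw [← hKint]
        exact schur_convolution hKm (hm1.comp (measurable_const.prodMk measurable_id))
          (hm2.comp (measurable_const.prodMk measurable_id)) s hs hs'
    _ = ENNReal.ofReal (C * B * π ^ n) * (s * (∫⁻ ξ, ∫⁻ x, ‖expAvg v ξ x‖ₑ ^ 2) +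
          s⁻¹ * ∫⁻ ξ, ∫⁻ y, ‖expAvg u' ξ y‖ₑ ^ 2) := by
        rw [lintegral_const_mul' _ _ ENNReal.ofReal_ne_top, lintegral_add_left,
          lintegral_const_mul' _ _ hs', lintegral_const_mul' _ _ (ENNReal.inv_ne_top.2 hs)]
        exact (hm1.pow_const 2).lintegral_prod_right'.const_mul _
    _ ≤ ENNReal.ofReal (C * B * π ^ n) *
          (s * (ENNReal.ofReal ((2 * π) ^ n) * ∫⁻ x, ‖v x‖ₑ ^ 2) +
          s⁻¹ * (ENNReal.ofReal ((2 * π) ^ n) * ∫⁻ y, ‖u' y‖ₑ ^ 2)) := by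
        refine mul_le_mul_right (add_le_add (mul_le_mul_right ?_ _) (mul_le_mul_right ?_ _)) _
        · exact lintegral_expAvg_sq_le hvm hv
        · exact lintegral_expAvg_sq_le hu'm hu'i
    _ = ENNReal.ofReal (C * π ^ n * (2 * π) ^ n * B) *
        (s * (∫⁻ x, ‖v x‖ₑ ^ 2) + s⁻¹ * ∫⁻ y, ‖u y‖ₑ ^ 2) := by
        have h1 : ∀ y, ‖u' y‖ₑ = ‖u y‖ₑ := fun y => by
          rw [hu', ← ofReal_norm, ← ofReal_norm, RCLike.norm_conj]
        have h2 : C * π ^ n * (2 * π) ^ n * B = C * B * π ^ n * (2 * π) ^ n := by ring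
        simp only [h1]
        rw [h2, ENNReal.ofReal_mul (p := C * B * π ^ n) (by positivity)]
        ring

end CoreTheorem

section SymbolClass

/-- The list containing `g i` exactly `A i` times for every `i`. -/
def multList {n : ℕ} {ι : Type*} (A : Fin n → ℕ) (g : Fin n → ι) : List ι :=
  (List.finRange n).flatMap fun i => List.replicate (A i) (g i)

lemma length_multList {n : ℕ} {ι : Type*} (A : Fin n → ℕ) (g : Fin n → ι) :
    (multList A g).length = fullLen A := by
  simp [multList, List.length_flatMap, fullLen, Fin.sum_univ_def]

lemma count_multList {n : ℕ} {ι : Type*} [DecidableEq ι] (A : Fin n → ℕ) {g : Fin n → ι}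
    (hg : Function.Injective g) (i : Fin n) : (multList A g).count (g i) = A i := by
  simp only [multList, List.count_flatMap, Function.comp_def, List.count_replicate]
  rw [← Fin.sum_univ_def]
  simp [hg.eq_iff]

lemma count_multList_eq_zero {n : ℕ} {ι : Type*} [DecidableEq ι] (A : Fin n → ℕ) {g : Fin n → ι}
    {x : ι} (hx : ∀ i, g i ≠ x) : (multList A g).count x = 0 := by
  simp [multList, List.count_flatMap, Function.comp_def, List.count_replicate, hx]

lemma prod_map_multList {n : ℕ} {ι : Type*} (A : Fin n → ℕ) (g : Fin n → ι) (w : ι → ℝ) :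
    ((multList A g).map w).prod = ∏ i, w (g i) ^ A i := by
  rw [multList, Fin.prod_univ_def]
  induction List.finRange n with
  | nil => simp
  | cons i l ih => simp [List.flatMap_cons, ih]

lemma mpd_eq_itD {n : ℕ} (A : Fin n → ℕ) (f : Vec n → ℂ) :
    mpd A f = itD (fun i : Fin n => Pi.single i (1 : ℝ)) (multList A id) f := by
  rw [mpd, multList]
  induction List.finRange n with
  | nil => rfl
  | cons i l ih =>
    rw [List.foldr_cons, ih, List.flatMap_cons, itD_append]
    induction A i with
    | zero => rfl
    | succ k ihk => rw [Function.iterate_succ_apply', ihk, List.replicate_succ, itD_cons]; rfl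

lemma multList_map {n : ℕ} {ι : Type*} (A : Fin n → ℕ) (g : Fin n → ι) :
    (multList A id).map g = multList A g := by
  simp [multList, List.map_flatMap]

lemma mpd_slice {n : ℕ} {f : Tri n → ℂ} (hf : ContDiff ℝ (⊤ : ℕ∞) f) (T : Vec n →L[ℝ] Tri n)
    (g : Fin n → Fin n ⊕ Fin n ⊕ Fin n) (hT : ∀ i, T (Pi.single i 1) = triE (g i))
    (A : Fin n → ℕ) (b : Tri n) (x : Vec n) :
    mpd A (fun x => f (T x + b)) x = itD triE (multList A g) f (T x + b) := by
  rw [mpd_eq_itD, itD_comp_affine hf]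
  simp only [hT]
  rw [itD_index, multList_map]

lemma d1B_d2B_d3B_eq_itD {n : ℕ} {a : Vec n → Vec n → Vec n → ℂ}
    (ha : ContDiff ℝ (⊤ : ℕ∞) fun X : Tri n => a X.1 X.2.1 X.2.2) (A B A' : Fin n → ℕ)
    (q p q' : Vec n) :
    d1B A (d2B B (d3B A' a)) q p q' =
      itD triE (multList A Sum.inl ++ (multList B (Sum.inr ∘ Sum.inl) ++
        multList A' (Sum.inr ∘ Sum.inr))) (fun X : Tri n => a X.1 X.2.1 X.2.2) (q, p, q') := by
  have h3 : ∀ q p q', d3B A' a q p q' =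
      itD triE (multList A' (Sum.inr ∘ Sum.inr)) (fun X : Tri n => a X.1 X.2.1 X.2.2)
        (q, p, q') := by
    intro q p q'
    have := mpd_slice ha ((ContinuousLinearMap.inr ℝ (Vec n) (Vec n × Vec n)).comp
      (ContinuousLinearMap.inr ℝ (Vec n) (Vec n))) (Sum.inr ∘ Sum.inr) (fun i => rfl) A'
      (q, p, 0) q'
    simpa [d3B] using this
  have hs3 := contDiff_itD ha triE (multList A' (Sum.inr ∘ Sum.inr))
  have h2 : ∀ q p q', d2B B (d3B A' a) q p q' =
      itD triE (multList B (Sum.inr ∘ Sum.inl)) (itD triE (multList A' (Sum.inr ∘ Sum.inr))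
        (fun X : Tri n => a X.1 X.2.1 X.2.2)) (q, p, q') := by
    intro q p q'
    have := mpd_slice hs3 ((ContinuousLinearMap.inr ℝ (Vec n) (Vec n × Vec n)).comp
      (ContinuousLinearMap.inl ℝ (Vec n) (Vec n))) (Sum.inr ∘ Sum.inl) (fun i => rfl) B
      (q, 0, q') p
    simpa [d2B, h3] using this
  have hs2 := contDiff_itD hs3 triE (multList B (Sum.inr ∘ Sum.inl))
  have := mpd_slice hs2 (ContinuousLinearMap.inl ℝ (Vec n) (Vec n × Vec n)) Sum.inl
    (fun i => rfl) A (0, p, q') q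
  rw [itD_append, itD_append]
  simpa [d1B, h2] using this

/-- The weight attached to each coordinate direction by the symbol class. -/
noncomputable def dirWt {n : ℕ} [NeZero n] (μ : ℝ) : Fin n ⊕ Fin n ⊕ Fin n → ℝ :=
  Sum.elim (fun i => if i = 0 then 1 else μ⁻¹)
    (Sum.elim (fun i => if i = 0 then 1 else μ) fun i => if i = 0 then 1 else μ⁻¹)

lemma prod_ite_pow {n : ℕ} [NeZero n] (μ : ℝ) (A : Fin n → ℕ) :
    ∏ i, (if i = 0 then (1 : ℝ) else μ) ^ A i = μ ^ angLen A := by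
  rw [angLen, ← Finset.prod_pow_eq_pow_sum]
  refine Finset.prod_congr rfl fun i _ => ?_
  split_ifs <;> simp

lemma exists_perm_multList {n : ℕ} (l : List (Fin n ⊕ Fin n ⊕ Fin n)) : ∃ A B A' : Fin n → ℕ,
    l.Perm (multList A Sum.inl ++ (multList B (Sum.inr ∘ Sum.inl) ++
      multList A' (Sum.inr ∘ Sum.inr))) := by
  let _ : BEq (Fin n ⊕ Fin n ⊕ Fin n) := instBEqOfDecidableEq
  refine ⟨fun i => l.count (Sum.inl i), fun i => l.count (Sum.inr (Sum.inl i)),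
    fun i => l.count (Sum.inr (Sum.inr i)), ?_⟩
  rw [List.perm_iff_count]
  have i2 : Function.Injective (Sum.inr ∘ Sum.inl : Fin n → Fin n ⊕ Fin n ⊕ Fin n) :=
    Sum.inr_injective.comp Sum.inl_injective
  have i3 : Function.Injective (Sum.inr ∘ Sum.inr : Fin n → Fin n ⊕ Fin n ⊕ Fin n) :=
    Sum.inr_injective.comp Sum.inr_injective
  rintro (i | i | i)
  · rw [List.count_append, List.count_append, count_multList _ Sum.inl_injective,
      count_multList_eq_zero _ (by simp), count_multList_eq_zero _ (by simp)]
    simp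
  · have := count_multList (fun i => l.count (Sum.inr (Sum.inl i))) i2 i
    simp only [Function.comp_apply] at this
    rw [List.count_append, List.count_append, this,
      count_multList_eq_zero _ (by simp), count_multList_eq_zero _ (by simp)]
    simp
  · have := count_multList (fun i => l.count (Sum.inr (Sum.inr i))) i3 i
    simp only [Function.comp_apply] at this
    rw [List.count_append, List.count_append, this,
      count_multList_eq_zero _ (by simp), count_multList_eq_zero _ (by simp)]
    simp

lemma lamT_pos {lam : ℝ → ℝ} (hlam : ∀ r, 0 < lam r) (t : ℝ) (j k : ℤ) : 0 < lamT lam t j k :=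
  hlam _

lemma le_sum_sum_sum {α β γ : Type*} [Fintype α] [Fintype β] [Fintype γ] {T : α → β → γ → ℝ}
    (hT : ∀ a b c, 0 ≤ T a b c) (a : α) (b : β) (c : γ) : T a b c ≤ ∑ a, ∑ b, ∑ c, T a b c :=
  (Finset.single_le_sum (f := fun c => T a b c) (fun _ _ => hT _ _ _) (Finset.mem_univ c)).trans
    ((Finset.single_le_sum (f := fun b => ∑ c, T a b c)
      (fun _ _ => Finset.sum_nonneg fun _ _ => hT _ _ _) (Finset.mem_univ b)).trans
    (Finset.single_le_sum (f := fun a => ∑ b, ∑ c, T a b c)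
      (fun _ _ => Finset.sum_nonneg fun _ _ => Finset.sum_nonneg fun _ _ => hT _ _ _)
      (Finset.mem_univ a)))

lemma le_iSup_five {α β γ δ ε : Type*} [Nonempty α] [Nonempty β] [Nonempty γ] [Nonempty δ]
    [Nonempty ε] {F : α → β → γ → δ → ε → ℝ} {C : ℝ} (hF : ∀ a b c d e, F a b c d e ≤ C)
    (a : α) (b : β) (c : γ) (d : δ) (e : ε) : F a b c d e ≤ ⨆ a, ⨆ b, ⨆ c, ⨆ d, ⨆ e, F a b c d e :=
  (le_ciSup (f := fun e => F a b c d e) ⟨C, Set.forall_mem_range.2 (hF a b c d)⟩ e).trans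
  ((le_ciSup (f := fun d => ⨆ e, F a b c d e)
    ⟨C, Set.forall_mem_range.2 fun d => ciSup_le (hF a b c d)⟩ d).trans
  ((le_ciSup (f := fun c => ⨆ d, ⨆ e, F a b c d e)
    ⟨C, Set.forall_mem_range.2 fun c => ciSup_le fun d => ciSup_le (hF a b c d)⟩ c).trans
  ((le_ciSup (f := fun b => ⨆ c, ⨆ d, ⨆ e, F a b c d e)
    ⟨C, Set.forall_mem_range.2 fun b => ciSup_le fun c => ciSup_le fun d =>
      ciSup_le (hF a b c d)⟩ b).trans
  (le_ciSup (f := fun a => ⨆ b, ⨆ c, ⨆ d, ⨆ e, F a b c d e)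
    ⟨C, Set.forall_mem_range.2 fun a => ciSup_le fun b => ciSup_le fun c => ciSup_le fun d =>
      ciSup_le (hF a b c d)⟩ a))))

/-- The weighted derivative occurring in the seminorms of order zero. -/
noncomputable def blockTerm {n : ℕ} [NeZero n] (lam : ℝ → ℝ) (t : ℝ)
    (a : Vec n → Vec n → Vec n → ℂ) (A B A' : Fin n → ℕ) (j k : ℤ) (q p q' : Vec n) : ℝ :=
  if |q 0 - (j : ℝ)| ≤ 1 ∧ |q' 0 - (k : ℝ)| ≤ 1 then
    lamT lam t j k ^ ((angLen B : ℤ) - (angLen A : ℤ) - (angLen A' : ℤ)) *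
      ‖d1B A (d2B B (d3B A' a)) q p q'‖
  else 0

lemma blockTerm_nonneg {n : ℕ} [NeZero n] {lam : ℝ → ℝ} (hlam : ∀ r, 0 < lam r) (t : ℝ)
    (a : Vec n → Vec n → Vec n → ℂ) (A B A' : Fin n → ℕ) (j k : ℤ) (q p q' : Vec n) :
    0 ≤ blockTerm lam t a A B A' j k q p q' := by
  have := lamT_pos hlam t j k
  rw [blockTerm]
  split_ifs
  · positivity
  · exact le_rfl

lemma bisymSeminorm_zero_eq {n : ℕ} [NeZero n] (lam : ℝ → ℝ) (M : ℕ) (t : ℝ)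
    (a : Vec n → Vec n → Vec n → ℂ) : bisymSeminorm lam M 0 0 t a =
    ∑ A : Fin n → Fin (M + 1), ∑ B : Fin n → Fin (M + 1), ∑ A' : Fin n → Fin (M + 1),
      if fullLen (fun i => (A i : ℕ)) + fullLen (fun i => (B i : ℕ))
        + fullLen (fun i => (A' i : ℕ)) ≤ M then
        ⨆ j : ℤ, ⨆ k : ℤ, ⨆ q : Vec n, ⨆ p : Vec n, ⨆ q' : Vec n,
          blockTerm lam t a (fun i => (A i : ℕ)) (fun i => (B i : ℕ)) (fun i => (A' i : ℕ))
            j k q p q'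
      else 0 := by
  simp only [bisymSeminorm, neg_zero, zero_mul, add_zero, Real.rpow_zero, one_mul, blockTerm]

lemma norm_le_bisymSeminorm {n : ℕ} [NeZero n] {lam : ℝ → ℝ} (hlam : ∀ r, 0 < lam r) {t : ℝ}
    {a : Vec n → Vec n → Vec n → ℂ} (ha : IsBisymbol lam 0 0 t a) {M : ℕ} (A B A' : Fin n → ℕ)
    (hM : fullLen A + fullLen B + fullLen A' ≤ M) (j k : ℤ) (q p q' : Vec n)
    (hj : |q 0 - (j : ℝ)| ≤ 1) (hk : |q' 0 - (k : ℝ)| ≤ 1) :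
    lamT lam t j k ^ ((angLen B : ℤ) - (angLen A : ℤ) - (angLen A' : ℤ)) *
      ‖d1B A (d2B B (d3B A' a)) q p q'‖ ≤ bisymSeminorm lam M 0 0 t a := by
  have hlt : ∀ (D : Fin n → ℕ), fullLen D ≤ M → ∀ i, D i < M + 1 := fun D hD i =>
    Nat.lt_succ_of_le ((Finset.single_le_sum (f := D) (fun _ _ => Nat.zero_le _)
      (Finset.mem_univ i)).trans hD)
  obtain ⟨C, hC0, hC⟩ := ha.2 A B A'
  have hle : ∀ (j k : ℤ) (q p q' : Vec n), blockTerm lam t a A B A' j k q p q' ≤ C := by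
    intro j k q p q'
    rw [blockTerm]
    split_ifs with h
    · simpa using hC j k q p q' h.1 h.2
    · exact hC0.le
  have h1 : blockTerm lam t a A B A' j k q p q' =
      lamT lam t j k ^ ((angLen B : ℤ) - (angLen A : ℤ) - (angLen A' : ℤ)) *
      ‖d1B A (d2B B (d3B A' a)) q p q'‖ := if_pos ⟨hj, hk⟩
  rw [← h1, bisymSeminorm_zero_eq]
  refine (le_iSup_five hle j k q p q').trans ?_
  have h2 := le_sum_sum_sum (T := fun A B A' : Fin n → Fin (M + 1) =>
    if fullLen (fun i => (A i : ℕ)) + fullLen (fun i => (B i : ℕ))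
        + fullLen (fun i => (A' i : ℕ)) ≤ M then
        ⨆ j : ℤ, ⨆ k : ℤ, ⨆ q : Vec n, ⨆ p : Vec n, ⨆ q' : Vec n,
          blockTerm lam t a (fun i => (A i : ℕ)) (fun i => (B i : ℕ)) (fun i => (A' i : ℕ))
            j k q p q'
      else 0) (fun A B A' => by
        split_ifs
        · exact Real.iSup_nonneg fun j => Real.iSup_nonneg fun k => Real.iSup_nonneg fun q =>
            Real.iSup_nonneg fun p => Real.iSup_nonneg fun q' =>
              blockTerm_nonneg hlam t a _ _ _ j k q p q'
        · exact le_rfl)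
    (fun i => ⟨A i, hlt A (by omega) i⟩) (fun i => ⟨B i, hlt B (by omega) i⟩)
    (fun i => ⟨A' i, hlt A' (by omega) i⟩)
  simp only [if_pos hM] at h2
  exact h2

lemma prod_dirWt_mul_norm_itD_le {n : ℕ} [NeZero n] {lam : ℝ → ℝ} (hlam : ∀ r, 0 < lam r) {t : ℝ}
    {a : Vec n → Vec n → Vec n → ℂ} (ha : IsBisymbol lam 0 0 t a) {M : ℕ}
    (l : List (Fin n ⊕ Fin n ⊕ Fin n)) (hl : l.length ≤ M) (j k : ℤ) (X : Tri n)
    (hj : |X.1 0 - (j : ℝ)| ≤ 1) (hk : |X.2.2 0 - (k : ℝ)| ≤ 1) :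
    (l.map (dirWt (lamT lam t j k))).prod *
      ‖itD triE l (fun X : Tri n => a X.1 X.2.1 X.2.2) X‖ ≤ bisymSeminorm lam M 0 0 t a := by
  obtain ⟨A, B, A', hp⟩ := exists_perm_multList l
  have hlen := hp.length_eq
  rw [List.length_append, List.length_append, length_multList, length_multList,
    length_multList] at hlen
  have hμ := lamT_pos hlam t j k
  rw [itD_perm ha.1 triE hp, (hp.map _).prod_eq, List.map_append, List.map_append,
    List.prod_append, List.prod_append, prod_map_multList, prod_map_multList, prod_map_multList]
  refine le_trans (le_of_eq ?_) (norm_le_bisymSeminorm hlam ha A B A' (by omega) j k X.1 X.2.1 X.2.2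
    hj hk)
  rw [d1B_d2B_d3B_eq_itD ha.1]
  congr 1
  simp only [dirWt, Function.comp_apply, Sum.elim_inl, Sum.elim_inr, prod_ite_pow]
  rw [zpow_sub₀ hμ.ne', zpow_sub₀ hμ.ne', zpow_natCast, zpow_natCast, zpow_natCast, inv_pow,
    inv_pow]
  field_simp

lemma norm_le_biSup {n : ℕ} [NeZero n] {lam : ℝ → ℝ} {t : ℝ}
    {a : Vec n → Vec n → Vec n → ℂ} (ha : IsBisymbol lam 0 0 t a) (q p q' : Vec n) :
    ‖a q p q'‖ ≤ biSup a := by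
  obtain ⟨C, hC0, hC⟩ := ha.2 0 0 0
  have hz : ∀ f : Vec n → ℂ, mpd 0 f = f := fun f => by
    rw [mpd]; induction List.finRange n with
    | nil => rfl
    | cons i l ih => simp
  have hle : ∀ q p q', ‖a q p q'‖ ≤ C := by
    intro q p q'
    have h : ∀ r : ℝ, |r - (round r : ℤ)| ≤ 1 := fun r =>
      (abs_sub_round r).trans (by norm_num)
    have := hC (round (q 0)) (round (q' 0)) q p q' (h _) (h _)
    simpa [d1B, d2B, d3B, hz, angLen] using this
  have hb : ∀ (f : Vec n → ℝ), (∀ x, f x ≤ C) →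
      BddAbove (Set.range f) := fun f hf => ⟨C, by rintro _ ⟨x, rfl⟩; exact hf x⟩
  refine le_trans ?_ (le_ciSup (hb _ fun q => ciSup_le fun p => ciSup_le fun q' => hle q p q') q)
  refine le_trans ?_ (le_ciSup (hb _ fun p => ciSup_le fun q' => hle q p q') p)
  exact le_ciSup (hb _ fun q' => hle q p q') q'

end SymbolClass

section Rescaling

open scoped ENNReal

/-- The coordinatewise rescaling of a vector. -/
noncomputable def scaleV {n : ℕ} (w : Vec n) : Vec n →L[ℝ] Vec n :=
  ContinuousLinearMap.pi fun i => w i • ContinuousLinearMap.proj (R := ℝ) (φ := fun _ => ℝ) i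

@[simp] lemma scaleV_apply {n : ℕ} (w x : Vec n) (i : Fin n) : scaleV w x i = w i * x i := rfl

/-- The rescaling of the three groups of variables. -/
noncomputable def scaleT {n : ℕ} (w w' w'' : Vec n) : Tri n →L[ℝ] Tri n :=
  (scaleV w).prodMap ((scaleV w').prodMap (scaleV w''))

@[simp] lemma scaleT_fst {n : ℕ} (w w' w'' : Vec n) (X : Tri n) :
    (scaleT w w' w'' X).1 = scaleV w X.1 := rfl

@[simp] lemma scaleT_snd_fst {n : ℕ} (w w' w'' : Vec n) (X : Tri n) :
    (scaleT w w' w'' X).2.1 = scaleV w' X.2.1 := rfl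

@[simp] lemma scaleT_snd_snd {n : ℕ} (w w' w'' : Vec n) (X : Tri n) :
    (scaleT w w' w'' X).2.2 = scaleV w'' X.2.2 := rfl

lemma scaleV_single {n : ℕ} (w : Vec n) (i : Fin n) :
    scaleV w (Pi.single i 1) = w i • Pi.single i (1 : ℝ) := by
  funext k
  by_cases h : k = i
  · subst h; simp
  · simp [h]

lemma scaleT_triE {n : ℕ} (w w' w'' : Vec n) (ι : Fin n ⊕ Fin n ⊕ Fin n) :
    scaleT w w' w'' (triE ι) = Sum.elim w (Sum.elim w' w'') ι • triE ι := by
  rcases ι with i | i | i <;>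
    simp [triE, scaleT, scaleV_single]

lemma BdAt.comp_scaleT {n : ℕ} [NeZero n] {f : Tri n → ℂ} (hf : ContDiff ℝ (⊤ : ℕ∞) f)
    {N : ℕ} {X : Tri n} {r μ S₀ S₁ : ℝ} (hr0 : 0 ≤ r) (hr1 : r ≤ 1) (hμ : 0 < μ)
    {w w' w'' : Vec n}
    (hw : ∀ ι, Sum.elim w (Sum.elim w' w'') ι = r * dirWt μ ι)
    (h0 : ‖f (scaleT w w' w'' X)‖ ≤ S₀) (hS₁ : 0 ≤ S₁)
    (h1 : ∀ l, l.length ≤ N →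
      (l.map (dirWt μ)).prod * ‖itD triE l f (scaleT w w' w'' X)‖ ≤ S₁) :
    BdAt triE N (fun X => f (scaleT w w' w'' X)) X (S₀ + r * S₁) := by
  intro l hl
  have hS₀ : 0 ≤ S₀ := (norm_nonneg _).trans h0
  by_cases hne : l = []
  · subst hne
    exact h0.trans (le_add_of_nonneg_right (mul_nonneg hr0 hS₁))
  rw [itD_comp_scaling hf (scaleT w w' w'') triE _ (scaleT_triE w w' w''), norm_mul,
    Complex.norm_real]
  have hd : ∀ ι : Fin n ⊕ Fin n ⊕ Fin n, 0 ≤ dirWt μ ι := by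
    rintro (i | i | i) <;> simp only [dirWt, Sum.elim_inl, Sum.elim_inr] <;> split_ifs <;> positivity
  have hp : ∀ l : List (Fin n ⊕ Fin n ⊕ Fin n), (l.map (Sum.elim w (Sum.elim w' w''))).prod =
      r ^ l.length * (l.map (dirWt μ)).prod := by
    intro l
    induction l with
    | nil => simp
    | cons i l ih => simp only [List.map_cons, List.prod_cons, ih, hw, List.length_cons, pow_succ]; ring
  have hpn : 0 ≤ (l.map (dirWt μ)).prod := List.prod_nonneg fun x hx => by
    obtain ⟨ι, -, rfl⟩ := List.mem_map.1 hx
    exact hd ι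
  rw [hp, Real.norm_of_nonneg (by positivity), mul_assoc]
  refine (mul_le_mul (pow_le_of_le_one hr0 hr1 (n := l.length) (by simpa using hne)) (h1 l hl)
    (by positivity) hr0).trans ?_
  linarith

lemma one_add_sq_sub_le {r x y α β : ℝ} (hr0 : 0 ≤ r) (hr1 : r ≤ 1) (hα : |r * x - α| ≤ 1)
    (hβ : |r * y - β| ≤ 1) : 1 + (α - β) ^ 2 ≤ 9 * (1 + (x - y) ^ 2) := by
  have h1 := abs_le.1 hα
  have h2 := abs_le.1 hβ
  set δ := (r * x - α) - (r * y - β) with hδ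
  have h3 : α - β = r * (x - y) - δ := by rw [hδ]; ring
  have h4 : δ ^ 2 ≤ 4 := by nlinarith
  have h5 : (r * (x - y)) ^ 2 ≤ (x - y) ^ 2 := by
    rw [mul_pow]
    exact mul_le_of_le_one_left (sq_nonneg _) (pow_le_one₀ hr0 hr1)
  rw [h3]
  nlinarith [sq_nonneg (r * (x - y) + δ), sq_nonneg (x - y)]

/-- The amplitude localised to a block, in rescaled variables. -/
noncomputable def blockAmp {n : ℕ} [NeZero n] (f : Tri n → ℂ) (w : Vec n) (w' : Vec n) (r α β : ℝ)
    (ν : Vec n) (X : Tri n) : ℂ :=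
  bump (r * X.1 0 - α) * (bump (r * X.2.2 0 - β) *
    (f (scaleT w w' w X) * ∏ i, resK 4 (ν i * X.2.1 i)))

lemma exists_bdAt_blockAmp (n : ℕ) [NeZero n] (N : ℕ) : ∃ C : ℝ, 0 < C ∧
    ∀ (f : Tri n → ℂ) (w w' : Vec n) (r α β : ℝ) (ν : Vec n), ContDiff ℝ (⊤ : ℕ∞) f →
      0 ≤ r → r ≤ 1 → (∀ i, |ν i| ≤ 1) →
      ∀ B, 0 ≤ B → (∀ X : Tri n, |r * X.1 0 - α| ≤ 1 → |r * X.2.2 0 - β| ≤ 1 →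
        BdAt triE N (fun X => f (scaleT w w' w X)) X B) →
      ContDiff ℝ (⊤ : ℕ∞) (blockAmp f w w' r α β ν) ∧
      ∀ X, BdAt triE N (blockAmp f w w' r α β ν) X
          (C * B * ∏ i, ((1 + (ν i * X.2.1 i) ^ 2)⁻¹) ^ 2) ∧
        BdAt triE N (blockAmp f w w' r α β ν) X
          (C * B / (1 + (α - β) ^ 2) * (1 + (X.1 0 - X.2.2 0) ^ 2)) := by
  obtain ⟨Cb, hCb1, hCb⟩ := exists_iteratedDeriv_bump_bound N
  obtain ⟨Cr, hCr1, hCr⟩ := exists_iteratedDeriv_resK_bound N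
  set K : ℝ := 2 ^ N * (Cb * (2 ^ N * (Cb * (2 ^ N * ((2 ^ N) ^ n * Cr ^ n))))) with hK
  have hK0 : 0 < K := by positivity
  refine ⟨9 * K, by positivity, ?_⟩
  intro f w w' r α β ν hf hr0 hr1 hν B hB hfB
  let L1 : Tri n →L[ℝ] ℝ := r • (ContinuousLinearMap.proj (R := ℝ) (φ := fun _ => ℝ) 0).comp
    (ContinuousLinearMap.fst ℝ (Vec n) (Vec n × Vec n))
  let L2 : Tri n →L[ℝ] ℝ := r • (ContinuousLinearMap.proj (R := ℝ) (φ := fun _ => ℝ) 0).comp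
    ((ContinuousLinearMap.snd ℝ (Vec n) (Vec n)).comp
      (ContinuousLinearMap.snd ℝ (Vec n) (Vec n × Vec n)))
  let L3 : Fin n → Tri n →L[ℝ] ℝ := fun i =>
    ν i • (ContinuousLinearMap.proj (R := ℝ) (φ := fun _ => ℝ) i).comp
    ((ContinuousLinearMap.fst ℝ (Vec n) (Vec n)).comp
      (ContinuousLinearMap.snd ℝ (Vec n) (Vec n × Vec n)))
  have hsingle : ∀ (i k : Fin n) (ρ : ℝ), |ρ| ≤ 1 → |ρ * (Pi.single i (1 : ℝ) : Vec n) k| ≤ 1 := by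
    intro i k ρ hρ
    by_cases h : k = i
    · subst h; simpa using hρ
    · simp [h]
  have hrr : |r| ≤ 1 := abs_le.2 ⟨by linarith, hr1⟩
  have hL1 : ∀ ι, |L1 (triE ι)| ≤ 1 := by
    rintro (i | i | i)
    · exact hsingle i 0 r hrr
    · simp [L1, triE]
    · simp [L1, triE]
  have hL2 : ∀ ι, |L2 (triE ι)| ≤ 1 := by
    rintro (i | i | i)
    · simp [L2, triE]
    · simp [L2, triE]
    · exact hsingle i 0 r hrr
  have hL3 : ∀ k ι, |L3 k (triE ι)| ≤ 1 := by
    rintro k (i | i | i)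
    · simp [L3, triE]
    · exact hsingle i k _ (hν k)
    · simp [L3, triE]
  have e1 : (fun X : Tri n => bump (r * X.1 0 - α)) = fun X => bump (L1 X + -α) := rfl
  have e2 : (fun X : Tri n => bump (r * X.2.2 0 - β)) = fun X => bump (L2 X + -β) := rfl
  have e3 : ∀ i, (fun X : Tri n => resK 4 (ν i * X.2.1 i)) = fun X => resK 4 (L3 i X + 0) :=
    fun i => by funext X; rw [add_zero]; rfl
  have s1 : ContDiff ℝ (⊤ : ℕ∞) fun X : Tri n => bump (r * X.1 0 - α) := by
    rw [e1]; exact contDiff_bump.comp (L1.contDiff.add contDiff_const)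
  have s2 : ContDiff ℝ (⊤ : ℕ∞) fun X : Tri n => bump (r * X.2.2 0 - β) := by
    rw [e2]; exact contDiff_bump.comp (L2.contDiff.add contDiff_const)
  have s3 : ∀ i, ContDiff ℝ (⊤ : ℕ∞) fun X : Tri n => resK 4 (ν i * X.2.1 i) := fun i => by
    rw [e3]; exact (contDiff_resK 4).comp ((L3 i).contDiff.add contDiff_const)
  have s4 : ContDiff ℝ (⊤ : ℕ∞) fun X : Tri n => f (scaleT w w' w X) :=
    hf.comp (scaleT w w' w).contDiff
  have s5 : ContDiff ℝ (⊤ : ℕ∞) fun X : Tri n => ∏ i, resK 4 (ν i * X.2.1 i) :=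
    contDiff_prod fun i _ => s3 i
  have s45 := s4.mul s5
  have s245 := s2.mul s45
  have sA : ContDiff ℝ (⊤ : ℕ∞) (blockAmp f w w' r α β ν) := s1.mul s245
  refine ⟨sA, ?_⟩
  have hzero : ∀ X : Tri n, ¬(|r * X.1 0 - α| ≤ 1 ∧ |r * X.2.2 0 - β| ≤ 1) →
      ∀ A : ℝ, 0 ≤ A → BdAt triE N (blockAmp f w w' r α β ν) X A := by
    intro X hX A hA l _
    rw [itD_eq_zero_of_eventuallyEq triE _ l]
    · simpa using hA
    rw [not_and_or, not_le, not_le] at hX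
    rcases hX with hX | hX
    · have hc : Continuous fun X : Tri n => |r * X.1 0 - α| := by fun_prop
      filter_upwards [continuousAt_const.eventually_lt hc.continuousAt hX] with Y hY
      rw [blockAmp, bump_eq_zero hY.le, zero_mul]
    · have hc : Continuous fun X : Tri n => |r * X.2.2 0 - β| := by fun_prop
      filter_upwards [continuousAt_const.eventually_lt hc.continuousAt hX] with Y hY
      rw [blockAmp, bump_eq_zero (r := r * Y.2.2 0 - β) hY.le, zero_mul, mul_zero]
  intro X
  have hprod0 : 0 ≤ ∏ i, ((1 + (ν i * X.2.1 i) ^ 2)⁻¹) ^ 2 :=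
    Finset.prod_nonneg fun i _ => by positivity
  have hprod1 : ∏ i, ((1 + (ν i * X.2.1 i) ^ 2)⁻¹) ^ 2 ≤ 1 :=
    Finset.prod_le_one (fun i _ => by positivity) fun i _ =>
      pow_le_one₀ (by positivity) (inv_one_add_sq_le_one _)
  by_cases hX : |r * X.1 0 - α| ≤ 1 ∧ |r * X.2.2 0 - β| ≤ 1
  swap
  · exact ⟨hzero X hX _ (by positivity), hzero X hX _ (by positivity)⟩
  have b1 : BdAt triE N (fun X : Tri n => bump (r * X.1 0 - α)) X Cb := by
    rw [e1]; exact BdAt.comp_linear contDiff_bump L1 _ hL1 fun m hm => hCb m hm _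
  have b2 : BdAt triE N (fun X : Tri n => bump (r * X.2.2 0 - β)) X Cb := by
    rw [e2]; exact BdAt.comp_linear contDiff_bump L2 _ hL2 fun m hm => hCb m hm _
  have b3 : ∀ i, BdAt triE N (fun X : Tri n => resK 4 (ν i * X.2.1 i)) X
      (Cr * ((1 + (ν i * X.2.1 i) ^ 2)⁻¹) ^ 2) := fun i => by
    rw [e3]
    refine BdAt.comp_linear (contDiff_resK 4) (L3 i) _ (hL3 i) fun m hm => ?_
    have : L3 i X + 0 = ν i * X.2.1 i := by rw [add_zero]; rfl
    rw [this]
    exact hCr m hm _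
  have b5 := BdAt.prod Finset.univ s3 b3
  have b := b1.mul s1 s245 (b2.mul s2 s45 ((hfB X hX.1 hX.2).mul s4 s5 b5))
  rw [Finset.card_univ, Fintype.card_fin, Finset.prod_mul_distrib, Finset.prod_const,
    Finset.card_univ, Fintype.card_fin] at b
  have hb : BdAt triE N (blockAmp f w w' r α β ν) X
      (K * B * ∏ i, ((1 + (ν i * X.2.1 i) ^ 2)⁻¹) ^ 2) := by
    refine BdAt.mono b le_rfl (le_of_eq ?_)
    rw [hK]; ring
  refine ⟨hb.mono le_rfl ?_, hb.mono le_rfl ?_⟩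
  · refine mul_le_mul_of_nonneg_right ?_ hprod0
    nlinarith [mul_nonneg hK0.le hB]
  · refine (mul_le_of_le_one_right (by positivity) hprod1).trans ?_
    have h9 := one_add_sq_sub_le hr0 hr1 hX.1 hX.2
    rw [div_mul_eq_mul_div, le_div_iff₀ (by positivity)]
    nlinarith [mul_le_mul_of_nonneg_left h9 (mul_nonneg hK0.le hB)]

end Rescaling

section Block

open scoped ENNReal

lemma det_scaleV_ne_zero {n : ℕ} {w : Vec n} (hw : ∀ i, w i ≠ 0) :
    LinearMap.det (scaleV w : Vec n →ₗ[ℝ] Vec n) * LinearMap.det (scaleV w⁻¹ : Vec n →ₗ[ℝ] Vec n) =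
      1 := by
  rw [← LinearMap.det_comp, ← LinearMap.det_id (A := ℝ) (M := Vec n)]
  congr 1
  ext x i
  simp [hw]

lemma exists_map_scale {n : ℕ} {w : Vec n} (hw : ∀ i, w i ≠ 0) : ∃ d : ℝ≥0∞, d ≠ 0 ∧ d ≠ ⊤ ∧
    Measure.map (scaleV w) volume = d • (volume : Measure (Vec n)) ∧
    Measure.map (scaleT w w⁻¹ w) volume = d • (volume : Measure (Tri n)) := by
  have h1 := det_scaleV_ne_zero hw
  set d := LinearMap.det (scaleV w : Vec n →ₗ[ℝ] Vec n) with hd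
  have hd0 : d ≠ 0 := left_ne_zero_of_mul_eq_one h1
  refine ⟨ENNReal.ofReal |d⁻¹|, ?_, ENNReal.ofReal_ne_top, ?_, ?_⟩
  · rw [Ne, ENNReal.ofReal_eq_zero, not_le]
    exact abs_pos.2 (inv_ne_zero hd0)
  · exact Measure.map_linearMap_addHaar_eq_smul_addHaar volume
      (f := (scaleV w : Vec n →ₗ[ℝ] Vec n)) hd0
  · have hT : LinearMap.det (scaleT w w⁻¹ w : Tri n →ₗ[ℝ] Tri n) = d := by
      have e : (scaleT w w⁻¹ w : Tri n →ₗ[ℝ] Tri n) =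
          LinearMap.prodMap (scaleV w : Vec n →ₗ[ℝ] Vec n)
            (LinearMap.prodMap (scaleV w⁻¹ : Vec n →ₗ[ℝ] Vec n)
              (scaleV w : Vec n →ₗ[ℝ] Vec n)) := rfl
      rw [e, LinearMap.det_prodMap, LinearMap.det_prodMap, ← hd, mul_comm _ d, h1, mul_one]
    have h2 : Measure.IsAddHaarMeasure
        ((volume : Measure (Vec n)).prod (volume : Measure (Vec n))) :=
      Measure.prod.instIsAddHaarMeasure _ _
    have h3 : Measure.IsAddHaarMeasure (volume : Measure (Tri n)) :=
      @Measure.prod.instIsAddHaarMeasure _ _ _ _ _ _ _ _ (volume : Measure (Vec n))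
        ((volume : Measure (Vec n)).prod (volume : Measure (Vec n))) _ h2 _ _ _ _
    have := Measure.map_linearMap_addHaar_eq_smul_addHaar (volume : Measure (Tri n))
      (f := (scaleT w w⁻¹ w : Tri n →ₗ[ℝ] Tri n)) (by rw [hT]; exact hd0)
    rw [hT] at this
    exact this

lemma integrable_prod_inv_sq {n : ℕ} {ν : Vec n} (hν : ∀ i, ν i ≠ 0) :
    Integrable fun ξ : Vec n => ∏ i, ((1 + (ν i * ξ i) ^ 2)⁻¹) ^ 2 := by
  refine Integrable.fintype_prod (f := fun i (x : ℝ) => ((1 + (ν i * x) ^ 2)⁻¹) ^ 2) fun i => ?_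
  refine (integrable_inv_one_add_sq.comp_mul_left' (hν i)).mono ?_ ?_
  · exact (Continuous.aestronglyMeasurable (by fun_prop (disch := intro x; positivity)))
  · refine Filter.Eventually.of_forall fun x => ?_
    have h0 := inv_one_add_sq_nonneg (ν i * x)
    have h1 := inv_one_add_sq_le_one (ν i * x)
    rw [norm_of_nonneg (by positivity), norm_of_nonneg (by positivity)]
    exact pow_le_of_le_one h0 h1 two_ne_zero

/-- The regularised amplitude of the operator localised to a block. -/
noncomputable def blockSym {n : ℕ} [NeZero n] (a : Vec n → Vec n → Vec n → ℂ) (h ε : ℝ) (j k : ℤ)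
    (X : Tri n) : ℂ :=
  bump (X.1 0 - j) * (bump (X.2.2 0 - k) *
    (a X.1 (h • X.2.1) X.2.2 * ∏ i, resK 4 (ε * X.2.1 i)))

lemma continuous_resK (p : ℕ) : Continuous (resK p) := (contDiff_resK p).continuous

lemma continuous_blockSym {n : ℕ} [NeZero n] {a : Vec n → Vec n → Vec n → ℂ}
    (ha : ContDiff ℝ (⊤ : ℕ∞) fun X : Tri n => a X.1 X.2.1 X.2.2) (h ε : ℝ) (j k : ℤ) :
    Continuous (blockSym a h ε j k) := by
  have h1 := contDiff_bump.continuous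
  have h2 : Continuous fun X : Tri n => a X.1 (h • X.2.1) X.2.2 :=
    ha.continuous.comp (by fun_prop : Continuous fun X : Tri n => (X.1, h • X.2.1, X.2.2))
  refine (h1.comp (by fun_prop)).mul ((h1.comp (by fun_prop)).mul (h2.mul ?_))
  exact continuous_finsetProd _ fun i _ => (continuous_resK 4).comp (by fun_prop)

theorem exists_enorm_integral_blockSym_le (n : ℕ) [NeZero n] : ∃ C : ℝ, 0 < C ∧
    ∀ lam : ℝ → ℝ, (∀ r, 0 < lam r) → ∀ (t : ℝ) (a : Vec n → Vec n → Vec n → ℂ),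
    IsBisymbol lam 0 0 t a → ∀ h, 0 < h → h ≤ 1 → ∀ (j k : ℤ) (ε : ℝ), 0 < ε → ε ≤ √h →
    ε * lamT lam t j k ≤ √h →
    ∀ u v : Vec n → ℂ, Measurable u → Measurable v → Integrable u → Integrable v →
    ∀ s : ℝ≥0∞, s ≠ 0 → s ≠ ⊤ →
      2 * ‖∫ X, blockSym a h ε j k X * oscF u v X‖ₑ ≤
        ENNReal.ofReal (C * (biSup a + √h * bisymSeminorm lam (6 * n) 0 0 t a) /
          (1 + ((j : ℝ) - k) ^ 2)) *
        (s * (∫⁻ x, ‖v x‖ₑ ^ 2) + s⁻¹ * ∫⁻ y, ‖u y‖ₑ ^ 2) := by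
  obtain ⟨C₁, hC₁, H₁⟩ := exists_enorm_integral_oscF_le n
  obtain ⟨C₂, hC₂, H₂⟩ := exists_bdAt_blockAmp n (6 * n)
  refine ⟨C₁ * C₂, by positivity, ?_⟩
  intro lam hlam t a ha h hh0 hh1 j k ε hε0 hε1 hε2 u v hum hvm hu hv s hs hs'
  set r := √h with hr
  set μ := lamT lam t j k with hμd
  have hμ : 0 < μ := lamT_pos hlam t j k
  have hr0 : 0 < r := Real.sqrt_pos.2 hh0
  have hr1 : r ≤ 1 := Real.sqrt_le_one.2 hh1
  have hrr : r * r = h := Real.mul_self_sqrt hh0.le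
  set w : Vec n := fun i => r * (if i = 0 then 1 else μ⁻¹) with hw
  have hw0 : ∀ i, 0 < w i := fun i => by simp only [hw]; split_ifs <;> positivity
  have hwr : w 0 = r := by simp [hw]
  set w' : Vec n := h • w⁻¹ with hw'
  set ν : Vec n := fun i => ε * (w i)⁻¹ with hν
  have hν0 : ∀ i, 0 < ν i := fun i => mul_pos hε0 (inv_pos.2 (hw0 i))
  have hν1 : ∀ i, |ν i| ≤ 1 := fun i => by
    rw [abs_of_pos (hν0 i)]
    simp only [hν]
    rw [← div_eq_mul_inv, div_le_one (hw0 i)]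
    simp only [hw]
    split_ifs
    · simpa using hε1
    · rw [← div_eq_mul_inv, le_div_iff₀ hμ]; exact hε2
  have hwt : ∀ ι, Sum.elim w (Sum.elim w' w) ι = r * dirWt μ ι := by
    rintro (i | i | i)
    · rfl
    · simp only [Sum.elim_inr, Sum.elim_inl, dirWt, hw', Pi.smul_apply, Pi.inv_apply, hw,
        smul_eq_mul, ← hrr]
      split_ifs <;> field_simp
    · rfl
  set S₁ := bisymSeminorm lam (6 * n) 0 0 t a with hS₁
  set f : Tri n → ℂ := fun X => a X.1 X.2.1 X.2.2 with hf
  have hS₁0 : 0 ≤ S₁ := by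
    have := prod_dirWt_mul_norm_itD_le hlam ha (M := 6 * n) [] (by simp) 0 0 (0 : Tri n)
      (by simp) (by simp)
    exact le_trans (by simp) this
  set B := biSup a + r * S₁ with hB
  have hB0 : 0 ≤ B := add_nonneg ((norm_nonneg _).trans (norm_le_biSup ha 0 0 0))
    (mul_nonneg hr0.le hS₁0)
  obtain ⟨hsm, hbd⟩ := H₂ f w w' r j k ν ha.1 hr0.le hr1 hν1 B hB0 fun X h1 h2 => by
    refine BdAt.comp_scaleT ha.1 hr0.le hr1 hμ hwt (norm_le_biSup ha _ _ _) hS₁0 fun l hl => ?_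
    exact prod_dirWt_mul_norm_itD_le hlam ha l hl j k _ (by simpa [hwr] using h1)
      (by simpa [hwr] using h2)
  obtain ⟨d, hd0, hd1, hdV, hdT⟩ := exists_map_scale fun i => (hw0 i).ne'
  have hmV : Measurable (scaleV w) := (scaleV w).continuous.measurable
  have hmT : Measurable (scaleT w w⁻¹ w) := (scaleT w w⁻¹ w).continuous.measurable
  have hcomp : ∀ X, blockAmp f w w' r j k ν X *
      oscF (fun y => u (scaleV w y)) (fun x => v (scaleV w x)) X =
      (fun X => blockSym a h ε j k X * oscF u v X) (scaleT w w⁻¹ w X) := by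
    intro X
    have e1 : scaleV w' X.2.1 = h • scaleV w⁻¹ X.2.1 := by
      funext i; simp [hw', mul_assoc]
    have e2 : chr (X.1 - X.2.2) X.2.1 = chr (scaleV w X.1 - scaleV w X.2.2) (scaleV w⁻¹ X.2.1) := by
      rw [chr, chr]
      congr 3
      refine Finset.sum_congr rfl fun i _ => ?_
      have := (hw0 i).ne'
      simp only [Pi.sub_apply, scaleV_apply, Pi.inv_apply]
      field_simp
    have e3 : ∀ i, ν i * X.2.1 i = ε * scaleV w⁻¹ X.2.1 i := fun i => by
      simp [hν, mul_assoc]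
    simp only [blockAmp, blockSym, oscF, scaleT_fst, scaleT_snd_fst, scaleT_snd_snd, hf, e1, e2, e3,
      scaleV_apply w, hwr]
  have hGm : Measurable fun X => blockSym a h ε j k X * oscF u v X :=
    (continuous_blockSym ha.1 h ε j k).measurable.mul (measurable_oscF hum hvm)
  have hInt : ‖∫ X, blockAmp f w w' r j k ν X *
      oscF (fun y => u (scaleV w y)) (fun x => v (scaleV w x)) X‖ₑ =
      d * ‖∫ X, blockSym a h ε j k X * oscF u v X‖ₑ := by
    simp only [hcomp]
    rw [← integral_map hmT.aemeasurable hGm.aestronglyMeasurable, hdT, integral_smul_measure,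
      enorm_smul, Real.enorm_eq_ofReal ENNReal.toReal_nonneg, ENNReal.ofReal_toReal hd1]
  have hl : ∀ g : Vec n → ℂ, Measurable g → ∫⁻ x, ‖g (scaleV w x)‖ₑ ^ 2 = d * ∫⁻ x, ‖g x‖ₑ ^ 2 := by
    intro g hg
    rw [← lintegral_map (f := fun x => ‖g x‖ₑ ^ 2) (hg.enorm.pow_const 2) hmV, hdV,
      lintegral_smul_measure, smul_eq_mul]
  have hi : ∀ g : Vec n → ℂ, Measurable g → Integrable g → Integrable fun x => g (scaleV w x) := by
    intro g hg hgi
    refine (integrable_map_measure hg.aestronglyMeasurable hmV.aemeasurable).1 ?_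
    rw [hdV]
    exact hgi.smul_measure hd1
  have hK0 : 0 ≤ C₂ * B := mul_nonneg hC₂.le hB0
  have key := H₁ _ hsm (C₂ * B / (1 + ((j : ℝ) - k) ^ 2)) (by positivity)
    (fun X => (hbd X).2) (fun ξ => C₂ * B * ∏ i, ((1 + (ν i * ξ i) ^ 2)⁻¹) ^ 2)
    ((integrable_prod_inv_sq fun i => (hν0 i).ne').const_mul _) (fun X => (hbd X).1) (C₂ * B)
    (fun ξ => mul_le_of_le_one_right hK0 (Finset.prod_le_one (fun i _ => by positivity) fun i _ =>
      pow_le_one₀ (by positivity) (inv_one_add_sq_le_one _)))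
    _ _ (hum.comp hmV) (hvm.comp hmV) (hi u hum hu) (hi v hvm hv) s hs hs'
  simp only [Function.comp_def] at key
  rw [hInt, hl u hum, hl v hvm] at key
  have e : C₁ * (C₂ * B / (1 + ((j : ℝ) - k) ^ 2)) = C₁ * C₂ * B / (1 + ((j : ℝ) - k) ^ 2) := by
    ring
  rw [e] at key
  refine (ENNReal.mul_le_mul_iff_right hd0 hd1).1 ?_
  refine le_trans (le_of_eq ?_) (key.trans (le_of_eq ?_)) <;> ring

end Block

section Summation

open scoped ENNReal

/-- The decay of the interaction between the blocks. -/
noncomputable def blockKer (m : ℤ) : ℝ≥0∞ := ENNReal.ofReal (1 / (1 + (m : ℝ) ^ 2))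

lemma tsum_blockKer_ne_top : ∑' m : ℤ, blockKer m ≠ ⊤ := by
  have h : Summable fun m : ℤ => 1 / (1 + (m : ℝ) ^ 2) := by
    have h2 : Summable fun m : ℤ => 1 / (m : ℝ) ^ 2 :=
      Real.summable_one_div_int_pow.2 one_lt_two
    refine Summable.of_norm_bounded_eventually h2 ?_
    refine (Set.finite_singleton (0 : ℤ)).subset fun m hm => ?_
    by_contra hm0
    refine hm ?_
    have h0 : (m : ℝ) ≠ 0 := by exact_mod_cast hm0
    show ‖1 / (1 + (m : ℝ) ^ 2)‖ ≤ 1 / (m : ℝ) ^ 2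
    rw [Real.norm_of_nonneg (by positivity)]
    exact one_div_le_one_div_of_le (by positivity) (by linarith)
  exact h.tsum_ofReal_ne_top

lemma sum_sum_blockKer_le (F : Finset ℤ) (V : ℤ → ℝ≥0∞) :
    ∑ j ∈ F, ∑ k ∈ F, blockKer (j - k) * V j ≤ (∑' m, blockKer m) * ∑ j ∈ F, V j := by
  rw [Finset.mul_sum]
  refine Finset.sum_le_sum fun j _ => ?_
  rw [← Finset.sum_mul]
  refine mul_le_mul_left ?_ _
  refine (ENNReal.sum_le_tsum F).trans_eq ?_
  exact (Equiv.subLeft j).tsum_eq blockKer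

lemma sum_sum_blockKer_le' (F : Finset ℤ) (V : ℤ → ℝ≥0∞) :
    ∑ j ∈ F, ∑ k ∈ F, blockKer (j - k) * V k ≤ (∑' m, blockKer m) * ∑ k ∈ F, V k := by
  rw [Finset.sum_comm]
  refine le_trans (le_of_eq ?_) (sum_sum_blockKer_le F V)
  refine Finset.sum_congr rfl fun j _ => Finset.sum_congr rfl fun k _ => ?_
  rw [blockKer, blockKer]
  congr 4
  push_cast
  ring

/-- The restriction of a function to the slab `|x_0 - j| ≤ 1`. -/
noncomputable def slab {n : ℕ} [NeZero n] (j : ℤ) (v : Vec n → ℂ) : Vec n → ℂ :=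
  {x | |x 0 - (j : ℝ)| ≤ 1}.indicator v

lemma measurableSet_slab {n : ℕ} [NeZero n] (j : ℤ) :
    MeasurableSet {x : Vec n | |x 0 - (j : ℝ)| ≤ 1} := by
  refine (isClosed_le ?_ continuous_const).measurableSet
  fun_prop

lemma sum_lintegral_slab_le {n : ℕ} [NeZero n] (F : Finset ℤ) {v : Vec n → ℂ} (hv : Measurable v) :
    ∑ j ∈ F, ∫⁻ x, ‖slab j v x‖ₑ ^ 2 ≤ 3 * ∫⁻ x, ‖v x‖ₑ ^ 2 := by
  have hm : ∀ j ∈ F, Measurable fun x => ‖slab j v x‖ₑ ^ 2 := fun j _ =>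
    (hv.indicator (measurableSet_slab j)).enorm.pow_const 2
  rw [← lintegral_finsetSum F hm,
    ← lintegral_const_mul _ (hv.enorm.pow_const 2)]
  refine lintegral_mono fun x => ?_
  have h1 : ∀ j : ℤ, ‖slab j v x‖ₑ ^ 2 = if |x 0 - (j : ℝ)| ≤ 1 then ‖v x‖ₑ ^ 2 else 0 := by
    intro j
    simp only [slab, Set.indicator_apply, Set.mem_ofPred_eq]
    split_ifs <;> simp
  simp only [h1]
  rw [← Finset.sum_filter, Finset.sum_const, nsmul_eq_mul]
  refine mul_le_mul_left ?_ _
  have h2 : (F.filter fun j : ℤ => |x 0 - (j : ℝ)| ≤ 1) ⊆ Finset.Icc (⌊x 0⌋ - 1) (⌊x 0⌋ + 1) := by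
    intro j hj
    have h3 := abs_le.1 (Finset.mem_filter.1 hj).2
    have h4 := Int.floor_le (x 0)
    have h5 := Int.lt_floor_add_one (x 0)
    rw [Finset.mem_Icc]
    constructor
    · have : ((⌊x 0⌋ - 1 : ℤ) : ℝ) ≤ j := by push_cast; linarith
      exact_mod_cast this
    · have : (j : ℝ) < ((⌊x 0⌋ + 2 : ℤ) : ℝ) := by push_cast; linarith
      have : j < ⌊x 0⌋ + 2 := by exact_mod_cast this
      omega
  have h6 := Finset.card_le_card h2
  rw [Int.card_Icc] at h6
  have h7 : (F.filter fun j : ℤ => |x 0 - (j : ℝ)| ≤ 1).card ≤ 3 := by omega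
  exact_mod_cast h7

/-- The regularised amplitude of the operator. -/
noncomputable def fullSym {n : ℕ} (a : Vec n → Vec n → Vec n → ℂ) (h ε : ℝ) (X : Tri n) : ℂ :=
  a X.1 (h • X.2.1) X.2.2 * ∏ i, resK 4 (ε * X.2.1 i)

lemma norm_prod_resK_le {n : ℕ} (ε : ℝ) (ξ : Vec n) :
    ‖∏ i, resK 4 (ε * ξ i)‖ ≤ ∏ i, ((1 + (ε * ξ i) ^ 2)⁻¹) ^ 2 := by
  rw [norm_prod]
  exact Finset.prod_le_prod (fun i _ => norm_nonneg _) fun i _ => norm_resK_four_add_le 0 _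

lemma norm_fullSym_le {n : ℕ} [NeZero n] {lam : ℝ → ℝ} {t : ℝ}
    {a : Vec n → Vec n → Vec n → ℂ} (ha : IsBisymbol lam 0 0 t a) (h ε : ℝ) (X : Tri n) :
    ‖fullSym a h ε X‖ ≤ biSup a * ∏ i, ((1 + (ε * X.2.1 i) ^ 2)⁻¹) ^ 2 := by
  rw [fullSym, norm_mul]
  exact mul_le_mul (norm_le_biSup ha _ _ _) (norm_prod_resK_le _ _) (norm_nonneg _)
    ((norm_nonneg _).trans (norm_le_biSup ha 0 0 0))

lemma continuous_fullSym {n : ℕ} {a : Vec n → Vec n → Vec n → ℂ}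
    (ha : ContDiff ℝ (⊤ : ℕ∞) fun X : Tri n => a X.1 X.2.1 X.2.2) (h ε : ℝ) :
    Continuous (fullSym a h ε) := by
  have h2 : Continuous fun X : Tri n => a X.1 (h • X.2.1) X.2.2 :=
    ha.continuous.comp (by fun_prop : Continuous fun X : Tri n => (X.1, h • X.2.1, X.2.2))
  exact h2.mul (continuous_finsetProd _ fun i _ => (continuous_resK 4).comp (by fun_prop))

lemma integrable_fullSym_mul_oscF {n : ℕ} [NeZero n] {lam : ℝ → ℝ} {t : ℝ}
    {a : Vec n → Vec n → Vec n → ℂ} (ha : IsBisymbol lam 0 0 t a) (h : ℝ) {ε : ℝ} (hε : ε ≠ 0)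
    {u v : Vec n → ℂ} (hum : Measurable u) (hvm : Measurable v) (hu : Integrable u)
    (hv : Integrable v) : Integrable fun X => fullSym a h ε X * oscF u v X := by
  refine (integrable_tri ((integrable_prod_inv_sq (ν := fun _ => ε) fun _ => hε).const_mul (biSup a))
    hu hv).mono' ((continuous_fullSym ha.1 h ε).measurable.mul
      (measurable_oscF hum hvm)).aestronglyMeasurable (Filter.Eventually.of_forall fun X => ?_)
  rw [norm_mul, norm_oscF]
  exact mul_le_mul_of_nonneg_right (norm_fullSym_le ha h ε X) (by positivity)

lemma blockSym_mul_oscF_slab {n : ℕ} [NeZero n] (a : Vec n → Vec n → Vec n → ℂ) (h ε : ℝ) (j k : ℤ)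
    (u v : Vec n → ℂ) (X : Tri n) :
    blockSym a h ε j k X * oscF (slab k u) (slab j v) X =
      bump (X.1 0 - j) * bump (X.2.2 0 - k) * (fullSym a h ε X * oscF u v X) := by
  by_cases h1 : |X.1 0 - (j : ℝ)| ≤ 1
  swap
  · simp [blockSym, bump_eq_zero (not_le.1 h1).le]
  by_cases h2 : |X.2.2 0 - (k : ℝ)| ≤ 1
  swap
  · simp [blockSym, bump_eq_zero (not_le.1 h2).le]
  have e1 : slab j v X.1 = v X.1 := Set.indicator_of_mem (by exact h1) v
  have e2 : slab k u X.2.2 = u X.2.2 := Set.indicator_of_mem (by exact h2) u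
  rw [oscF, oscF, e1, e2, blockSym, fullSym]
  ring

lemma biSup_add_mul_bisymSeminorm_nonneg {n : ℕ} [NeZero n] {lam : ℝ → ℝ} (hlam : ∀ r, 0 < lam r)
    {t : ℝ} {a : Vec n → Vec n → Vec n → ℂ} (ha : IsBisymbol lam 0 0 t a) (h : ℝ) (M : ℕ) :
    0 ≤ biSup a + √h * bisymSeminorm lam M 0 0 t a := by
  have h1 : 0 ≤ bisymSeminorm lam M 0 0 t a := by
    have := prod_dirWt_mul_norm_itD_le hlam ha (M := M) [] (by simp) 0 0 (0 : Tri n)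
      (by simp) (by simp)
    exact le_trans (by simp) this
  exact add_nonneg ((norm_nonneg _).trans (norm_le_biSup ha 0 0 0))
    (mul_nonneg (Real.sqrt_nonneg _) h1)

theorem exists_enorm_integral_fullSym_le (n : ℕ) [NeZero n] : ∃ C : ℝ, 0 < C ∧
    ∀ lam : ℝ → ℝ, (∀ r, 0 < lam r) → ∀ (t : ℝ) (a : Vec n → Vec n → Vec n → ℂ),
    IsBisymbol lam 0 0 t a → ∀ h, 0 < h → h ≤ 1 → ∀ (J : ℕ) (ε : ℝ), 0 < ε → ε ≤ √h →
    (∀ j ∈ Finset.Icc (-(J : ℤ)) J, ∀ k ∈ Finset.Icc (-(J : ℤ)) J, ε * lamT lam t j k ≤ √h) →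
    ∀ u v : Vec n → ℂ, Measurable u → Measurable v → Integrable u → Integrable v →
    (∀ y, u y ≠ 0 → |y 0| ≤ J) → (∀ x, v x ≠ 0 → |x 0| ≤ J) →
    ∀ s : ℝ≥0∞, s ≠ 0 → s ≠ ⊤ →
      2 * ‖∫ X, fullSym a h ε X * oscF u v X‖ₑ ≤
        ENNReal.ofReal (C * (biSup a + √h * bisymSeminorm lam (6 * n) 0 0 t a)) *
        (s * (∫⁻ x, ‖v x‖ₑ ^ 2) + s⁻¹ * ∫⁻ y, ‖u y‖ₑ ^ 2) := by
  obtain ⟨C, hC, H⟩ := exists_enorm_integral_blockSym_le n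
  obtain ⟨Cb, hCb1, hCb⟩ := exists_iteratedDeriv_bump_bound 0
  set κ := ∑' m : ℤ, blockKer m with hκ
  have hκt : κ ≠ ⊤ := tsum_blockKer_ne_top
  refine ⟨C * (3 * κ.toReal + 1), by positivity, ?_⟩
  intro lam hlam t a ha h hh0 hh1 J ε hε0 hε1 hε2 u v hum hvm hu hv hus hvs s hs hs'
  set F := Finset.Icc (-(J : ℤ)) J with hF
  set B := biSup a + √h * bisymSeminorm lam (6 * n) 0 0 t a with hB
  have hB0 : 0 ≤ B := biSup_add_mul_bisymSeminorm_nonneg hlam ha h _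
  have hI := integrable_fullSym_mul_oscF ha h hε0.ne' hum hvm hu hv
  have hIjk : ∀ j k : ℤ, Integrable fun X : Tri n =>
      bump (X.1 0 - j) * bump (X.2.2 0 - k) * (fullSym a h ε X * oscF u v X) := by
    intro j k
    have hc : Continuous fun X : Tri n => bump (X.1 0 - j) * bump (X.2.2 0 - k) :=
      (contDiff_bump.continuous.comp (by fun_prop)).mul
        (contDiff_bump.continuous.comp (by fun_prop))
    refine hI.bdd_mul (c := Cb * Cb) hc.aestronglyMeasurable
      (Filter.Eventually.of_forall fun X => ?_)
    rw [norm_mul]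
    have hb : ∀ r, ‖bump r‖ ≤ Cb := fun r => by simpa using hCb 0 le_rfl r
    exact mul_le_mul (hb _) (hb _) (norm_nonneg _) (by linarith)
  have hsum : ∫ X, fullSym a h ε X * oscF u v X =
      ∑ j ∈ F, ∑ k ∈ F, ∫ X, blockSym a h ε j k X * oscF (slab k u) (slab j v) X := by
    simp only [blockSym_mul_oscF_slab]
    have e : ∀ j ∈ F, ∑ k ∈ F, ∫ X : Tri n,
        bump (X.1 0 - j) * bump (X.2.2 0 - k) * (fullSym a h ε X * oscF u v X) =
        ∫ X : Tri n, ∑ k ∈ F,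
          bump (X.1 0 - j) * bump (X.2.2 0 - k) * (fullSym a h ε X * oscF u v X) :=
      fun j _ => (integral_finsetSum _ fun k _ => hIjk j k).symm
    rw [Finset.sum_congr rfl e,
      ← integral_finsetSum _ fun j _ => integrable_finsetSum _ fun k _ => hIjk j k]
    refine integral_congr_ae (Filter.Eventually.of_forall fun X => ?_)
    simp only
    by_cases hz : u X.2.2 * v X.1 = 0
    · simp [oscF, hz]
    have h1 := sum_bump_eq_one J (hvs _ (right_ne_zero_of_mul hz))
    have h2 := sum_bump_eq_one J (hus _ (left_ne_zero_of_mul hz))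
    simp only [← Finset.sum_mul, ← Finset.mul_sum, hF, h1, h2, one_mul]
  have hmeasS : ∀ (j : ℤ) (g : Vec n → ℂ), Measurable g → Measurable (slab j g) :=
    fun j g hg => hg.indicator (measurableSet_slab j)
  have hintS : ∀ (j : ℤ) (g : Vec n → ℂ), Integrable g → Integrable (slab j g) :=
    fun j g hg => hg.indicator (measurableSet_slab j)
  calc 2 * ‖∫ X, fullSym a h ε X * oscF u v X‖ₑ
      ≤ 2 * ∑ j ∈ F, ∑ k ∈ F,
          ‖∫ X, blockSym a h ε j k X * oscF (slab k u) (slab j v) X‖ₑ := by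
        rw [hsum]
        exact mul_le_mul_right ((enorm_sum_le _ _).trans
          (Finset.sum_le_sum fun j _ => enorm_sum_le _ _)) _
    _ = ∑ j ∈ F, ∑ k ∈ F,
          2 * ‖∫ X, blockSym a h ε j k X * oscF (slab k u) (slab j v) X‖ₑ := by
        simp only [Finset.mul_sum]
    _ ≤ ∑ j ∈ F, ∑ k ∈ F, ENNReal.ofReal (C * B) * (s * (blockKer (j - k) *
          ∫⁻ x, ‖slab j v x‖ₑ ^ 2) + s⁻¹ * (blockKer (j - k) * ∫⁻ x, ‖slab k u x‖ₑ ^ 2)) := by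
        refine Finset.sum_le_sum fun j hj => Finset.sum_le_sum fun k hk => ?_
        refine (H lam hlam t a ha h hh0 hh1 j k ε hε0 hε1 (hε2 j hj k hk) _ _ (hmeasS k u hum)
          (hmeasS j v hvm) (hintS k u hu) (hintS j v hv) s hs hs').trans_eq ?_
        rw [div_eq_mul_one_div, ENNReal.ofReal_mul (by positivity)]
        have : blockKer (j - k) = ENNReal.ofReal (1 / (1 + ((j : ℝ) - k) ^ 2)) := by
          rw [blockKer]; push_cast; rfl
        rw [this]
        ring
    _ = ENNReal.ofReal (C * B) * (s * (∑ j ∈ F, ∑ k ∈ F, blockKer (j - k) *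
          ∫⁻ x, ‖slab j v x‖ₑ ^ 2) + s⁻¹ * ∑ j ∈ F, ∑ k ∈ F, blockKer (j - k) *
            ∫⁻ x, ‖slab k u x‖ₑ ^ 2) := by
        simp only [Finset.mul_sum, ← Finset.sum_add_distrib, mul_add]
    _ ≤ ENNReal.ofReal (C * B) * (s * (κ * (3 * ∫⁻ x, ‖v x‖ₑ ^ 2)) +
          s⁻¹ * (κ * (3 * ∫⁻ x, ‖u x‖ₑ ^ 2))) := by
        refine mul_le_mul_right (add_le_add (mul_le_mul_right ?_ _) (mul_le_mul_right ?_ _)) _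
        · exact (sum_sum_blockKer_le F fun j => ∫⁻ x, ‖slab j v x‖ₑ ^ 2).trans
            (mul_le_mul_right (sum_lintegral_slab_le F hvm) _)
        · exact (sum_sum_blockKer_le' F fun j => ∫⁻ x, ‖slab j u x‖ₑ ^ 2).trans
            (mul_le_mul_right (sum_lintegral_slab_le F hum) _)
    _ = ENNReal.ofReal (C * B * (3 * κ.toReal)) *
          (s * (∫⁻ x, ‖v x‖ₑ ^ 2) + s⁻¹ * ∫⁻ y, ‖u y‖ₑ ^ 2) := by
        rw [ENNReal.ofReal_mul (p := C * B) (by positivity),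
          ENNReal.ofReal_mul (p := (3 : ℝ)) (by norm_num), ENNReal.ofReal_toReal hκt]
        simp only [ENNReal.ofReal_ofNat]
        ring
    _ ≤ _ := by
        refine mul_le_mul_left (ENNReal.ofReal_le_ofReal ?_) _
        nlinarith [mul_nonneg hC.le hB0]

end Summation

section Conclusion

open scoped ENNReal

/-- The inner integral in the definition of `Oph`. -/
noncomputable def fiberInt {n : ℕ} (a : Vec n → Vec n → Vec n → ℂ) (h : ℝ) (u : Vec n → ℂ)
    (q p : Vec n) : ℂ :=
  ∫ y, a q (h • p) y * phase p q y * u y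

/-- The regularisation of the operator `Oph`, without its normalising constant. -/
noncomputable def regOp {n : ℕ} (a : Vec n → Vec n → Vec n → ℂ) (h ε : ℝ) (u : Vec n → ℂ)
    (q : Vec n) : ℂ :=
  ∫ p, (∏ i, resK 4 (ε * p i)) * fiberInt a h u q p

lemma measurable_fiberInt {n : ℕ} {a : Vec n → Vec n → Vec n → ℂ}
    (ha : ContDiff ℝ (⊤ : ℕ∞) fun X : Tri n => a X.1 X.2.1 X.2.2) (h : ℝ) {u : Vec n → ℂ}
    (hu : Measurable u) : Measurable fun z : Vec n × Vec n => fiberInt a h u z.1 z.2 := by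
  have h1 : Continuous fun z : (Vec n × Vec n) × Vec n => a z.1.1 (h • z.1.2) z.2 :=
    ha.continuous.comp
      (by fun_prop : Continuous fun z : (Vec n × Vec n) × Vec n => (z.1.1, h • z.1.2, z.2))
  have h2 : Continuous fun z : (Vec n × Vec n) × Vec n => phase z.1.2 z.1.1 z.2 := by
    unfold phase; fun_prop
  have h3 : Measurable fun z : (Vec n × Vec n) × Vec n =>
      a z.1.1 (h • z.1.2) z.2 * phase z.1.2 z.1.1 z.2 * u z.2 :=
    (h1.mul h2).measurable.mul (hu.comp measurable_snd)
  exact (h3.stronglyMeasurable.integral_prod_right (ν := volume)).measurable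

lemma continuous_prod_resK {n : ℕ} (ε : ℝ) :
    Continuous fun p : Vec n => ∏ i, resK 4 (ε * p i) :=
  continuous_finsetProd _ fun i _ => (continuous_resK 4).comp (by fun_prop)

lemma measurable_regOp {n : ℕ} {a : Vec n → Vec n → Vec n → ℂ}
    (ha : ContDiff ℝ (⊤ : ℕ∞) fun X : Tri n => a X.1 X.2.1 X.2.2) (h ε : ℝ) {u : Vec n → ℂ}
    (hu : Measurable u) : Measurable (regOp a h ε u) := by
  have h3 : Measurable fun z : Vec n × Vec n =>
      (∏ i, resK 4 (ε * z.2 i)) * fiberInt a h u z.1 z.2 :=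
    ((continuous_prod_resK ε).measurable.comp measurable_snd).mul (measurable_fiberInt ha h hu)
  exact (h3.stronglyMeasurable.integral_prod_right (ν := volume)).measurable

lemma norm_phase {n : ℕ} (p q q' : Vec n) : ‖phase p q q'‖ = 1 := norm_chr (q - q') p

lemma norm_fiberInt_le {n : ℕ} [NeZero n] {lam : ℝ → ℝ} {t : ℝ}
    {a : Vec n → Vec n → Vec n → ℂ} (ha : IsBisymbol lam 0 0 t a) (h : ℝ) {u : Vec n → ℂ}
    (hu : Integrable u) (q p : Vec n) : ‖fiberInt a h u q p‖ ≤ biSup a * ∫ y, ‖u y‖ := by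
  rw [← integral_const_mul]
  refine norm_integral_le_of_norm_le (hu.norm.const_mul _) (Filter.Eventually.of_forall fun y => ?_)
  rw [norm_mul, norm_mul, norm_phase, mul_one]
  exact mul_le_mul_of_nonneg_right (norm_le_biSup ha _ _ _) (norm_nonneg _)

lemma exists_norm_regOp_le {n : ℕ} [NeZero n] {lam : ℝ → ℝ} {t : ℝ}
    {a : Vec n → Vec n → Vec n → ℂ} (ha : IsBisymbol lam 0 0 t a) (h : ℝ) {ε : ℝ} (hε : ε ≠ 0)
    {u : Vec n → ℂ} (hu : Integrable u) : ∃ K, ∀ q, ‖regOp a h ε u q‖ ≤ K := by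
  have hB : 0 ≤ biSup a := (norm_nonneg _).trans (norm_le_biSup ha 0 0 0)
  refine ⟨_, fun q => norm_integral_le_of_norm_le
    ((integrable_prod_inv_sq (ν := fun _ : Fin n => ε) fun _ => hε).mul_const
      (biSup a * ∫ y, ‖u y‖)) (Filter.Eventually.of_forall fun p => ?_)⟩
  rw [norm_mul]
  exact mul_le_mul (norm_prod_resK_le _ _) (norm_fiberInt_le ha h hu q p) (norm_nonneg _)
    (by positivity)

lemma integral_mul_regOp {n : ℕ} [NeZero n] {lam : ℝ → ℝ} {t : ℝ}
    {a : Vec n → Vec n → Vec n → ℂ} (ha : IsBisymbol lam 0 0 t a) (h : ℝ) {ε : ℝ} (hε : ε ≠ 0)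
    {u v : Vec n → ℂ} (hum : Measurable u) (hvm : Measurable v) (hu : Integrable u)
    (hv : Integrable v) :
    ∫ X, fullSym a h ε X * oscF u v X = ∫ q, v q * regOp a h ε u q := by
  have hI := integrable_fullSym_mul_oscF ha h hε hum hvm hu hv
  rw [Measure.volume_eq_prod] at hI ⊢
  rw [integral_prod _ hI]
  refine integral_congr_ae ?_
  filter_upwards [hI.prod_right_ae] with q hq
  rw [Measure.volume_eq_prod] at hq ⊢
  rw [integral_prod _ hq, regOp, ← integral_const_mul]
  refine integral_congr_ae (Filter.Eventually.of_forall fun p => ?_)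
  simp only [fiberInt]
  rw [← integral_const_mul, ← integral_const_mul]
  refine integral_congr_ae (Filter.Eventually.of_forall fun y => ?_)
  have : phase p q y = chr (q - y) p := rfl
  simp only [fullSym, oscF, this]
  ring

lemma le_sq_mul_of_forall_two_mul_le {N N' D : ℝ≥0∞} (hN : N ≠ ⊤) (hD : D ≠ ⊤)
    (H : ∀ s : ℝ≥0∞, s ≠ 0 → s ≠ ⊤ → 2 * N ≤ D * (s * N + s⁻¹ * N')) : N ≤ D ^ 2 * N' := by
  by_cases h0 : D = 0
  · have := H 1 one_ne_zero ENNReal.one_ne_top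
    rw [h0, zero_mul] at this
    have : N = 0 := by simpa using this
    simp [this]
  have h1 := H D⁻¹ (ENNReal.inv_ne_zero.2 hD) (ENNReal.inv_ne_top.2 h0)
  rw [mul_add, ← mul_assoc, ENNReal.mul_inv_cancel h0 hD, one_mul, inv_inv, two_mul,
    ← mul_assoc, ← sq] at h1
  exact (ENNReal.add_le_add_iff_left hN).1 h1

/-- The norm bound for the regularised operators on large balls. -/
theorem exists_setLIntegral_regOp_le (n : ℕ) [NeZero n] : ∃ C : ℝ, 0 < C ∧
    ∀ lam : ℝ → ℝ, (∀ r, 0 < lam r) → ∀ (t : ℝ) (a : Vec n → Vec n → Vec n → ℂ),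
    IsBisymbol lam 0 0 t a → ∀ h, 0 < h → h ≤ 1 → ∀ (J : ℕ) (ε : ℝ), 0 < ε → ε ≤ √h →
    (∀ j ∈ Finset.Icc (-(J : ℤ)) J, ∀ k ∈ Finset.Icc (-(J : ℤ)) J, ε * lamT lam t j k ≤ √h) →
    ∀ u : Vec n → ℂ, Measurable u → Integrable u → (∀ y, u y ≠ 0 → |y 0| ≤ J) →
    ∀ m : ℕ, m ≤ J →
      ∫⁻ q in Metric.closedBall 0 (m : ℝ), ‖regOp a h ε u q‖ₑ ^ 2 ≤
        ENNReal.ofReal (C * (biSup a + √h * bisymSeminorm lam (6 * n) 0 0 t a)) ^ 2 *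
          ∫⁻ y, ‖u y‖ₑ ^ 2 := by
  obtain ⟨C, hC, H⟩ := exists_enorm_integral_fullSym_le n
  refine ⟨C, hC, ?_⟩
  intro lam hlam t a ha h hh0 hh1 J ε hε0 hε1 hε2 u hum hu hus m hm
  set S : Set (Vec n) := Metric.closedBall 0 (m : ℝ) with hS
  have hSm : MeasurableSet S := Metric.isClosed_closedBall.measurableSet
  have hSf : volume S ≠ ⊤ := measure_closedBall_lt_top.ne
  obtain ⟨K, hK⟩ := exists_norm_regOp_le ha h hε0.ne' hu
  have hRm := measurable_regOp ha.1 h ε hum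
  set v : Vec n → ℂ := S.indicator fun q => starRingEnd ℂ (regOp a h ε u q) with hv
  have hvm : Measurable v := (Complex.continuous_conj.measurable.comp hRm).indicator hSm
  have hvi : Integrable v := by
    refine (integrable_indicator_iff hSm).2
      (Measure.integrableOn_of_bounded (M := K) hSf
        (Complex.continuous_conj.measurable.comp hRm).aestronglyMeasurable
        (Filter.Eventually.of_forall fun q => ?_))
    simpa using hK q
  have hvs : ∀ x, v x ≠ 0 → |x 0| ≤ J := by
    intro x hx
    have h1 : x ∈ S := Set.mem_of_indicator_ne_zero hx
    rw [hS, mem_closedBall_zero_iff] at h1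
    exact ((norm_le_pi_norm x 0).trans h1).trans (by exact_mod_cast hm)
  have hsq : ∀ q, v q * regOp a h ε u q = ((‖v q‖ ^ 2 : ℝ) : ℂ) := by
    intro q
    by_cases hq : q ∈ S
    · simp only [hv, Set.indicator_of_mem hq]
      rw [mul_comm, Complex.mul_conj, RCLike.norm_conj, Complex.normSq_eq_norm_sq]
    · simp [hv, Set.indicator_of_notMem hq]
  have hsqi : Integrable fun q => ‖v q‖ ^ 2 := by
    have : Integrable fun q => ‖v q‖ * ‖v q‖ := by
      refine hvi.norm.mul_bdd (c := K) hvm.norm.aestronglyMeasurable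
        (Filter.Eventually.of_forall fun q => ?_)
      by_cases hq : q ∈ S
      · simpa [hv, Set.indicator_of_mem hq] using hK q
      · simpa [hv, Set.indicator_of_notMem hq] using (norm_nonneg _).trans (hK q)
    simpa only [sq] using this
  have hoR : ∀ q, ENNReal.ofReal (‖v q‖ ^ 2) = ‖v q‖ₑ ^ 2 := fun q => by
    rw [ENNReal.ofReal_pow (norm_nonneg _), ofReal_norm]
  have hNv : ‖∫ X, fullSym a h ε X * oscF u v X‖ₑ = ∫⁻ q, ‖v q‖ₑ ^ 2 := by
    rw [integral_mul_regOp ha h hε0.ne' hum hvm hu hvi]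
    simp only [hsq]
    rw [integral_complex_ofReal, ← ofReal_norm, Complex.norm_real,
      Real.norm_of_nonneg (integral_nonneg fun q => by positivity),
      ofReal_integral_eq_lintegral_ofReal hsqi (Filter.Eventually.of_forall fun q => by positivity)]
    simp only [hoR]
  have hfin : ∫⁻ q, ‖v q‖ₑ ^ 2 ≠ ⊤ := hNv ▸ enorm_ne_top
  have hmain := le_sq_mul_of_forall_two_mul_le hfin ENNReal.ofReal_ne_top fun s hs hs' => by
    have := H lam hlam t a ha h hh0 hh1 J ε hε0 hε1 hε2 u v hum hvm hu hvi hus hvs s hs hs'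
    rwa [hNv] at this
  refine le_of_eq_of_le ?_ hmain
  rw [← lintegral_indicator hSm]
  refine lintegral_congr fun q => ?_
  by_cases hq : q ∈ S
  · simp only [hv, Set.indicator_of_mem hq]
    rw [← ofReal_norm, ← ofReal_norm, RCLike.norm_conj]
  · simp [hv, Set.indicator_of_notMem hq]

lemma tendsto_regOp {n : ℕ} {a : Vec n → Vec n → Vec n → ℂ} {h : ℝ} {u : Vec n → ℂ} {q : Vec n}
    (hq : Integrable (fiberInt a h u q)) {ε : ℕ → ℝ} (hε : Filter.Tendsto ε Filter.atTop (nhds 0)) :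
    Filter.Tendsto (fun m => regOp a h (ε m) u q) Filter.atTop
      (nhds (∫ p, fiberInt a h u q p)) := by
  refine tendsto_integral_of_dominated_convergence (fun p => ‖fiberInt a h u q p‖)
    (fun m => (continuous_prod_resK _).aestronglyMeasurable.mul hq.aestronglyMeasurable) hq.norm
    (fun m => Filter.Eventually.of_forall fun p => ?_) (Filter.Eventually.of_forall fun p => ?_)
  · rw [norm_mul, norm_prod]
    exact mul_le_of_le_one_left (norm_nonneg _)
      (Finset.prod_le_one (fun _ _ => norm_nonneg _) fun _ _ => norm_resK_le_one _ _)
  · have hc : Continuous fun e : ℝ => (∏ i, resK 4 (e * p i)) * fiberInt a h u q p :=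
      (continuous_finsetProd _ fun i _ => (continuous_resK 4).comp (by fun_prop)).mul
        continuous_const
    have := (hc.tendsto 0).comp hε
    simp only [zero_mul, resK_zero_right, Finset.prod_const_one, one_mul] at this
    exact this

lemma exists_regularisation_parameter (lam : ℝ → ℝ) (hlam : ∀ r, 0 < lam r) (t : ℝ) {h : ℝ}
    (h0 : 0 < h) (h1 : h ≤ 1) (J m : ℕ) : ∃ ε : ℝ, 0 < ε ∧ ε ≤ √h ∧ ε ≤ 1 / ((m : ℝ) + 1) ∧
      ∀ j ∈ Finset.Icc (-(J : ℤ)) J, ∀ k ∈ Finset.Icc (-(J : ℤ)) J,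
        ε * lamT lam t j k ≤ √h := by
  set F := Finset.Icc (-(J : ℤ)) J
  have hpos : ∀ j k, 0 ≤ lamT lam t j k := fun j k => (hlam _).le
  set S := 1 + ∑ j ∈ F, ∑ k ∈ F, lamT lam t j k with hS
  have hS1 : 1 ≤ S :=
    le_add_of_nonneg_right (Finset.sum_nonneg fun j _ => Finset.sum_nonneg fun k _ => hpos j k)
  have hsh : 0 < √h := Real.sqrt_pos.2 h0
  have hsh1 : √h ≤ 1 := Real.sqrt_le_one.2 h1
  have hm : (1 : ℝ) ≤ m + 1 := by simp
  refine ⟨√h / (S * (m + 1)), by positivity, div_le_self hsh.le (one_le_mul_of_one_le_of_one_le hS1 hm),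
    ?_, fun j hj k hk => ?_⟩
  · exact div_le_div₀ zero_le_one hsh1 (by positivity) (le_mul_of_one_le_left (by positivity) hS1)
  · have h2 : lamT lam t j k ≤ S := by
      have e1 := Finset.single_le_sum (f := fun k => lamT lam t j k) (fun k _ => hpos j k) hk
      have e2 := Finset.single_le_sum (f := fun j => ∑ k ∈ F, lamT lam t j k)
        (fun j _ => Finset.sum_nonneg fun k _ => hpos j k) hj
      linarith
    rw [div_mul_eq_mul_div, div_le_iff₀ (by positivity)]
    exact mul_le_mul_of_nonneg_left (h2.trans (le_mul_of_one_le_right (by positivity) hm)) hsh.le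

theorem exists_lintegral_Oph_le (n : ℕ) [NeZero n] : ∃ C : ℝ, 0 < C ∧
    ∀ lam : ℝ → ℝ, (∀ r, 0 < lam r) → ∀ (t : ℝ) (a : Vec n → Vec n → Vec n → ℂ),
    IsBisymbol lam 0 0 t a → ∀ h, 0 < h → h ≤ 1 →
    ∀ u : Vec n → ℂ, Continuous u → HasCompactSupport u →
      ∫⁻ q, ‖∫ p, fiberInt a h u q p‖ₑ ^ 2 ≤
        ENNReal.ofReal (C * (biSup a + √h * bisymSeminorm lam (6 * n) 0 0 t a)) ^ 2 *
          ∫⁻ y, ‖u y‖ₑ ^ 2 := by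
  obtain ⟨C, hC, H⟩ := exists_setLIntegral_regOp_le n
  refine ⟨C, hC, ?_⟩
  intro lam hlam t a ha h hh0 hh1 u huc hus
  have hui : Integrable u := huc.integrable_of_hasCompactSupport hus
  obtain ⟨R, hR⟩ := hus.isCompact.isBounded.exists_norm_le
  obtain ⟨J₀, hJ₀⟩ := exists_nat_ge R
  have hus' : ∀ m : ℕ, ∀ y, u y ≠ 0 → |y 0| ≤ ((max m J₀ : ℕ) : ℝ) := by
    intro m y hy
    refine ((norm_le_pi_norm y 0).trans (hR y (subset_tsupport u hy))).trans (hJ₀.trans ?_)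
    exact_mod_cast le_max_right _ _
  choose ε hε0 hε1 hε3 hε2 using fun m : ℕ =>
    exists_regularisation_parameter lam hlam t hh0 hh1 (max m J₀) m
  have hε : Filter.Tendsto ε Filter.atTop (nhds 0) :=
    squeeze_zero (fun m => (hε0 m).le) hε3 tendsto_one_div_add_atTop_nhds_zero_nat
  set f : ℕ → Vec n → ℝ≥0∞ := fun m => (Metric.closedBall (0 : Vec n) (m : ℝ)).indicator
    fun q => ‖regOp a h (ε m) u q‖ₑ ^ 2 with hf
  have hfm : ∀ m, Measurable (f m) := fun m =>
    ((measurable_regOp ha.1 h (ε m) huc.measurable).enorm.pow_const 2).indicator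
      Metric.isClosed_closedBall.measurableSet
  have hpt : ∀ q, ‖∫ p, fiberInt a h u q p‖ₑ ^ 2 ≤ Filter.liminf (fun m => f m q) Filter.atTop := by
    intro q
    by_cases hq : Integrable (fiberInt a h u q)
    · have h1 := ((ENNReal.continuous_pow 2).tendsto _).comp ((tendsto_regOp hq hε).enorm)
      refine (Filter.Tendsto.liminf_eq (h1.congr' ?_)).ge
      obtain ⟨m₀, hm₀⟩ := exists_nat_ge ‖q‖
      filter_upwards [Filter.eventually_ge_atTop m₀] with m hm
      have : q ∈ Metric.closedBall (0 : Vec n) (m : ℝ) := by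
        rw [mem_closedBall_zero_iff]
        exact hm₀.trans (by exact_mod_cast hm)
      simp [hf, Set.indicator_of_mem this]
    · simp [integral_undef hq]
  refine (lintegral_mono hpt).trans ((lintegral_liminf_le hfm).trans ?_)
  refine Filter.liminf_le_of_frequently_le' (Filter.Frequently.of_forall fun m => ?_)
  rw [hf, lintegral_indicator Metric.isClosed_closedBall.measurableSet]
  exact H lam hlam t a ha h hh0 hh1 (max m J₀) (ε m) (hε0 m) (hε1 m) (hε2 m) u huc.measurable hui
    (hus' m) m (le_max_left _ _)

lemma L2_le_mul_of_lintegral_le {n : ℕ} {f u : Vec n → ℂ} (hu : Integrable fun y => ‖u y‖ ^ 2)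
    {D : ℝ} (hD : 0 ≤ D)
    (H : ∫⁻ q, ‖f q‖ₑ ^ 2 ≤ ENNReal.ofReal D ^ 2 * ∫⁻ y, ‖u y‖ₑ ^ 2) : L2 f ≤ D * L2 u := by
  have hnn : 0 ≤ ∫ y, ‖u y‖ ^ 2 := integral_nonneg fun y => by positivity
  by_cases hf : Integrable fun q => ‖f q‖ ^ 2
  swap
  · rw [L2, integral_undef hf, Real.sqrt_zero]
    exact mul_nonneg hD (Real.sqrt_nonneg _)
  have key : ∀ {g : Vec n → ℂ}, (Integrable fun y => ‖g y‖ ^ 2) →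
      ∫⁻ y, ‖g y‖ₑ ^ 2 = ENNReal.ofReal (∫ y, ‖g y‖ ^ 2) := by
    intro g hg
    rw [ofReal_integral_eq_lintegral_ofReal hg
      (Filter.Eventually.of_forall fun q => by positivity)]
    refine lintegral_congr fun q => ?_
    rw [ENNReal.ofReal_pow (norm_nonneg _), ofReal_norm]
  rw [key hf, key hu, ← ENNReal.ofReal_pow hD, ← ENNReal.ofReal_mul (by positivity),
    ENNReal.ofReal_le_ofReal_iff (by positivity)] at H
  rw [L2, L2]
  calc √(∫ q, ‖f q‖ ^ 2) ≤ √(D ^ 2 * ∫ y, ‖u y‖ ^ 2) := Real.sqrt_le_sqrt H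
    _ = D * √(∫ y, ‖u y‖ ^ 2) := by rw [Real.sqrt_mul (by positivity), Real.sqrt_sq hD]

lemma enorm_Oph {n : ℕ} (a : Vec n → Vec n → Vec n → ℂ) (h : ℝ) (u : Vec n → ℂ) (q : Vec n) :
    ‖Oph h a u q‖ₑ =
      ENNReal.ofReal ((2 * Real.pi) ^ (-(n : ℤ))) * ‖∫ p, fiberInt a h u q p‖ₑ := by
  have hpi : (0 : ℝ) ≤ (2 * Real.pi) ^ (-(n : ℤ)) := by positivity
  simp only [Oph, Op, fiberInt]
  rw [enorm_mul, ← ofReal_norm (((2 * Real.pi) ^ (-(n : ℤ)) : ℝ) : ℂ), Complex.norm_real,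
    Real.norm_of_nonneg hpi]

lemma integrable_norm_sq_of_hasCompactSupport {n : ℕ} {u : Vec n → ℂ} (hu : Continuous u)
    (hus : HasCompactSupport u) : Integrable fun y => ‖u y‖ ^ 2 := by
  have h1 : Continuous fun y => ‖u y‖ ^ 2 := by fun_prop
  refine h1.integrable_of_hasCompactSupport (hus.mono' fun y hy => subset_tsupport u ?_)
  intro h0
  exact hy (by simp [h0])

end Conclusion

/-- **Theorem 3.10 (semiclassical `L²` bound).**  Let `λ` satisfy the admissibility
condition.  There are `C > 0` and `M ≥ 0` such that
`‖Op_ħ(a)‖_{L²→L²} ≤ C (‖a‖_{L^∞} + ħ^{1/2} |a|_{λ:M,0,0,t})` for all `t ∈ [0,1]`,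
all `a ∈ BS⁰₀(λ;t)` and all `ħ ∈ (0,1]`; the operator norm bound is expressed on the
dense subspace `C_c^∞(ℝⁿ)`. -/
theorem Oph_semiclassical_bound
    (n : ℕ) [NeZero n] (lam : ℝ → ℝ) (hlam : Admissible lam) :
    ∃ C > 0, ∃ M : ℕ, ∀ t ∈ Set.Icc (0 : ℝ) 1,
      ∀ a : Vec n → Vec n → Vec n → ℂ, IsBisymbol lam 0 0 t a →
        ∀ h ∈ Set.Ioc (0 : ℝ) 1, ∀ u : Vec n → ℂ, ContDiff ℝ (⊤ : ℕ∞) u → HasCompactSupport u →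
          L2 (Oph h a u)
            ≤ C * (biSup a + Real.sqrt h * bisymSeminorm lam M 0 0 t a) * L2 u := by
  obtain ⟨C, hC, H⟩ := exists_lintegral_Oph_le n
  have hpi : (0 : ℝ) < (2 * Real.pi) ^ (-(n : ℤ)) := by positivity
  refine ⟨(2 * Real.pi) ^ (-(n : ℤ)) * C, by positivity, 6 * n, ?_⟩
  intro t _ a ha h hh u hu hus
  have hB := biSup_add_mul_bisymSeminorm_nonneg hlam.1 ha h (6 * n)
  refine L2_le_mul_of_lintegral_le
    (integrable_norm_sq_of_hasCompactSupport hu.continuous hus) (by positivity) ?_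
  simp only [enorm_Oph, mul_pow]
  rw [lintegral_const_mul' _ _ (by finiteness), mul_assoc ((2 * Real.pi) ^ (-(n : ℤ)) : ℝ),
    ENNReal.ofReal_mul hpi.le, mul_pow, mul_assoc]
  exact mul_le_mul_right (H lam hlam.1 t a ha h hh.1 hh.2 u hu.continuous hus) _
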